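/- There exists a constant c > 0 such that for every integer n ≥ 2, every skew-corner-free subset A of [n] × [n] satisfies |A| ≤ exp(−c · (log n)^{1/12}) · n². -/

import Mathlib

open scoped BigOperators Classical

noncomputable section

namespace SkewPaper

variable {G : Type*}

/-- Expectation (average) of `f` over a finite type: `E[f] = (1/|G|) ∑ x, f x`. -/
def expect [Fintype G] (f : G → ℝ) : ℝ := (∑ x, f x) / (Fintype.card G)

/-- Normalized inner product `⟨f, g⟩ = E_{x∈G} f(x) g(x)`. -/
def inprod [Fintype G] (f g : G → ℝ) : ℝ := expect (fun x => f x * g x)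

/-- Convolution `(f ∗ g)(x) = E_{y∈G} f(y) g(x − y)`. -/
def conv [Fintype G] [AddCommGroup G] (f g : G → ℝ) : G → ℝ :=
  fun x => expect (fun y => f y * g (x - y))

/-- Difference convolution `(f ∘ g)(x) = E_{y∈G} f(y) g(x + y)`. -/
def dconv [Fintype G] [AddCommGroup G] (f g : G → ℝ) : G → ℝ :=
  fun x => expect (fun y => f y * g (x + y))

/-- Indicator function `1_A` of a set `A`. -/
def ind (A : Set G) : G → ℝ := Set.indicator A (fun _ => (1 : ℝ))

/-- Normalized indicator `μ_A = (|G|/|A|) · 1_A`. -/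
def muSet [Fintype G] (A : Set G) : G → ℝ :=
  fun x => ((Fintype.card G : ℝ) / (Nat.card A : ℝ)) * ind A x

/-- `μ_f = f / E[f]`, the normalization of `f` to have mean 1. -/
def muFun [Fintype G] (f : G → ℝ) : G → ℝ := fun x => f x / expect f

/-- Weighted `L^p` norm `‖f‖_{p(ν)} = (E_x ν(x) |f(x)|^p)^{1/p}`. -/
def wnorm [Fintype G] (p : ℕ) (ν f : G → ℝ) : ℝ :=
  (expect (fun x => ν x * |f x| ^ p)) ^ ((p : ℝ)⁻¹)

/-- `L^p` norm with respect to the uniform measure. -/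
def pnorm [Fintype G] (p : ℕ) (f : G → ℝ) : ℝ := wnorm p (fun _ => 1) f

/-- Sup norm `‖f‖_∞`. -/
def supNorm (f : G → ℝ) : ℝ := ⨆ x, |f x|

/-- `A` is skew-corner-free: it contains no nontrivial skew corner
`(x,y), (x,y+h), (x+h,y')` with `h ≠ 0`. -/
def IsSkewCornerFree [AddCommGroup G] (A : Set (G × G)) : Prop :=
  ∀ x y y' h : G, (x, y) ∈ A → (x, y + h) ∈ A → (x + h, y') ∈ A → h = 0

/-- The set of quadruples `(x, y, y', h)` forming a skew corner of `A`. -/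
def skewCorners [AddCommGroup G] (A : Set (G × G)) : Set (G × G × G × G) :=
  {q | (q.1, q.2.1) ∈ A ∧ (q.1, q.2.1 + q.2.2.2) ∈ A ∧ (q.1 + q.2.2.2, q.2.2.1) ∈ A}

/-- The column `A_x = {y : (x,y) ∈ A}`. -/
def col (A : Set (G × G)) (x : G) : Set G := {y | (x, y) ∈ A}

/-- A Bohr set datum: a finite frequency set of characters together with a width. -/
structure BohrSet (G : Type*) [AddCommGroup G] where
  freq : Finset (AddChar G ℂ)
  width : ℝ

namespace BohrSet

variable [AddCommGroup G]

/-- The underlying set `Bohr(Γ, φ) = {x : |1 − γ(x)| ≤ φ for all γ ∈ Γ}`. -/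
def toSet (B : BohrSet G) : Set G :=
  {x | ∀ γ ∈ B.freq, ‖(1 : ℂ) - γ x‖ ≤ B.width}

/-- The rank `|Γ|` of a Bohr set. -/
def rank (B : BohrSet G) : ℕ := B.freq.card

/-- The dilate `B_ρ = Bohr(Γ, ρφ)`. -/
def dilate (B : BohrSet G) (ρ : ℝ) : BohrSet G := ⟨B.freq, ρ * B.width⟩

/-- `B'` is a sub-Bohr set of `B` (written `B' ≤ B`): its frequency set contains
that of `B` and its width is at most that of `B`. -/
def Sub (B' B : BohrSet G) : Prop := B.freq ⊆ B'.freq ∧ B'.width ≤ B.width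

/-- A Bohr set of rank `r` is regular if for all `0 ≤ κ ≤ 1/(100r)`,
`|B_{1+κ}| ≤ (1+100κr)|B|` and `|B_{1−κ}| ≥ (1−100κr)|B|`. -/
def IsRegular (B : BohrSet G) : Prop :=
  ∀ κ : ℝ, 0 ≤ κ → κ ≤ 1 / (100 * B.rank) →
    ((Nat.card (B.dilate (1 + κ)).toSet : ℝ) ≤ (1 + 100 * κ * B.rank) * (Nat.card B.toSet : ℝ) ∧
     (Nat.card (B.dilate (1 - κ)).toSet : ℝ) ≥ (1 - 100 * κ * B.rank) * (Nat.card B.toSet : ℝ))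

/-- The density `μ(B) = |B|/|G|`. -/
def measure [Fintype G] (B : BohrSet G) : ℝ := (Nat.card B.toSet : ℝ) / (Fintype.card G : ℝ)

/-- The normalized indicator measure `μ_B`. -/
def mu [Fintype G] (B : BohrSet G) : G → ℝ := muSet B.toSet

end BohrSet


/-- (r, λ)-simultaneously spread collection of subsets of 𝔽_q^n. -/
def SimSpread {F : Type*} [Field F] [Fintype F] {n : ℕ} {ι : Type*} [Fintype ι]
    (A : ι → Set (Fin n → F)) (r : ℕ) (lam : ℝ) : Prop :=
  ∀ V : Submodule F (Fin n → F), n ≤ Module.finrank F V + r →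
    ∀ x : ι → Fin n → F,
      ∑ i, ((Nat.card ↥(((fun a => a - x i) '' A i) ∩ (V : Set (Fin n → F))) : ℝ) /
            (Nat.card (V : Set (Fin n → F)) : ℝ)) ^ 2 ≤
        lam * ∑ i, ((Nat.card (A i) : ℝ) / ((Fintype.card F : ℝ) ^ n)) ^ 2

/-- (r, λ)-simultaneously spread in an ambient subspace `W`. -/
def SimSpreadIn {F : Type*} [Field F] [Fintype F] {n : ℕ} {ι : Type*} [Fintype ι]
    (W : Submodule F (Fin n → F)) (A : ι → Set (Fin n → F)) (r : ℕ) (lam : ℝ) : Prop :=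
  ∀ V : Submodule F (Fin n → F), V ≤ W → Module.finrank F W ≤ Module.finrank F V + r →
    ∀ x : ι → Fin n → F, (∀ i, x i ∈ W) →
      ∑ i, ((Nat.card ↥(((fun a => a - x i) '' A i) ∩ (V : Set (Fin n → F))) : ℝ) /
            (Nat.card (V : Set (Fin n → F)) : ℝ)) ^ 2 ≤
        lam * ∑ i, ((Nat.card (A i) : ℝ) / (Nat.card (W : Set (Fin n → F)) : ℝ)) ^ 2

/-- (r, δ, λ)-simultaneously spread collection of subsets of a regular Bohr set `B`. -/
def SimSpreadBohr {G : Type*} [AddCommGroup G] [Fintype G] {ι : Type*} [Fintype ι]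
    (B : BohrSet G) (A : ι → Set G) (r : ℕ) (δ lam : ℝ) : Prop :=
  ∀ B' : BohrSet G, B'.Sub B → B'.IsRegular → B'.rank ≤ B.rank + r →
    δ * B.measure ≤ B'.measure →
    ∀ x : ι → G,
      ∑ i, ((Nat.card ↥(((fun a => a - x i) '' A i) ∩ B'.toSet) : ℝ) /
            (Nat.card B'.toSet : ℝ)) ^ 2 ≤
        lam * ∑ i, ((Nat.card (A i) : ℝ) / (Nat.card B.toSet : ℝ)) ^ 2

section Sifting

variable {T I : Type*} [Fintype I]

lemma sum_sum_pow_mul (B : Finset T) (c : I → ℝ) (u v : T → I → ℝ) (φ : T → T → ℝ) (p : ℕ) :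
    ∑ t ∈ B, ∑ t' ∈ B, (∑ i, c i * u t i * v t' i) ^ p * φ t t' =
      ∑ q : Fin p → I, (∏ j, c (q j)) *
        ∑ t ∈ B, ∑ t' ∈ B, (∏ j, u t (q j)) * (∏ j, v t' (q j)) * φ t t' := by
  simp_rw [Fintype.sum_pow, Finset.sum_mul, Finset.prod_mul_distrib, Finset.mul_sum]
  rw [Finset.sum_comm]
  rw [Finset.sum_congr rfl (fun y _ => Finset.sum_congr rfl (fun x _ => rfl))]
  rw [Finset.sum_comm]
  rw [Finset.sum_congr rfl (fun t _ => Finset.sum_comm)]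
  rw [Finset.sum_comm]
  refine Finset.sum_congr rfl fun q _ => Finset.sum_congr rfl fun t _ =>
    Finset.sum_congr rfl fun t' _ => ?_
  ring

lemma sum_sum_pow (B : Finset T) (c : I → ℝ) (u v : T → I → ℝ) (p : ℕ) :
    ∑ t ∈ B, ∑ t' ∈ B, (∑ i, c i * u t i * v t' i) ^ p =
      ∑ q : Fin p → I, (∏ j, c (q j)) *
        ((∑ t ∈ B, ∏ j, u t (q j)) * ∑ t' ∈ B, ∏ j, v t' (q j)) := by
  have := sum_sum_pow_mul B c u v (fun _ _ => 1) p
  simpa [Finset.sum_mul_sum] using this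

lemma sum_sum_pow_self_nonneg (B : Finset T) (c : I → ℝ) (hc : ∀ i, 0 ≤ c i) (u : T → I → ℝ)
    (p : ℕ) : 0 ≤ ∑ t ∈ B, ∑ t' ∈ B, (∑ i, c i * u t i * u t' i) ^ p := by
  rw [sum_sum_pow]
  exact Finset.sum_nonneg fun q _ =>
    mul_nonneg (Finset.prod_nonneg fun j _ => hc _) (mul_self_nonneg _)

lemma sum_sum_pow_le_half_add (B : Finset T) (c : I → ℝ) (hc : ∀ i, 0 ≤ c i) (u v : T → I → ℝ)
    (p : ℕ) :
    ∑ t ∈ B, ∑ t' ∈ B, (∑ i, c i * u t i * v t' i) ^ p ≤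
      (∑ t ∈ B, ∑ t' ∈ B, (∑ i, c i * u t i * u t' i) ^ p +
        ∑ t ∈ B, ∑ t' ∈ B, (∑ i, c i * v t i * v t' i) ^ p) / 2 := by
  rw [sum_sum_pow, sum_sum_pow, sum_sum_pow, ← Finset.sum_add_distrib, Finset.sum_div]
  refine Finset.sum_le_sum fun q _ => ?_
  have h : 0 ≤ ∏ j, c (q j) := Finset.prod_nonneg fun j _ => hc _
  nlinarith [mul_nonneg h (sq_nonneg ((∑ t ∈ B, ∏ j, u t (q j)) - ∑ t' ∈ B, ∏ j, v t' (q j)))]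

/-- If a nonnegative combination `K` of squares of sets has large `P`-th moment, then some
intersection of these sets is large and has almost all of its pairs in the set `{K ≥ 6/5}`. -/
lemma exists_sifted (B : Finset T) (hB : B.Nonempty) (c : I → ℝ) (hc : ∀ i, 0 ≤ c i)
    (a : I → T → Prop) (D : ℝ) (hD : 0 < D)
    (hcD : ∀ t, ∑ i, c i * (if a i t then 1 else 0) ≤ D) (P : ℕ) (hP : 40 ≤ P)
    (K : T → T → ℝ)
    (hK : ∀ t t', K t t' = ∑ i, c i * (if a i t then 1 else 0) * (if a i t' then 1 else 0))
    (h : (7 / 5 : ℝ) ^ P * (B.card : ℝ) ^ 2 ≤ ∑ t ∈ B, ∑ t' ∈ B, K t t' ^ P) :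
    ∃ A ⊆ B, (B.card : ℝ) < 2 * D ^ P * A.card ∧
      100 * ∑ t ∈ A, ∑ t' ∈ A, (if K t t' < 6 / 5 then (1 : ℝ) else 0) < (A.card : ℝ) ^ 2 := by
  set χ : T → I → ℝ := fun t i => if a i t then 1 else 0 with hχ
  have hχ01 : ∀ t i, 0 ≤ χ t i := fun t i => by simp only [hχ]; split_ifs <;> norm_num
  replace hK : ∀ t t', K t t' = ∑ i, c i * χ t i * χ t' i := hK
  replace hcD : ∀ t, ∑ i, c i * χ t i ≤ D := hcD
  have hK0 : ∀ t t', 0 ≤ K t t' := fun t t' => by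
    rw [hK]
    exact Finset.sum_nonneg fun i _ => mul_nonneg (mul_nonneg (hc i) (hχ01 t i)) (hχ01 t' i)
  set S : (Fin P → I) → Finset T := fun q => B.filter fun t => ∀ j, a (q j) t with hS
  have hprod : ∀ (q : Fin P → I) t, ∏ j, χ t (q j) =
      if ∀ j, a (q j) t then (1 : ℝ) else 0 := fun q t => by
    simp only [hχ, Finset.prod_ite_zero, Finset.prod_const_one, Finset.mem_univ, true_implies]
  set C : (Fin P → I) → ℝ := fun q => ∏ j, c (q j) with hC
  have hC0 : ∀ q, 0 ≤ C q := fun q => Finset.prod_nonneg fun j _ => hc _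
  have e1 : ∑ t ∈ B, ∑ t' ∈ B, K t t' ^ P = ∑ q, C q * ((S q).card : ℝ) ^ 2 := by
    simp_rw [hK]
    rw [sum_sum_pow B c χ χ]
    refine Finset.sum_congr rfl fun q _ => ?_
    simp only [hprod, hS, Finset.sum_boole, hC, sq]
  have e2 : ∑ q, C q * ∑ t ∈ S q, ∑ t' ∈ S q, (if K t t' < 6 / 5 then (1 : ℝ) else 0) =
      ∑ t ∈ B, ∑ t' ∈ B, K t t' ^ P * (if K t t' < 6 / 5 then (1 : ℝ) else 0) := by
    have := sum_sum_pow_mul B c χ χ (fun t t' => if K t t' < 6 / 5 then (1 : ℝ) else 0) P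
    simp_rw [← hK] at this
    rw [this]
    refine Finset.sum_congr rfl fun q _ => ?_
    congr 1
    simp only [hS, Finset.sum_filter, hprod]
    refine Finset.sum_congr rfl fun t _ => ?_
    split_ifs with h1
    · refine Finset.sum_congr rfl fun t' _ => ?_
      split_ifs <;> simp
    · simp
  have e3 : ∑ q, C q * ((S q).card : ℝ) = ∑ t ∈ B, (∑ i, c i * χ t i) ^ P := by
    simp_rw [Fintype.sum_pow, Finset.prod_mul_distrib, hprod]
    rw [Finset.sum_comm]
    refine Finset.sum_congr rfl fun q _ => ?_
    rw [← Finset.mul_sum, Finset.sum_boole]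
  have b2 : ∑ t ∈ B, ∑ t' ∈ B, K t t' ^ P * (if K t t' < 6 / 5 then (1 : ℝ) else 0) ≤
      (6 / 5 : ℝ) ^ P * (B.card : ℝ) ^ 2 := by
    have : ∀ t ∈ B, ∑ t' ∈ B, K t t' ^ P * (if K t t' < 6 / 5 then (1 : ℝ) else 0) ≤
        B.card • (6 / 5 : ℝ) ^ P := fun t _ => by
      refine Finset.sum_le_card_nsmul _ _ _ fun t' _ => ?_
      split_ifs with h1
      · rw [mul_one]; exact pow_le_pow_left₀ (hK0 _ _) h1.le _
      · rw [mul_zero]; positivity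
    refine (Finset.sum_le_card_nsmul _ _ _ this).trans (le_of_eq ?_)
    simp only [nsmul_eq_mul]; ring
  have b3 : ∑ t ∈ B, (∑ i, c i * χ t i) ^ P ≤ B.card * D ^ P := by
    rw [← nsmul_eq_mul]
    exact Finset.sum_le_card_nsmul _ _ _ fun t _ =>
      pow_le_pow_left₀ (Finset.sum_nonneg fun i _ => mul_nonneg (hc i) (hχ01 t i)) (hcD t) _
  have hn : (0 : ℝ) < B.card := by exact_mod_cast hB.card_pos
  have hDP : 0 < D ^ P := pow_pos hD P
  by_contra hcon
  push Not at hcon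
  have key : ∀ q, ((S q).card : ℝ) ^ 2 ≤
      100 * ∑ t ∈ S q, ∑ t' ∈ S q, (if K t t' < 6 / 5 then (1 : ℝ) else 0) +
        B.card / (2 * D ^ P) * (S q).card := fun q => by
    rcases lt_or_ge (B.card : ℝ) (2 * D ^ P * (S q).card) with h1 | h1
    · have := hcon (S q) (Finset.filter_subset _ _) h1
      have : 0 ≤ B.card / (2 * D ^ P) * ((S q).card : ℝ) := by positivity
      linarith
    · have h2 : ((S q).card : ℝ) ≤ B.card / (2 * D ^ P) := by
        rw [le_div_iff₀ (by positivity)]; linarith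
      have h3 : 0 ≤ ∑ t ∈ S q, ∑ t' ∈ S q, (if K t t' < 6 / 5 then (1 : ℝ) else 0) :=
        Finset.sum_nonneg fun _ _ => Finset.sum_nonneg fun _ _ => by split_ifs <;> norm_num
      have h4 : ((S q).card : ℝ) ^ 2 ≤ B.card / (2 * D ^ P) * (S q).card := by
        rw [sq]; exact mul_le_mul_of_nonneg_right h2 (by positivity)
      linarith
  have hsum : ∑ q, C q * ((S q).card : ℝ) ^ 2 ≤
      100 * (∑ q, C q * ∑ t ∈ S q, ∑ t' ∈ S q, (if K t t' < 6 / 5 then (1 : ℝ) else 0)) +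
        B.card / (2 * D ^ P) * ∑ q, C q * ((S q).card : ℝ) := by
    rw [Finset.mul_sum, Finset.mul_sum, ← Finset.sum_add_distrib]
    refine Finset.sum_le_sum fun q _ => ?_
    have := mul_le_mul_of_nonneg_left (key q) (hC0 q)
    linarith
  rw [← e1, e2, e3] at hsum
  have h5 : (B.card : ℝ) / (2 * D ^ P) * ∑ t ∈ B, (∑ i, c i * χ t i) ^ P ≤
      (B.card : ℝ) ^ 2 / 2 := by
    refine (mul_le_mul_of_nonneg_left b3 (by positivity)).trans (le_of_eq ?_)
    field_simp
  have h6 : (200 : ℝ) * (6 / 5) ^ P ≤ (7 / 5) ^ P := by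
    have : (7 / 5 : ℝ) ^ P = (7 / 6) ^ P * (6 / 5) ^ P := by rw [← mul_pow]; norm_num
    rw [this]
    refine mul_le_mul_of_nonneg_right ?_ (by positivity)
    calc (200 : ℝ) ≤ (7 / 6) ^ 40 := by norm_num
      _ ≤ (7 / 6) ^ P := pow_le_pow_right₀ (by norm_num) hP
  have h7 : (1 : ℝ) ≤ (6 / 5) ^ P := one_le_pow₀ (by norm_num)
  have h8 : (0 : ℝ) < (B.card : ℝ) ^ 2 := by positivity
  nlinarith [mul_le_mul_of_nonneg_right h6 h8.le, mul_le_mul_of_nonneg_right h7 h8.le]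

end Sifting

/-- If `f ≥ -1` has a large even moment and a nonnegative odd moment just below it, then any
nonnegative `g ≥ f + 99/100` has a large higher moment. -/
lemma le_sum_mul_pow_of_moments {ι : Type*} (s : Finset ι) (ν f g : ι → ℝ) (L : ℕ) (hL : 1 ≤ L)
    (hν : ∀ i ∈ s, 0 ≤ ν i) (hν1 : ∑ i ∈ s, ν i = 1) (hf : ∀ i ∈ s, ν i ≠ 0 → -1 ≤ f i)
    (hg : ∀ i ∈ s, 0 ≤ g i) (hfg : ∀ i ∈ s, ν i ≠ 0 → f i + 99 / 100 ≤ g i)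
    (h1 : (2 ^ L)⁻¹ * (49 / 50 : ℝ) ^ (6 * L) ≤ ∑ i ∈ s, ν i * f i ^ (6 * L))
    (h2 : 0 ≤ ∑ i ∈ s, ν i * f i ^ (6 * L - 1)) :
    (7 / 5 : ℝ) ^ (90 * L) ≤ ∑ i ∈ s, ν i * g i ^ (90 * L) := by
  obtain ⟨q, hq⟩ : ∃ q, 6 * L = q + 1 := ⟨6 * L - 1, by omega⟩
  have hqo : Odd q := ⟨3 * L - 1, by omega⟩
  have hP : 90 * L = 84 * L + (q + 1) := by omega
  have hpt : ∀ i ∈ s, ν i * (f i ^ (q + 1) + f i ^ q) ≤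
      ν i * (3 * (1 / 2) ^ (q + 1) + 3 * ((149 / 100) ^ (84 * L))⁻¹ * g i ^ (90 * L)) := by
    intro i hi
    rcases eq_or_ne (ν i) 0 with h0 | h0
    · simp [h0]
    refine mul_le_mul_of_nonneg_left ?_ (hν i hi)
    have hf1 := hf i hi h0
    have hg0 := hg i hi
    have hfg1 := hfg i hi h0
    have hr : 0 ≤ 3 * ((149 / 100 : ℝ) ^ (84 * L))⁻¹ * g i ^ (90 * L) := by positivity
    rcases lt_or_ge (f i) 0 with hneg | hpos
    · have : f i ^ (q + 1) + f i ^ q ≤ 0 := by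
        rw [pow_succ, ← mul_add_one]
        exact mul_nonpos_of_nonpos_of_nonneg (hqo.pow_nonpos hneg.le) (by linarith)
      have h3 : (0 : ℝ) ≤ 3 * (1 / 2) ^ (q + 1) := by positivity
      linarith
    rcases lt_or_ge (f i) (1 / 2) with hlt | hge
    · have a1 : f i ^ (q + 1) ≤ (1 / 2) ^ (q + 1) := pow_le_pow_left₀ hpos hlt.le _
      have a2 : f i ^ q ≤ (1 / 2) ^ q := pow_le_pow_left₀ hpos hlt.le _
      have a3 : ((1 : ℝ) / 2) ^ (q + 1) = (1 / 2) ^ q * (1 / 2) := pow_succ _ _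
      linarith
    · have a1 : f i ^ q ≤ 2 * f i ^ (q + 1) := by
        rw [pow_succ]; nlinarith [pow_nonneg hpos q]
      have a2 : f i ^ (q + 1) ≤ ((149 / 100) ^ (84 * L))⁻¹ * g i ^ (90 * L) := by
        rw [inv_mul_eq_div, le_div_iff₀ (by positivity), hP, add_comm (84 * L),
          pow_add (g i)]
        exact mul_le_mul (pow_le_pow_left₀ hpos (by linarith) _)
          (pow_le_pow_left₀ (by norm_num) (by linarith) _) (by positivity) (by positivity)
      have h3 : (0 : ℝ) ≤ 3 * (1 / 2) ^ (q + 1) := by positivity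
      linarith
  have hsum := Finset.sum_le_sum hpt
  have hq' : 6 * L - 1 = q := by omega
  rw [hq'] at h2
  rw [hq] at h1
  simp_rw [mul_add, Finset.sum_add_distrib, ← Finset.sum_mul] at hsum
  rw [hν1, one_mul] at hsum
  have e : ∑ i ∈ s, ν i * (3 * ((149 / 100 : ℝ) ^ (84 * L))⁻¹ * g i ^ (90 * L)) =
      3 * ((149 / 100) ^ (84 * L))⁻¹ * ∑ i ∈ s, ν i * g i ^ (90 * L) := by
    rw [Finset.mul_sum]; exact Finset.sum_congr rfl fun i _ => by ring
  rw [e, ← hq] at hsum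
  rw [← hq] at h1
  have n1 : 3 * (1 / 2 : ℝ) ^ (6 * L) ≤ 1 / 2 * ((2 ^ L)⁻¹ * (49 / 50) ^ (6 * L)) := by
    have : (6 : ℝ) * 1 ^ L ≤ 28 ^ L := by
      calc (6 : ℝ) * 1 ^ L ≤ 28 ^ 1 := by norm_num
        _ ≤ 28 ^ L := pow_le_pow_right₀ (by norm_num) hL
    have h3 : (3 : ℝ) * (1 / 2) ^ (6 * L) = 1 / 2 * (6 * (1 / 64) ^ L) := by
      rw [pow_mul]; norm_num; ring
    rw [h3, pow_mul, ← inv_pow, ← mul_pow]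
    refine mul_le_mul_of_nonneg_left ?_ (by norm_num)
    calc (6 : ℝ) * (1 / 64) ^ L = (6 * 1 ^ L) * (1 / 64) ^ L := by simp
      _ ≤ 28 ^ L * (1 / 64) ^ L := mul_le_mul_of_nonneg_right this (by positivity)
      _ = (28 / 64) ^ L := by rw [← mul_pow]; norm_num
      _ ≤ (2⁻¹ * (49 / 50) ^ 6) ^ L := pow_le_pow_left₀ (by norm_num) (by norm_num) _
  have n2 : 6 * (7 / 5 : ℝ) ^ (90 * L) ≤ (149 / 100) ^ (84 * L) *
      ((2 ^ L)⁻¹ * (49 / 50) ^ (6 * L)) := by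
    rw [pow_mul, pow_mul, pow_mul, ← inv_pow, ← mul_pow, ← mul_pow]
    calc 6 * ((7 / 5 : ℝ) ^ 90) ^ L ≤ 6 ^ L * ((7 / 5 : ℝ) ^ 90) ^ L := by
          refine mul_le_mul_of_nonneg_right ?_ (by positivity)
          calc (6 : ℝ) = 6 ^ 1 := by norm_num
            _ ≤ 6 ^ L := pow_le_pow_right₀ (by norm_num) hL
      _ = (6 * (7 / 5 : ℝ) ^ 90) ^ L := by rw [mul_pow]
      _ ≤ _ := pow_le_pow_left₀ (by positivity) (by norm_num) _
  have n3 : 1 / 2 * ((2 ^ L)⁻¹ * (49 / 50 : ℝ) ^ (6 * L)) ≤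
      3 * ((149 / 100) ^ (84 * L))⁻¹ * ∑ i ∈ s, ν i * g i ^ (90 * L) := by linarith
  have hM : (0 : ℝ) < (149 / 100) ^ (84 * L) := by positivity
  have n4 := mul_le_mul_of_nonneg_left n3 hM.le
  have e2 : (149 / 100 : ℝ) ^ (84 * L) *
      (3 * ((149 / 100) ^ (84 * L))⁻¹ * ∑ i ∈ s, ν i * g i ^ (90 * L)) =
      3 * ∑ i ∈ s, ν i * g i ^ (90 * L) := by field_simp
  rw [e2] at n4
  linarith

section DiffMeasure

variable [AddCommGroup G]

/-- The distribution of `t' - t` for `t`, `t'` uniform in `S`. -/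
def diffMeasure (S : Finset G) (x : G) : ℝ :=
  (∑ t ∈ S, ∑ t' ∈ S, if t' - t = x then (1 : ℝ) else 0) / (S.card : ℝ) ^ 2

lemma sum_diffMeasure_mul [Fintype G] (S : Finset G) (φ : G → ℝ) :
    ∑ x, diffMeasure S x * φ x = (∑ t ∈ S, ∑ t' ∈ S, φ (t' - t)) / (S.card : ℝ) ^ 2 := by
  simp_rw [diffMeasure, div_mul_eq_mul_div, ← Finset.sum_div, Finset.sum_mul]
  rw [Finset.sum_comm]
  congr 1
  refine Finset.sum_congr rfl fun t _ => ?_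
  rw [Finset.sum_comm]
  exact Finset.sum_congr rfl fun t' _ => by simp

lemma diffMeasure_nonneg (S : Finset G) (x : G) : 0 ≤ diffMeasure S x :=
  div_nonneg (Finset.sum_nonneg fun _ _ => Finset.sum_nonneg fun _ _ => by
    split_ifs <;> norm_num) (by positivity)

lemma sum_diffMeasure [Fintype G] {S : Finset G} (hS : S.Nonempty) : ∑ x, diffMeasure S x = 1 := by
  have := sum_diffMeasure_mul S (fun _ => 1)
  have h : (S.card : ℝ) ≠ 0 := by exact_mod_cast hS.card_pos.ne'
  simp only [mul_one, Finset.sum_const, nsmul_eq_mul] at this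
  rw [this]; field_simp

lemma exists_of_diffMeasure_ne_zero {S : Finset G} {x : G} (h : diffMeasure S x ≠ 0) :
    ∃ t ∈ S, ∃ t' ∈ S, x = t' - t := by
  by_contra hcon
  push Not at hcon
  refine h ?_
  rw [diffMeasure, div_eq_zero_iff]
  left
  refine Finset.sum_eq_zero fun t ht => Finset.sum_eq_zero fun t' ht' => ?_
  rw [if_neg]
  exact fun e => hcon t ht t' ht' e.symm

lemma diffMeasure_le (S : Finset G) (x : G) : diffMeasure S x ≤ 1 / S.card := by
  rcases S.eq_empty_or_nonempty with rfl | hS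
  · simp [diffMeasure]
  have h : (0 : ℝ) < S.card := by exact_mod_cast hS.card_pos
  rw [diffMeasure, div_le_div_iff₀ (by positivity) h]
  have : ∑ t ∈ S, ∑ t' ∈ S, (if t' - t = x then (1 : ℝ) else 0) ≤ S.card • 1 := by
    refine Finset.sum_le_card_nsmul _ _ _ fun t _ => ?_
    have e : ∀ t', (t' - t = x) = (t' = x + t) := fun t' => by rw [sub_eq_iff_eq_add]
    simp_rw [e, Finset.sum_ite_eq']
    split_ifs <;> norm_num
  rw [nsmul_eq_mul, mul_one] at this
  nlinarith

end DiffMeasure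

section Sifting

variable [AddCommGroup G] [Fintype G]

/-- The `{0, 1}`-valued indicator function of a finset. -/
def fInd (A : Finset G) (y : G) : ℝ := if y ∈ A then 1 else 0

omit [AddCommGroup G] [Fintype G] in
lemma fInd_nonneg (A : Finset G) (y : G) : 0 ≤ fInd A y := by
  rw [fInd]; split_ifs <;> norm_num

omit [AddCommGroup G] [Fintype G] in
lemma fInd_le_one (A : Finset G) (y : G) : fInd A y ≤ 1 := by
  rw [fInd]; split_ifs <;> norm_num

omit [AddCommGroup G] [Fintype G] in
lemma fInd_of_mem {A : Finset G} {y : G} (h : y ∈ A) : fInd A y = 1 := if_pos h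

omit [AddCommGroup G] [Fintype G] in
lemma fInd_of_notMem {A : Finset G} {y : G} (h : y ∉ A) : fInd A y = 0 := if_neg h

omit [AddCommGroup G] [Fintype G] in
lemma fInd_eq_ite (A : Finset G) (y : G) [Decidable (y ∈ A)] :
    fInd A y = if y ∈ A then 1 else 0 := by
  by_cases h : y ∈ A <;> simp [fInd, h]

omit [AddCommGroup G] in
lemma sum_fInd (A : Finset G) : ∑ y, fInd A y = A.card := by
  simp [fInd]

/-- The number of `y` with `y` and `y + h` both in `A`. -/
def autoCorr (A : Finset G) (h : G) : ℝ := ∑ y, fInd A y * fInd A (y + h)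

lemma autoCorr_nonneg (A : Finset G) (h : G) : 0 ≤ autoCorr A h :=
  Finset.sum_nonneg fun _ _ => mul_nonneg (fInd_nonneg _ _) (fInd_nonneg _ _)

lemma autoCorr_le_card (A : Finset G) (h : G) : autoCorr A h ≤ A.card := by
  rw [← sum_fInd]
  exact Finset.sum_le_sum fun y _ => mul_le_of_le_one_right (fInd_nonneg _ _) (fInd_le_one _ _)

lemma autoCorr_eq_zero {A : Finset G} {h : G} (hA : ∀ y ∈ A, y + h ∉ A) : autoCorr A h = 0 :=
  Finset.sum_eq_zero fun y _ => by
    by_cases hy : y ∈ A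
    · rw [fInd_of_notMem (hA y hy), mul_zero]
    · rw [fInd_of_notMem hy, zero_mul]

lemma card_le_autoCorr {B Bp : Finset G} {h : G} (hB : B ⊆ Bp) (hp : ∀ b ∈ B, b + h ∈ Bp) :
    (B.card : ℝ) ≤ autoCorr Bp h := by
  rw [← sum_fInd]
  refine Finset.sum_le_sum fun y _ => ?_
  by_cases hy : y ∈ B
  · rw [fInd_of_mem hy, fInd_of_mem (hB hy), fInd_of_mem (hp y hy), one_mul]
  · rw [fInd_of_notMem hy]
    exact mul_nonneg (fInd_nonneg _ _) (fInd_nonneg _ _)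

/-- The weighted average of the autocorrelations of the fibres `A x`. -/
def skewCorr (c : G → ℝ) (A : G → Finset G) (h : G) : ℝ := ∑ x, c x * autoCorr (A x) h

/-- Autocorrelation of a balanced function. -/
lemma sum_balanced_mul {A B Bp : Finset G} (hA : A ⊆ B) (hne : A.Nonempty) {h : G}
    (hp : ∀ b ∈ B, b + h ∈ Bp) (hm : ∀ b ∈ B, b - h ∈ Bp) :
    ∑ y, (fInd A y / (A.card / B.card) - fInd Bp y) *
        (fInd A (y + h) / (A.card / B.card) - fInd Bp (y + h)) =
      autoCorr A h / (A.card / B.card : ℝ) ^ 2 - 2 * B.card + autoCorr Bp h := by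
  have hA0 : (A.card : ℝ) ≠ 0 := by exact_mod_cast hne.card_pos.ne'
  have hB0 : (B.card : ℝ) ≠ 0 := by exact_mod_cast (hne.mono hA).card_pos.ne'
  have e1 : ∑ y, fInd A y * fInd Bp (y + h) = A.card := by
    rw [← sum_fInd]
    refine Finset.sum_congr rfl fun y _ => ?_
    by_cases hy : y ∈ A
    · rw [fInd_of_mem (hp y (hA hy)), mul_one]
    · rw [fInd_of_notMem hy, zero_mul]
  have e2 : ∑ y, fInd Bp y * fInd A (y + h) = A.card := by
    rw [← sum_fInd, ← Equiv.sum_comp (Equiv.addRight h) (fInd A)]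
    refine Finset.sum_congr rfl fun y _ => ?_
    simp only [Equiv.coe_addRight]
    by_cases hy : y + h ∈ A
    · have := hm _ (hA hy)
      rw [add_sub_cancel_right] at this
      rw [fInd_of_mem this, one_mul]
    · rw [fInd_of_notMem hy, mul_zero]
  set w : ℝ := A.card / B.card with hw
  have hw0 : w ≠ 0 := div_ne_zero hA0 hB0
  have : ∀ y, (fInd A y / w - fInd Bp y) * (fInd A (y + h) / w - fInd Bp (y + h)) =
      (fInd A y * fInd A (y + h)) / w ^ 2 - (fInd A y * fInd Bp (y + h)) / w -
        (fInd Bp y * fInd A (y + h)) / w + fInd Bp y * fInd Bp (y + h) := fun y => by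
    field_simp; ring
  simp_rw [this, Finset.sum_add_distrib, Finset.sum_sub_distrib, ← Finset.sum_div, e1, e2]
  have e3 : (A.card : ℝ) / w = B.card := by rw [hw]; field_simp
  rw [e3, autoCorr, autoCorr]; ring

set_option maxHeartbeats 1000000 in
/-- A skew-corner-free system of fibres has a large high moment of its autocorrelation. -/
lemma le_sum_skewCorr_pow_of_skewFree (L : ℕ) (hL : 1 ≤ L) (A : G → Finset G) (B Bp S : Finset G)
    (hAB : ∀ x, A x ⊆ B)
    (hBp : ∀ b ∈ B, ∀ t₁ ∈ S, ∀ t₂ ∈ S, ∀ t₃ ∈ S, ∀ t₄ ∈ S, b + (t₁ - t₂ - (t₃ - t₄)) ∈ Bp)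
    (hcard : (Bp.card : ℝ) ≤ 101 / 100 * B.card)
    (hfree : ∀ x z, x ≠ z → (A z).Nonempty → ∀ y ∈ A x, y + (z - x) ∉ A x)
    (hS : 100 * 2 ^ L ≤ (S.card : ℝ)) (δ : ℝ)
    (hδ : δ = ∑ x, diffMeasure S x * ((A x).card / B.card)) (hδL : (2 ^ L)⁻¹ ≤ δ) :
    (7 / 5 : ℝ) ^ (90 * L) ≤ ∑ z, diffMeasure S z *
      skewCorr (fun x => diffMeasure S x / (δ * (A x).card)) A z ^ (90 * L) := by
  have hS0 : (0 : ℝ) < S.card := lt_of_lt_of_le (by positivity) hS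
  have hSne : S.Nonempty := Finset.card_pos.1 (by exact_mod_cast hS0)
  have h2L : (0 : ℝ) < 2 ^ L := pow_pos two_pos L
  have h95 : (0 : ℝ) < (49 / 50) ^ (6 * L) := pow_pos (by norm_num) _
  have hδ0 : 0 < δ := lt_of_lt_of_le (by positivity) hδL
  have hδ2 : 1 / δ ≤ 2 ^ L := by rw [one_div]; exact inv_le_of_inv_le₀ (by positivity) hδL
  have hB0 : (0 : ℝ) < B.card := by
    rcases B.eq_empty_or_nonempty with h | h
    · rw [h] at hδ; simp at hδ; linarith
    · exact_mod_cast h.card_pos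
  obtain ⟨s₀, hs₀⟩ := hSne
  set ν := diffMeasure S with hν
  have hν0 : ∀ x, 0 ≤ ν x := diffMeasure_nonneg S
  set w : G → ℝ := fun x => (A x).card / B.card with hw
  have hw0 : ∀ x, 0 ≤ w x := fun x => by positivity
  have hw1 : ∀ x, w x ≤ 1 := fun x => by
    rw [hw]; simp only; rw [div_le_one hB0]; exact_mod_cast Finset.card_le_card (hAB x)
  have hwpos : ∀ x, w x ≠ 0 → (A x).Nonempty := fun x hx => by
    rw [Finset.nonempty_iff_ne_empty]; intro h; simp [hw, h] at hx
  have hcc : ∀ x, 0 ≤ ν x / (δ * (A x).card) := fun x =>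
    div_nonneg (hν0 x) (mul_nonneg hδ0.le (Nat.cast_nonneg _))
  set f : G → G → ℝ := fun x y => fInd (A x) y / w x - fInd Bp y with hf
  set c : G → ℝ := fun x => ν x * w x / (δ * B.card) with hc
  have hc0 : ∀ x, 0 ≤ c x := fun x => 
    div_nonneg (mul_nonneg (hν0 x) (hw0 x)) (mul_pos hδ0 hB0).le
  have hcsum : ∑ x, c x = 1 / B.card := by
    simp only [hc]
    rw [← Finset.sum_div, ← hδ]; field_simp
  set H : Set G := {h | ∃ t₁ ∈ S, ∃ t₂ ∈ S, ∃ t₃ ∈ S, ∃ t₄ ∈ S, h = t₁ - t₂ - (t₃ - t₄)} with hH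
  have hBB : B ⊆ Bp := fun b hb => by simpa using hBp b hb s₀ hs₀ s₀ hs₀ s₀ hs₀ s₀ hs₀
  have hHp : ∀ h ∈ H, ∀ b ∈ B, b + h ∈ Bp := by
    rintro h ⟨a, ha, b, hb, d, hd, e, he, rfl⟩ x hx
    exact hBp x hx a ha b hb d hd e he
  have hHm : ∀ h ∈ H, ∀ b ∈ B, b - h ∈ Bp := by
    rintro h ⟨a, ha, b, hb, d, hd, e, he, rfl⟩ x hx
    have := hBp x hx d hd e he a ha b hb
    convert this using 1; abel
  have hHd : ∀ t ∈ S, ∀ t' ∈ S, t' - t ∈ H := fun t ht t' ht' =>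
    ⟨t', ht', t, ht, t, ht, t, ht, by abel⟩
  have hker : ∀ h ∈ H, ∀ x, (A x).Nonempty → ∑ y, f x y * f x (y + h) =
      autoCorr (A x) h / w x ^ 2 - 2 * B.card + autoCorr Bp h := fun h hh x hx =>
    sum_balanced_mul (hAB x) hx (hHp h hh) (hHm h hh)
  have hk1 : ∀ h ∈ H, (B.card : ℝ) ≤ autoCorr Bp h := fun h hh => card_le_autoCorr hBB (hHp h hh)
  have hk2 : ∀ h, autoCorr Bp h ≤ 101 / 100 * B.card := fun h =>
    (autoCorr_le_card _ _).trans hcard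
  set F : G → ℝ := fun z => ∑ x, c x * ∑ y, f x y * f x (y + (z - x)) with hF
  set Γ : G → ℝ := fun h => ∑ x, c x * ∑ y, f x y * f x (y + h) with hΓ
  set g : G → ℝ := skewCorr (fun x => ν x / (δ * (A x).card)) A with hg
  have hg0 : ∀ h, 0 ≤ g h := fun h => Finset.sum_nonneg fun x _ =>
    mul_nonneg (hcc x) (autoCorr_nonneg _ _)
  -- The skew correlation is very negative at the nonempty fibres.
  have hFneg : ∀ z, ν z ≠ 0 → w z ≠ 0 → F z ≤ -(49 / 50) := by
    intro z hz hwz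
    have hzne := hwpos z hwz
    obtain ⟨a, ha, a', ha', rfl⟩ := exists_of_diffMeasure_ne_zero hz
    set z := a' - a
    have hx : ∀ x, c x * ∑ y, f x y * f x (y + (z - x)) ≤
        c x * (-(99 / 100) * B.card) + if x = z then c x * (B.card / w x) else 0 := by
      intro x
      rcases eq_or_ne (c x) 0 with h | h
      · rw [h]; simp
      have hνx : ν x ≠ 0 := fun h' => h (by simp [hc, h'])
      have hwx : w x ≠ 0 := fun h' => h (by simp [hc, h'])
      obtain ⟨b, hb, b', hb', hxb⟩ := exists_of_diffMeasure_ne_zero hνx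
      have hzx : z - x ∈ H := ⟨a', ha', a, ha, b', hb', b, hb, by rw [hxb]⟩
      rw [hker _ hzx x (hwpos x hwx)]
      split_ifs with hxz
      · rw [← mul_add]
        refine mul_le_mul_of_nonneg_left ?_ (hc0 x)
        have h1 : autoCorr (A x) (z - x) / w x ^ 2 ≤ B.card / w x := by
          have hwp : 0 < w x := lt_of_le_of_ne (hw0 x) (Ne.symm hwx)
          rw [div_le_div_iff₀ (pow_pos hwp 2) hwp]
          have h2 : (A x).card = w x * B.card := by simp only [hw]; field_simp
          have h3 := autoCorr_le_card (A x) (z - x)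
          rw [h2] at h3
          nlinarith
        have := hk2 (z - x)
        linarith
      · rw [add_zero]
        refine mul_le_mul_of_nonneg_left ?_ (hc0 x)
        rw [autoCorr_eq_zero (hfree x z hxz hzne), zero_div]
        have := hk2 (z - x)
        linarith
    have := Finset.sum_le_sum fun x (_ : x ∈ Finset.univ) => hx x
    rw [Finset.sum_add_distrib, ← Finset.sum_mul, hcsum, Finset.sum_ite_eq' Finset.univ z,
      if_pos (Finset.mem_univ z)] at this
    have h1 : c z * (B.card / w z) = ν z / δ := by simp only [hc]; field_simp
    have h2 : ν z / δ ≤ 1 / 100 := by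
      have h3 : ν z ≤ 1 / S.card := diffMeasure_le S z
      have h4 : (1 : ℝ) ≤ 2 ^ L * δ := by
        have := mul_le_mul_of_nonneg_left hδL (h2L.le)
        rwa [mul_inv_cancel₀ h2L.ne'] at this
      rw [div_le_iff₀ hδ0]
      refine h3.trans ?_
      rw [div_le_iff₀ hS0]
      nlinarith
    rw [h1] at this
    have h3 : 1 / (B.card : ℝ) * (-(99 / 100) * B.card) = -(99 / 100) := by field_simp
    rw [h3] at this
    simp only [hF]
    linarith
  have hFmom : (2 ^ L)⁻¹ * (49 / 50 : ℝ) ^ (6 * L) ≤ ∑ z, ν z * F z ^ (6 * L) := by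
    have hev : Even (6 * L) := ⟨3 * L, by ring⟩
    have h1 : ∀ z, ν z * w z * (49 / 50) ^ (6 * L) ≤ ν z * F z ^ (6 * L) := by
      intro z
      have hp : 0 ≤ F z ^ (6 * L) := hev.pow_nonneg _
      rcases eq_or_ne (ν z) 0 with h | h
      · rw [h]; simp
      rcases eq_or_ne (w z) 0 with h' | h'
      · rw [h']; simpa using mul_nonneg (hν0 z) hp
      rw [mul_assoc]
      refine mul_le_mul_of_nonneg_left ?_ (hν0 z)
      have h2 : (49 / 50 : ℝ) ^ (6 * L) ≤ F z ^ (6 * L) := by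
        rw [← hev.neg_pow (F z)]
        exact pow_le_pow_left₀ (by norm_num) (by have := hFneg z h h'; linarith) _
      exact (mul_le_mul_of_nonneg_right (hw1 z) h95.le).trans (by rwa [one_mul])
    have h2 := Finset.sum_le_sum fun z (_ : z ∈ Finset.univ) => h1 z
    rw [← Finset.sum_mul, ← hδ] at h2
    exact (mul_le_mul_of_nonneg_right hδL h95.le).trans h2
  -- Decoupling.
  have hkerT : ∀ t t' : G, Γ (t' - t) =
      ∑ q : G × G, c q.1 * f q.1 (q.2 + t) * f q.1 (q.2 + t') := by
    intro t t'
    rw [Fintype.sum_prod_type]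
    simp only [hΓ]
    refine Finset.sum_congr rfl fun x _ => ?_
    rw [← Equiv.sum_comp (Equiv.addRight t), Finset.mul_sum]
    refine Finset.sum_congr rfl fun y _ => ?_
    simp only [Equiv.coe_addRight]
    rw [show y + t + (t' - t) = y + t' by abel, mul_assoc]
  have hkerT2 : ∀ t t' : G, Γ (t' - t) =
      ∑ q : G × G, c q.1 * f q.1 (q.2 + t - q.1) * f q.1 (q.2 + t' - q.1) := by
    intro t t'
    rw [Fintype.sum_prod_type]
    simp only [hΓ]
    refine Finset.sum_congr rfl fun x _ => ?_
    rw [← Equiv.sum_comp (Equiv.addRight (t - x)), Finset.mul_sum]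
    refine Finset.sum_congr rfl fun y _ => ?_
    simp only [Equiv.coe_addRight]
    rw [show y + (t - x) + (t' - t) = y + t' - x by abel,
      show y + (t - x) = y + t - x by abel, mul_assoc]
  have hkerF : ∀ t t' : G, F (t' - t) =
      ∑ q : G × G, c q.1 * f q.1 (q.2 + t) * f q.1 (q.2 + t' - q.1) := by
    intro t t'
    rw [Fintype.sum_prod_type]
    simp only [hF]
    refine Finset.sum_congr rfl fun x _ => ?_
    rw [← Equiv.sum_comp (Equiv.addRight t), Finset.mul_sum]
    refine Finset.sum_congr rfl fun y _ => ?_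
    simp only [Equiv.coe_addRight]
    rw [show y + t + (t' - t - x) = y + t' - x by abel, mul_assoc]
  have hdec : ∑ z, ν z * F z ^ (6 * L) ≤ ∑ z, ν z * Γ z ^ (6 * L) := by
    rw [hν, sum_diffMeasure_mul S (fun z => F z ^ (6 * L)),
      sum_diffMeasure_mul S (fun z => Γ z ^ (6 * L))]
    refine div_le_div_of_nonneg_right ?_ (sq_nonneg _)
    have := sum_sum_pow_le_half_add S (fun q : G × G => c q.1) (fun q => hc0 q.1)
      (fun t q => f q.1 (q.2 + t)) (fun t q => f q.1 (q.2 + t - q.1)) (6 * L)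
    simp only [← hkerF, ← hkerT, ← hkerT2] at this
    linarith
  have hodd : 0 ≤ ∑ z, ν z * Γ z ^ (6 * L - 1) := by
    rw [hν, sum_diffMeasure_mul S (fun z => Γ z ^ (6 * L - 1))]
    refine div_nonneg ?_ (sq_nonneg _)
    have := sum_sum_pow_self_nonneg S (fun q : G × G => c q.1) (fun q => hc0 q.1)
      (fun t q => f q.1 (q.2 + t)) (6 * L - 1)
    simpa only [← hkerT] using this
  have hgΓ : ∀ h ∈ H, Γ h = g h - 2 + autoCorr Bp h / B.card := by
    intro h hh
    have h1 : ∀ x, c x * ∑ y, f x y * f x (y + h) = ν x / (δ * (A x).card) * autoCorr (A x) h +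
        c x * (-2 * B.card + autoCorr Bp h) := by
      intro x
      rcases eq_or_ne (w x) 0 with hwx | hwx
      · have : c x = 0 := by simp [hc, hwx]
        have h2 : ((A x).card : ℝ) = 0 := by
          simp only [hw] at hwx
          rcases div_eq_zero_iff.1 hwx with h | h
          · exact h
          · exact absurd h hB0.ne'
        rw [this, h2]; simp
      · rw [hker h hh x (hwpos x hwx)]
        have h2 : ((A x).card : ℝ) = w x * B.card := by simp only [hw]; field_simp
        rw [h2]
        simp only [hc]
        generalize autoCorr (A x) h = r, autoCorr Bp h = k, w x = w', ν x = n at *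
        field_simp
        ring
    simp only [hΓ, hg, skewCorr]
    rw [Finset.sum_congr rfl fun x _ => h1 x, Finset.sum_add_distrib, ← Finset.sum_mul, hcsum,
      show 1 / (B.card : ℝ) * (-2 * B.card + autoCorr Bp h) = -2 + autoCorr Bp h / B.card by
        generalize autoCorr Bp h = k
        field_simp]
    ring
  have hνH : ∀ z, ν z ≠ 0 → z ∈ H := fun z hz => by
    obtain ⟨t, ht, t', ht', rfl⟩ := exists_of_diffMeasure_ne_zero hz
    exact hHd t ht t' ht'
  exact le_sum_mul_pow_of_moments Finset.univ ν Γ g L hL (fun z _ => hν0 z)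
    (sum_diffMeasure ⟨s₀, hs₀⟩)
    (fun z _ hz => by
      have h1 : 1 ≤ autoCorr Bp z / B.card := by
        rw [le_div_iff₀ hB0, one_mul]; exact hk1 z (hνH z hz)
      have := hg0 z
      rw [hgΓ z (hνH z hz)]; linarith)
    (fun z _ => hg0 z)
    (fun z _ hz => by
      have h1 : autoCorr Bp z / B.card ≤ 101 / 100 := by
        rw [div_le_iff₀ hB0]; exact hk2 z
      rw [hgΓ z (hνH z hz)]; linarith)
    (hFmom.trans hdec) hodd

/-- A skew-corner-free system of fibres admits a large sifted set, most of whose differences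
are popular for the fibre autocorrelation. -/
theorem exists_sifted_of_skewFree (L : ℕ) (hL : 1 ≤ L) (A : G → Finset G) (B Bp S : Finset G)
    (hAB : ∀ x, A x ⊆ B)
    (hBp : ∀ b ∈ B, ∀ t₁ ∈ S, ∀ t₂ ∈ S, ∀ t₃ ∈ S, ∀ t₄ ∈ S, b + (t₁ - t₂ - (t₃ - t₄)) ∈ Bp)
    (hcard : (Bp.card : ℝ) ≤ 101 / 100 * B.card)
    (hfree : ∀ x z, x ≠ z → (A z).Nonempty → ∀ y ∈ A x, y + (z - x) ∉ A x)
    (hS : 100 * 2 ^ L ≤ (S.card : ℝ)) (δ : ℝ)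
    (hδ : δ = ∑ x, diffMeasure S x * ((A x).card / B.card)) (hδL : (2 ^ L)⁻¹ ≤ δ) :
    ∃ A₁ ⊆ S, (S.card : ℝ) < 2 * (2 ^ L) ^ (90 * L) * A₁.card ∧
      100 * ∑ t ∈ A₁, ∑ t' ∈ A₁,
        (if skewCorr (fun x => diffMeasure S x / (δ * (A x).card)) A (t' - t) < 6 / 5
          then (1 : ℝ) else 0) < (A₁.card : ℝ) ^ 2 := by
  have hS0 : (0 : ℝ) < S.card := lt_of_lt_of_le (by positivity) hS
  have hSne : S.Nonempty := Finset.card_pos.1 (by exact_mod_cast hS0)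
  have hδ0 : 0 < δ := lt_of_lt_of_le (by positivity) hδL
  have hδ2 : 1 / δ ≤ 2 ^ L := by rw [one_div]; exact inv_le_of_inv_le₀ (by positivity) hδL
  have hmom := le_sum_skewCorr_pow_of_skewFree L hL A B Bp S hAB hBp hcard hfree hS δ hδ hδL
  set g : G → ℝ := skewCorr (fun x => diffMeasure S x / (δ * (A x).card)) A with hg
  have hcc : ∀ x, 0 ≤ diffMeasure S x / (δ * (A x).card) := fun x =>
    div_nonneg (diffMeasure_nonneg S x) (by positivity)
  rw [sum_diffMeasure_mul S (fun z => g z ^ (90 * L)), le_div_iff₀ (pow_pos hS0 2)] at hmom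
  refine exists_sifted S hSne (fun q : G × G => diffMeasure S q.1 / (δ * (A q.1).card))
    (fun q => hcc q.1) (fun q t => q.2 + t ∈ A q.1) (2 ^ L)
    (pow_pos two_pos L) ?_ (90 * L) (by omega) (fun t t' => g (t' - t)) ?_ hmom
  · intro t
    rw [Fintype.sum_prod_type]
    refine le_trans ?_ hδ2
    simp only [← fInd_eq_ite]
    have h1 : ∀ x, ∑ y, diffMeasure S x / (δ * (A x).card) * fInd (A x) (y + t) ≤
        diffMeasure S x * (1 / δ) := by
      intro x
      rw [← Finset.mul_sum]
      have h2 : ∑ y, fInd (A x) (y + t) = (A x).card := by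
        rw [← sum_fInd, ← Equiv.sum_comp (Equiv.addRight t) (fInd (A x))]
        rfl
      rw [h2]
      rcases eq_or_ne ((A x).card : ℝ) 0 with h | h
      · rw [h, mul_zero]; exact mul_nonneg (diffMeasure_nonneg S x) (one_div_nonneg.2 hδ0.le)
      · apply le_of_eq; field_simp
    refine (Finset.sum_le_sum fun x _ => h1 x).trans ?_
    rw [← Finset.sum_mul, sum_diffMeasure hSne, one_mul]
  · intro t t'
    rw [Fintype.sum_prod_type]
    simp only [hg, skewCorr, autoCorr, ← fInd_eq_ite]
    refine Finset.sum_congr rfl fun x _ => ?_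
    rw [← Equiv.sum_comp (Equiv.addRight t), Finset.mul_sum]
    refine Finset.sum_congr rfl fun y _ => ?_
    simp only [Equiv.coe_addRight]
    rw [show y + t + (t' - t) = y + t' by abel, mul_assoc]

end Sifting

section Bohr

variable [AddCommGroup G] [Fintype G]

/-- The Bohr set with frequencies `Γ` and width `ρ`, as a finset. -/
def bohr (Γ : Finset (AddChar G ℂ)) (ρ : ℝ) : Finset G :=
  Finset.univ.filter fun x => ∀ γ ∈ Γ, ‖γ x - 1‖ ≤ ρ

variable {Γ Δ : Finset (AddChar G ℂ)} {ρ σ : ℝ} {x y : G}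

lemma mem_bohr : x ∈ bohr Γ ρ ↔ ∀ γ ∈ Γ, ‖γ x - 1‖ ≤ ρ := by simp [bohr]

lemma zero_mem_bohr (hρ : 0 ≤ ρ) : (0 : G) ∈ bohr Γ ρ := mem_bohr.2 fun γ _ => by simpa using hρ

lemma bohr_nonempty (hρ : 0 ≤ ρ) : (bohr Γ ρ).Nonempty := ⟨0, zero_mem_bohr hρ⟩

lemma card_bohr_pos (hρ : 0 ≤ ρ) : (0 : ℝ) < (bohr Γ ρ).card := by
  exact_mod_cast (bohr_nonempty hρ).card_pos

lemma norm_sub_eq_norm_sub_one (γ : AddChar G ℂ) (x y : G) :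
    ‖γ x - γ y‖ = ‖γ (x - y) - 1‖ := by
  have : γ x - γ y = γ y * (γ (x - y) - 1) := by
    rw [mul_sub, ← AddChar.map_add_eq_mul, add_sub_cancel, mul_one]
  rw [this, norm_mul, AddChar.norm_apply, one_mul]

lemma norm_map_neg_sub_one (γ : AddChar G ℂ) (x : G) : ‖γ (-x) - 1‖ = ‖γ x - 1‖ := by
  have := norm_sub_eq_norm_sub_one γ 0 x
  rw [zero_sub] at this
  rw [← this, AddChar.map_zero_eq_one, norm_sub_rev]

lemma norm_map_add_sub_one_le (γ : AddChar G ℂ) (x y : G) :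
    ‖γ (x + y) - 1‖ ≤ ‖γ x - 1‖ + ‖γ y - 1‖ := by
  have : γ (x + y) - 1 = (γ (x + y) - γ y) + (γ y - 1) := by ring
  rw [this]
  refine (norm_add_le _ _).trans ?_
  rw [norm_sub_eq_norm_sub_one, add_sub_cancel_right]

lemma neg_mem_bohr (hx : x ∈ bohr Γ ρ) : -x ∈ bohr Γ ρ := by
  rw [mem_bohr] at *
  exact fun γ hγ => (norm_map_neg_sub_one γ x).le.trans (hx γ hγ)

lemma add_mem_bohr (hx : x ∈ bohr Γ ρ) (hy : y ∈ bohr Γ σ) : x + y ∈ bohr Γ (ρ + σ) := by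
  rw [mem_bohr] at *
  exact fun γ hγ => (norm_map_add_sub_one_le γ x y).trans (add_le_add (hx γ hγ) (hy γ hγ))

lemma sub_mem_bohr (hx : x ∈ bohr Γ ρ) (hy : y ∈ bohr Γ σ) : x - y ∈ bohr Γ (ρ + σ) := by
  rw [sub_eq_add_neg]; exact add_mem_bohr hx (neg_mem_bohr hy)

lemma bohr_mono (h : ρ ≤ σ) : bohr Γ ρ ⊆ bohr Γ σ := fun x hx => by
  rw [mem_bohr] at *
  exact fun γ hγ => (hx γ hγ).trans h

lemma bohr_anti (h : Γ ⊆ Δ) : bohr Δ ρ ⊆ bohr Γ ρ := fun x hx => by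
  rw [mem_bohr] at *
  exact fun γ hγ => hx γ (h hγ)

lemma bohr_of_two_le (h : 2 ≤ ρ) : bohr Γ ρ = Finset.univ := by
  ext x
  simp only [mem_bohr, Finset.mem_univ, iff_true]
  intro γ _
  refine (norm_sub_le _ _).trans ?_
  rw [AddChar.norm_apply, norm_one]; linarith

lemma card_bohr_mono (h : ρ ≤ σ) : ((bohr Γ ρ).card : ℝ) ≤ (bohr Γ σ).card := by
  exact_mod_cast Finset.card_le_card (bohr_mono h)

/-- Doubling property of Bohr sets. -/
lemma card_bohr_two_mul_le (hρ : 0 < ρ) :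
    (bohr Γ (2 * ρ)).card ≤ 81 ^ Γ.card * (bohr Γ ρ).card := by
  set q : G → Γ → ℤ × ℤ := fun x γ =>
    (⌊(γ.1 x - 1).re * 2 / ρ⌋, ⌊(γ.1 x - 1).im * 2 / ρ⌋) with hq
  have h1 := Finset.card_le_mul_card_image (f := q) (bohr Γ (2 * ρ)) (bohr Γ ρ).card (by
    intro c hc
    obtain ⟨x₀, hx₀, rfl⟩ := Finset.mem_image.1 hc
    refine Finset.card_le_card_of_injOn (fun x => x - x₀) ?_ fun x _ y _ h => by simpa using h
    intro x hx
    simp only [Finset.coe_filter, Set.mem_ofPred_eq] at hx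
    refine mem_bohr.2 fun γ hγ => ?_
    have h2 := congrFun hx.2 ⟨γ, hγ⟩
    simp only [hq, Prod.mk.injEq] at h2
    have h3 := Int.abs_sub_lt_one_of_floor_eq_floor h2.1
    have h4 := Int.abs_sub_lt_one_of_floor_eq_floor h2.2
    rw [← sub_div, ← sub_mul, abs_div, abs_mul, abs_of_pos hρ, div_lt_one hρ] at h3 h4
    rw [← norm_sub_eq_norm_sub_one]
    have h5 := Complex.norm_le_abs_re_add_abs_im (γ x - γ x₀)
    have e1 : (γ x - γ x₀).re = (γ x - 1).re - (γ x₀ - 1).re := by simp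
    have e2 : (γ x - γ x₀).im = (γ x - 1).im - (γ x₀ - 1).im := by simp
    rw [e1, e2] at h5
    norm_num at h3 h4 h5 ⊢
    linarith)
  have h2 : ((bohr Γ (2 * ρ)).image q).card ≤ 81 ^ Γ.card := by
    have h3 : (bohr Γ (2 * ρ)).image q ⊆
        Fintype.piFinset fun _ : Γ => Finset.Icc (-4 : ℤ) 4 ×ˢ Finset.Icc (-4 : ℤ) 4 := by
      intro c hc
      obtain ⟨x, hx, rfl⟩ := Finset.mem_image.1 hc
      rw [Fintype.mem_piFinset]
      intro γ
      have h4 := mem_bohr.1 hx γ.1 γ.2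
      have key : ∀ r : ℝ, |r| ≤ 2 * ρ → ⌊r * 2 / ρ⌋ ∈ Finset.Icc (-4 : ℤ) 4 := by
        intro r hr
        rw [abs_le] at hr
        rw [Finset.mem_Icc]
        constructor
        · rw [Int.le_floor, le_div_iff₀ hρ]; push_cast; linarith
        · have : ⌊r * 2 / ρ⌋ < 5 := by
            rw [Int.floor_lt, div_lt_iff₀ hρ]; push_cast; linarith
          omega
      exact Finset.mem_product.2 ⟨key _ ((Complex.abs_re_le_norm _).trans h4),
        key _ ((Complex.abs_im_le_norm _).trans h4)⟩
    refine (Finset.card_le_card h3).trans ?_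
    rw [Fintype.card_piFinset]
    simp
  calc _ ≤ _ := h1
    _ ≤ _ := by rw [mul_comm]; exact Nat.mul_le_mul_right _ h2

lemma card_le_card_bohr (Γ : Finset (AddChar G ℂ)) (j : ℕ) :
    (Fintype.card G : ℝ) ≤ 81 ^ (j * Γ.card) * (bohr Γ (2 / 2 ^ j)).card := by
  induction j with
  | zero => simp [bohr_of_two_le]
  | succ j ih =>
    have h := card_bohr_two_mul_le (Γ := Γ) (ρ := 2 / 2 ^ (j + 1)) (by positivity)
    have e : 2 * (2 / 2 ^ (j + 1) : ℝ) = 2 / 2 ^ j := by rw [pow_succ]; field_simp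
    rw [e] at h
    have h' : ((bohr Γ (2 / 2 ^ j)).card : ℝ) ≤
      81 ^ Γ.card * (bohr Γ (2 / 2 ^ (j + 1))).card := by exact_mod_cast h
    calc _ ≤ _ := ih
      _ ≤ 81 ^ (j * Γ.card) * (81 ^ Γ.card * (bohr Γ (2 / 2 ^ (j + 1))).card) := by gcongr
      _ = _ := by rw [← mul_assoc, ← pow_add]; ring_nf

/-- The relative scale at which regular Bohr sets are stable. -/
def regScale (Γ : Finset (AddChar G ℂ)) : ℝ := 1 / (1000 * (Γ.card + 1))

omit [Fintype G] in
lemma regScale_pos (Γ : Finset (AddChar G ℂ)) : 0 < regScale Γ := by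
  rw [regScale]; positivity

/-- Regularity of Bohr sets at the single scale `regScale`. -/
def IsRegBohr (Γ : Finset (AddChar G ℂ)) (ρ : ℝ) : Prop :=
  ((bohr Γ (ρ * (1 + regScale Γ))).card : ℝ) ≤ 101 / 100 * (bohr Γ ρ).card

lemma exists_isRegBohr (Γ : Finset (AddChar G ℂ)) (hρ : 0 < ρ) :
    ∃ σ, ρ / 2 ≤ σ ∧ σ ≤ ρ ∧ IsRegBohr Γ σ := by
  by_contra hcon
  push Not at hcon
  set η := regScale Γ with hη
  have hη0 : 0 < η := regScale_pos Γ
  obtain ⟨N, hN⟩ : ∃ N, N = 500 * (Γ.card + 1) := ⟨_, rfl⟩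
  have hpow : (1 + η) ^ N ≤ 2 := by
    calc (1 + η) ^ N ≤ (Real.exp η) ^ N := by
          refine pow_le_pow_left₀ (by linarith) ?_ _
          rw [add_comm]; exact Real.add_one_le_exp η
      _ = Real.exp (1 / 2) := by
          rw [← Real.exp_nat_mul, hη, regScale, hN]; congr 1; push_cast; field_simp; norm_num
      _ ≤ 2 := by
          have h1 : Real.exp (1 / 2) ^ 2 = Real.exp 1 := by
            rw [← Real.exp_nat_mul]; norm_num
          have h2 := Real.exp_one_lt_d9
          nlinarith [Real.exp_pos (1 / 2)]
  have hstep : ∀ i, i ≤ N → (101 / 100 : ℝ) ^ i * (bohr Γ (ρ / 2)).card ≤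
      (bohr Γ (ρ / 2 * (1 + η) ^ i)).card := by
    intro i
    induction i with
    | zero => intro _; simp
    | succ i ih =>
      intro hi
      have h1 : (1 + η) ^ i ≤ 2 :=
        (pow_le_pow_right₀ (by linarith) (by omega : i ≤ N)).trans hpow
      have h2 : 1 ≤ (1 + η) ^ i := one_le_pow₀ (by linarith)
      have h3 := hcon (ρ / 2 * (1 + η) ^ i) (by nlinarith) (by nlinarith)
      rw [IsRegBohr, not_le, mul_assoc, ← pow_succ] at h3
      have h4 := ih (by omega)
      calc (101 / 100 : ℝ) ^ (i + 1) * (bohr Γ (ρ / 2)).card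
          = 101 / 100 * ((101 / 100 : ℝ) ^ i * (bohr Γ (ρ / 2)).card) := by ring
        _ ≤ 101 / 100 * (bohr Γ (ρ / 2 * (1 + η) ^ i)).card := by gcongr
        _ ≤ _ := h3.le
  have h1 := hstep N le_rfl
  have h2 : ((bohr Γ (ρ / 2 * (1 + η) ^ N)).card : ℝ) ≤ (bohr Γ (2 * (ρ / 2))).card :=
    card_bohr_mono (by nlinarith)
  have h3 : ((bohr Γ (2 * (ρ / 2))).card : ℝ) ≤ 81 ^ Γ.card * (bohr Γ (ρ / 2)).card := by
    exact_mod_cast card_bohr_two_mul_le (Γ := Γ) (ρ := ρ / 2) (by positivity)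
  have h4 : (0 : ℝ) < (bohr Γ (ρ / 2)).card := card_bohr_pos (by positivity)
  have h5 := le_of_mul_le_mul_right (h1.trans (h2.trans h3)) h4
  have h6 : (81 : ℝ) ^ (Γ.card + 1) ≤ (101 / 100) ^ N := by
    rw [hN, pow_mul]
    refine pow_le_pow_left₀ (by norm_num) ?_ _
    rw [show 500 = 100 * 5 from rfl, pow_mul]
    calc (81 : ℝ) ≤ (27 / 10) ^ 5 := by norm_num
      _ ≤ _ := pow_le_pow_left₀ (by norm_num) (by norm_num) _
  have h7 : (81 : ℝ) ^ Γ.card < 81 ^ (Γ.card + 1) := pow_lt_pow_right₀ (by norm_num) (by omega)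
  linarith

end Bohr

section AlmostPeriodicity

lemma exp_le_one_add_add_sq {x : ℝ} (hx : |x| ≤ 1) : Real.exp x ≤ 1 + x + x ^ 2 := by
  have := Real.abs_exp_sub_one_sub_id_le hx
  rw [abs_le] at this
  linarith [this.2]

/-- A one-sided Chernoff bound for sampling with replacement. -/
lemma card_filter_lt_sum_le {α : Type*} (A : Finset α) (X : α → ℝ)
    (hX : ∀ a ∈ A, |X a| ≤ 1) (hmean : ∑ a ∈ A, X a = 0) (m : ℕ) (ε : ℝ) (hε0 : 0 ≤ ε)
    (hε1 : ε ≤ 1) :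
    (((Fintype.piFinset fun _ : Fin m => A).filter fun c => m * ε < ∑ j, X (c j)).card : ℝ) ≤
      Real.exp (-(m * ε ^ 2 / 4)) * (A.card : ℝ) ^ m := by
  set l := ε / 2 with hl
  have h1 : ∑ c ∈ Fintype.piFinset fun _ : Fin m => A, Real.exp (l * ∑ j, X (c j)) =
      (∑ a ∈ A, Real.exp (l * X a)) ^ m := by
    simp_rw [Finset.mul_sum, Real.exp_sum]
    rw [← Finset.prod_univ_sum (fun _ : Fin m => A) (fun _ a => Real.exp (l * X a))]
    simp
  have h2 : ∑ a ∈ A, Real.exp (l * X a) ≤ A.card * Real.exp (l ^ 2) := by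
    calc ∑ a ∈ A, Real.exp (l * X a) ≤ ∑ a ∈ A, (1 + l * X a + l ^ 2) := by
          refine Finset.sum_le_sum fun a ha => ?_
          have hXa := hX a ha
          have hb : |l * X a| ≤ 1 := by
            rw [abs_mul, abs_of_nonneg (by linarith)]; nlinarith [abs_nonneg (X a)]
          refine (exp_le_one_add_add_sq hb).trans ?_
          have : X a ^ 2 ≤ 1 := by rw [sq_le_one_iff_abs_le_one]; exact hXa
          nlinarith [sq_nonneg l]
      _ = A.card * (1 + l ^ 2) := by
          rw [Finset.sum_add_distrib, Finset.sum_add_distrib, ← Finset.mul_sum, hmean]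
          simp; ring
      _ ≤ _ := by
          refine mul_le_mul_of_nonneg_left ?_ (Nat.cast_nonneg _)
          rw [add_comm]; exact Real.add_one_le_exp _
  have h3 : (((Fintype.piFinset fun _ : Fin m => A).filter
      fun c => m * ε < ∑ j, X (c j)).card : ℝ) * Real.exp (l * (m * ε)) ≤
      (∑ a ∈ A, Real.exp (l * X a)) ^ m := by
    rw [← h1, ← nsmul_eq_mul]
    refine (Finset.card_nsmul_le_sum _ (fun c => Real.exp (l * ∑ j, X (c j))) _ ?_).trans ?_
    · intro c hc
      exact Real.exp_le_exp.2
        (mul_le_mul_of_nonneg_left (Finset.mem_filter.1 hc).2.le (by linarith))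
    · exact Finset.sum_le_sum_of_subset_of_nonneg (Finset.filter_subset _ _)
        fun _ _ _ => (Real.exp_pos _).le
  have h4 : (∑ a ∈ A, Real.exp (l * X a)) ^ m ≤ A.card ^ m * Real.exp (m * l ^ 2) := by
    calc _ ≤ (A.card * Real.exp (l ^ 2)) ^ m :=
          pow_le_pow_left₀ (Finset.sum_nonneg fun _ _ => (Real.exp_pos _).le) h2 _
      _ = _ := by rw [mul_pow, ← Real.exp_nat_mul]
  have h5 := h3.trans h4
  rw [← le_div_iff₀ (Real.exp_pos _), mul_div_assoc, ← Real.exp_sub] at h5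
  refine h5.trans (le_of_eq ?_)
  rw [mul_comm, hl]
  congr 2; ring

/-- Chernoff bound for sampling with replacement. -/
lemma card_filter_lt_abs_sub_le {α : Type*} (A : Finset α) (hA : A.Nonempty) (X : α → ℝ)
    (hX0 : ∀ a, 0 ≤ X a) (hX1 : ∀ a, X a ≤ 1) (m : ℕ) (hm : 0 < m) (ε : ℝ)
    (hε0 : 0 ≤ ε) (hε1 : ε ≤ 1) :
    (((Fintype.piFinset fun _ : Fin m => A).filter
      fun c => ε < |(∑ j, X (c j)) / m - (∑ a ∈ A, X a) / A.card|).card : ℝ) ≤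
      2 * Real.exp (-(m * ε ^ 2 / 4)) * (A.card : ℝ) ^ m := by
  have hA0 : (0 : ℝ) < A.card := by exact_mod_cast hA.card_pos
  have hm0 : (0 : ℝ) < m := by exact_mod_cast hm
  set μ := (∑ a ∈ A, X a) / A.card with hμ
  have hμ0 : 0 ≤ μ := div_nonneg (Finset.sum_nonneg fun a _ => hX0 a) hA0.le
  have hμ1 : μ ≤ 1 := by
    rw [hμ, div_le_one hA0]
    simpa using Finset.sum_le_card_nsmul A X 1 fun a _ => hX1 a
  have hmean : ∑ a ∈ A, (X a - μ) = 0 := by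
    rw [Finset.sum_sub_distrib, hμ]; simp; field_simp; simp
  have h1 := card_filter_lt_sum_le A (fun a => X a - μ)
    (fun a _ => by rw [abs_le]; constructor <;> linarith [hX0 a, hX1 a]) hmean m ε hε0 hε1
  have h2 := card_filter_lt_sum_le A (fun a => -(X a - μ))
    (fun a _ => by rw [abs_le]; constructor <;> linarith [hX0 a, hX1 a])
    (by rw [Finset.sum_neg_distrib, hmean, neg_zero]) m ε hε0 hε1
  have h3 : ((Fintype.piFinset fun _ : Fin m => A).filter
      fun c => ε < |(∑ j, X (c j)) / m - μ|) ⊆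
      ((Fintype.piFinset fun _ : Fin m => A).filter fun c => m * ε < ∑ j, (X (c j) - μ)) ∪
      ((Fintype.piFinset fun _ : Fin m => A).filter fun c => m * ε < ∑ j, -(X (c j) - μ)) := by
    intro c hc
    rw [Finset.mem_filter] at hc
    have e : ∑ j, (X (c j) - μ) = m * ((∑ j, X (c j)) / m - μ) := by
      rw [Finset.sum_sub_distrib]; simp; field_simp
    rw [Finset.mem_union, Finset.mem_filter, Finset.mem_filter, Finset.sum_neg_distrib, e,
      ← mul_neg]
    rcases lt_abs.1 hc.2 with h | h
    · exact Or.inl ⟨hc.1, mul_lt_mul_of_pos_left h hm0⟩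
    · exact Or.inr ⟨hc.1, mul_lt_mul_of_pos_left h hm0⟩
  have h4 := (Nat.cast_le (α := ℝ)).2 ((Finset.card_le_card h3).trans (Finset.card_union_le _ _))
  push_cast at h4
  linarith

variable [AddCommGroup G]

/-- The average of `s (a' - a)` over `a' ∈ A`. -/
def shiftAvg (s : G → ℝ) (A : Finset G) (a : G) : ℝ := (∑ a' ∈ A, s (a' - a)) / A.card

/-- The average of `s (a' - a - u)` over `a ∈ A₁`, `a' ∈ A₂`. -/
def corrAvg (s : G → ℝ) (A₁ A₂ : Finset G) (u : G) : ℝ :=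
  (∑ a ∈ A₁, shiftAvg s A₂ (a + u)) / A₁.card

lemma shiftAvg_nonneg {s : G → ℝ} (hs : ∀ x, 0 ≤ s x) (A : Finset G) (a : G) :
    0 ≤ shiftAvg s A a := div_nonneg (Finset.sum_nonneg fun _ _ => hs _) (Nat.cast_nonneg _)

lemma shiftAvg_le_one {s : G → ℝ} (hs : ∀ x, s x ≤ 1) (A : Finset G) (a : G) :
    shiftAvg s A a ≤ 1 := by
  refine div_le_one_of_le₀ ?_ (Nat.cast_nonneg _)
  simpa using Finset.sum_le_card_nsmul A _ 1 fun a' _ => hs (a' - a)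

omit [AddCommGroup G] in
/-- If two `[0, 1]`-valued functions are close off a small exceptional set, their averages over
`A` are close. -/
lemma abs_avg_sub_avg_le (A : Finset G) (hA : A.Nonempty) (p q : G → ℝ) (ε : ℝ)
    (hpq : ∀ a, |p a - q a| ≤ 1) (hε : 0 ≤ ε)
    (h : ((A.filter fun a => ε < |p a - q a|).card : ℝ) ≤ ε * A.card) :
    |(∑ a ∈ A, p a) / A.card - (∑ a ∈ A, q a) / A.card| ≤ 2 * ε := by
  have hA0 : (0 : ℝ) < A.card := by exact_mod_cast hA.card_pos
  rw [← sub_div, ← Finset.sum_sub_distrib, abs_div, abs_of_pos hA0, div_le_iff₀ hA0]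
  refine (Finset.abs_sum_le_sum_abs _ _).trans ?_
  calc ∑ a ∈ A, |p a - q a| ≤ ∑ a ∈ A, (ε + if ε < |p a - q a| then 1 else 0) := by
        refine Finset.sum_le_sum fun a _ => ?_
        split_ifs with h'
        · linarith [hpq a]
        · linarith
    _ = A.card * ε + (A.filter fun a => ε < |p a - q a|).card := by
        rw [Finset.sum_add_distrib]; simp
    _ ≤ _ := by linarith

/-- Croot–Sisask almost periodicity. -/
theorem exists_almostPeriods (s : G → ℝ) (hs0 : ∀ x, 0 ≤ s x) (hs1 : ∀ x, s x ≤ 1)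
    (A₁ A₂ R W X : Finset G) (hA₁ : A₁.Nonempty) (hA₂ : A₂.Nonempty)
    (hX : ∀ a ∈ A₂, ∀ w ∈ W, a + w ∈ X) (m : ℕ) (hm : 0 < m) (ε : ℝ) (hε0 : 0 < ε)
    (hε1 : ε ≤ 1) (hR : 4 * (R.card : ℝ) ≤ ε * A₁.card * Real.exp (m * ε ^ 2 / 4)) :
    ∃ T ⊆ W, (W.card : ℝ) * A₂.card ^ m ≤ 2 * T.card * X.card ^ m ∧
      ∀ t ∈ T, ∀ t' ∈ T, ∀ u, (∀ a ∈ A₁, a + u ∈ R) → (∀ a ∈ A₁, a + (u + (t - t')) ∈ R) →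
        |corrAvg s A₁ A₂ u - corrAvg s A₁ A₂ (u + (t - t'))| ≤ 4 * ε := by
  have hA₁0 : (0 : ℝ) < A₁.card := by exact_mod_cast hA₁.card_pos
  set Y := Fintype.piFinset fun _ : Fin m => A₂ with hY
  set φ : (Fin m → G) → G → ℝ := fun c a => (∑ j, s (c j - a)) / m with hφ
  have hφ0 : ∀ c a, 0 ≤ φ c a := fun c a =>
    div_nonneg (Finset.sum_nonneg fun _ _ => hs0 _) (Nat.cast_nonneg _)
  have hφ1 : ∀ c a, φ c a ≤ 1 := fun c a => by
    refine div_le_one_of_le₀ ?_ (Nat.cast_nonneg _)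
    simpa using Finset.sum_le_card_nsmul Finset.univ (fun j => s (c j - a)) 1 fun j _ => hs1 _
  set bad : (Fin m → G) → Finset G :=
    fun c => R.filter fun a => ε < |φ c a - shiftAvg s A₂ a| with hbad
  set good := Y.filter fun c => ((bad c).card : ℝ) ≤ ε * A₁.card with hgood
  have hYc : (Y.card : ℝ) = A₂.card ^ m := by simp [hY]
  have hgoodc : (A₂.card : ℝ) ^ m ≤ 2 * good.card := by
    have h1 : ∑ c ∈ Y, ((bad c).card : ℝ) ≤
        R.card * (2 * Real.exp (-(m * ε ^ 2 / 4)) * (A₂.card : ℝ) ^ m) := by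
      have e : ∀ c, ((bad c).card : ℝ) =
          ∑ a ∈ R, if ε < |φ c a - shiftAvg s A₂ a| then 1 else 0 := fun c => by simp [hbad]
      simp_rw [e]
      rw [Finset.sum_comm, ← nsmul_eq_mul]
      refine Finset.sum_le_card_nsmul _ _ _ fun a _ => ?_
      have := card_filter_lt_abs_sub_le A₂ hA₂ (fun a' => s (a' - a)) (fun _ => hs0 _)
        (fun _ => hs1 _) m hm ε hε0.le hε1
      refine le_trans (le_of_eq ?_) this
      simp [hφ, shiftAvg, hY]
    have h2 : (Y.card - good.card : ℝ) * (ε * A₁.card) ≤ ∑ c ∈ Y, ((bad c).card : ℝ) := by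
      have e : (Y.card - good.card : ℝ) =
          (Y.filter fun c => ¬ ((bad c).card : ℝ) ≤ ε * A₁.card).card := by
        rw [← Finset.card_filter_add_card_filter_not (s := Y)
          (fun c => ((bad c).card : ℝ) ≤ ε * A₁.card)]
        push_cast; rw [hgood]; ring
      rw [e, ← nsmul_eq_mul]
      refine (Finset.card_nsmul_le_sum _ (fun c => ((bad c).card : ℝ)) _ ?_).trans
        (Finset.sum_le_sum_of_subset_of_nonneg (Finset.filter_subset _ _)
          fun _ _ _ => Nat.cast_nonneg _)
      intro c hc
      exact (not_le.1 (Finset.mem_filter.1 hc).2).le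
    have h3 := h2.trans h1
    have h4 : (R.card : ℝ) * (2 * Real.exp (-(m * ε ^ 2 / 4)) * (A₂.card : ℝ) ^ m) ≤
        (ε * A₁.card) * ((A₂.card : ℝ) ^ m / 2) := by
      have h5 := mul_le_mul_of_nonneg_right hR (Real.exp_pos (-(m * ε ^ 2 / 4))).le
      rw [mul_assoc (ε * _), ← Real.exp_add, add_neg_cancel, Real.exp_zero, mul_one] at h5
      have h6 : (0 : ℝ) ≤ A₂.card ^ m / 2 := by positivity
      have h7 := mul_le_mul_of_nonneg_right h5 h6
      refine le_trans (le_of_eq ?_) h7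
      ring
    have h5 : (Y.card - good.card : ℝ) ≤ (A₂.card : ℝ) ^ m / 2 := by
      refine le_of_mul_le_mul_left ?_ (mul_pos hε0 hA₁0)
      rw [mul_comm]
      exact h3.trans h4
    rw [hYc] at h5
    linarith
  -- Pigeonhole over the translates of good tuples.
  set Z := Fintype.piFinset fun _ : Fin m => X with hZ
  have hZc : (Z.card : ℝ) = X.card ^ m := by simp [hZ]
  set Tc : (Fin m → G) → Finset G := fun c => W.filter fun t => (fun j => c j - t) ∈ good with hTc
  have hsum : (W.card : ℝ) * good.card ≤ ∑ c ∈ Z, ((Tc c).card : ℝ) := by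
    have e : ∀ c, ((Tc c).card : ℝ) = ∑ t ∈ W, if (fun j => c j - t) ∈ good then 1 else 0 :=
      fun c => by simp [hTc]
    simp_rw [e]
    rw [Finset.sum_comm, ← nsmul_eq_mul]
    refine Finset.card_nsmul_le_sum _ _ _ fun t ht => ?_
    rw [← Finset.sum_filter, Finset.sum_const, nsmul_eq_mul, mul_one]
    norm_cast
    refine Finset.card_le_card_of_injOn (fun c j => c j + t) ?_ fun c _ d _ h => ?_
    · intro c hc
      have hc' : c ∈ good := hc
      have hcY : c ∈ Y := (Finset.mem_filter.1 hc').1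
      rw [hY, Fintype.mem_piFinset] at hcY
      rw [Finset.mem_coe, Finset.mem_filter, hZ, Fintype.mem_piFinset]
      exact ⟨fun j => hX _ (hcY j) t ht, by simpa using hc'⟩
    · funext j
      simpa using congrFun h j
  have hgoodne : (0 : ℝ) < good.card := by
    have : (0 : ℝ) < A₂.card ^ m := pow_pos (by exact_mod_cast hA₂.card_pos) m
    linarith
  obtain ⟨c, hc⟩ : ∃ c, (W.card : ℝ) * A₂.card ^ m ≤ 2 * (Tc c).card * X.card ^ m := by
    by_contra hcon
    push Not at hcon
    rcases Z.eq_empty_or_nonempty with hZe | hZne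
    · rw [hZe, Finset.sum_empty] at hsum
      obtain ⟨a, ha⟩ := hA₂
      have hW : (W.card : ℝ) = 0 := by nlinarith [(Nat.cast_nonneg W.card : (0 : ℝ) ≤ W.card)]
      have := hcon fun _ => a
      rw [hW, zero_mul] at this
      exact absurd this (not_lt.2 (by positivity))
    · have h1 := Finset.sum_lt_sum_of_nonempty hZne fun c _ => hcon c
      rw [Finset.sum_const, nsmul_eq_mul, hZc, ← Finset.sum_mul, ← Finset.mul_sum] at h1
      have hX0 : (0 : ℝ) < X.card ^ m := by rw [← hZc]; exact_mod_cast hZne.card_pos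
      have h2 : 2 * ∑ c ∈ Z, ((Tc c).card : ℝ) < W.card * A₂.card ^ m := by
        refine lt_of_mul_lt_mul_right ?_ hX0.le
        refine h1.trans_le (le_of_eq (by ring))
      have h3 := mul_le_mul_of_nonneg_left hgoodc (Nat.cast_nonneg W.card : (0 : ℝ) ≤ W.card)
      linarith
  refine ⟨Tc c, Finset.filter_subset _ _, hc, ?_⟩
  have key : ∀ t ∈ Tc c, ∀ u, (∀ a ∈ A₁, a + u ∈ R) →
      |(∑ a ∈ A₁, φ c (a + (u + t))) / A₁.card - corrAvg s A₁ A₂ u| ≤ 2 * ε := by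
    intro t ht u hu
    refine abs_avg_sub_avg_le A₁ hA₁ (fun a => φ c (a + (u + t)))
      (fun a => shiftAvg s A₂ (a + u)) ε ?_ hε0.le ?_
    · intro a
      rw [abs_le]
      constructor <;> linarith [hφ0 c (a + (u + t)), hφ1 c (a + (u + t)),
        shiftAvg_nonneg hs0 A₂ (a + u), shiftAvg_le_one hs1 A₂ (a + u)]
    · have hg := (Finset.mem_filter.1 (Finset.mem_filter.1 ht).2).2
      refine le_trans ?_ hg
      norm_cast
      refine Finset.card_le_card_of_injOn (fun a => a + u) ?_ fun a _ b _ h => by simpa using h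
      intro a ha
      rw [Finset.mem_coe, Finset.mem_filter] at ha
      rw [Finset.mem_coe, hbad, Finset.mem_filter]
      refine ⟨hu a ha.1, ?_⟩
      have e : φ (fun j => c j - t) (a + u) = φ c (a + (u + t)) :=
        congrArg (· / (m : ℝ)) (Finset.sum_congr rfl fun j _ => congrArg s (show
            c j - t - (a + u) = c j - (a + (u + t)) by abel))
      rw [e]
      exact ha.2
  intro t ht t' ht' u hu hu'
  have h1 := key t ht u hu
  have h2 := key t' ht' (u + (t - t')) hu'
  have e : ∀ a, a + (u + (t - t') + t') = a + (u + t) := fun a => by abel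
  simp_rw [e] at h2
  rw [abs_le] at *
  constructor <;> linarith [h1.1, h1.2, h2.1, h2.2]

end AlmostPeriodicity

section Fourier

variable [AddCommGroup G] [Fintype G]

/-- The Fourier transform of the uniform measure on `A`. -/
def muHat (A : Finset G) (γ : AddChar G ℂ) : ℂ := (∑ a ∈ A, γ a) / A.card

lemma norm_muHat_le_one (A : Finset G) (γ : AddChar G ℂ) : ‖muHat A γ‖ ≤ 1 := by
  rw [muHat, norm_div, Complex.norm_natCast]
  refine div_le_one_of_le₀ ((norm_sum_le _ _).trans ?_) (Nat.cast_nonneg _)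
  simp [AddChar.norm_apply]

lemma parseval (f : G → ℝ) :
    ∑ γ : AddChar G ℂ, ‖∑ x, (f x : ℂ) * γ x‖ ^ 2 = Fintype.card G * ∑ x, f x ^ 2 := by
  have h : ∀ γ : AddChar G ℂ, ((‖∑ x, (f x : ℂ) * γ x‖ ^ 2 : ℝ) : ℂ) =
      ∑ x, ∑ y, (f x * f y : ℂ) * γ (x - y) := by
    intro γ
    rw [Complex.ofReal_pow, ← Complex.mul_conj', map_sum, Finset.sum_mul_sum]
    refine Finset.sum_congr rfl fun x _ => Finset.sum_congr rfl fun y _ => ?_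
    rw [map_mul, Complex.conj_ofReal, ← AddChar.map_neg_eq_conj, sub_eq_add_neg,
      AddChar.map_add_eq_mul]
    ring
  have h2 : ((∑ γ : AddChar G ℂ, ‖∑ x, (f x : ℂ) * γ x‖ ^ 2 : ℝ) : ℂ) =
      ((Fintype.card G * ∑ x, f x ^ 2 : ℝ) : ℂ) := by
    rw [Complex.ofReal_sum, Finset.sum_congr rfl fun γ _ => h γ, Finset.sum_comm]
    push_cast
    rw [Finset.mul_sum]
    refine Finset.sum_congr rfl fun x _ => ?_
    rw [Finset.sum_comm]
    simp_rw [← Finset.mul_sum, AddChar.sum_apply_eq_ite, sub_eq_zero]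
    simp
    ring
  exact_mod_cast h2

lemma sum_norm_muHat_sq {A : Finset G} (hA : A.Nonempty) :
    ∑ γ : AddChar G ℂ, ‖muHat A γ‖ ^ 2 = Fintype.card G / A.card := by
  have h := parseval (fInd A)
  have hA0 : (A.card : ℝ) ≠ 0 := by exact_mod_cast hA.card_pos.ne'
  have e1 : ∀ γ : AddChar G ℂ, ∑ x, (fInd A x : ℂ) * γ x = ∑ a ∈ A, γ a := fun γ => by
    simp only [fInd_eq_ite, apply_ite Complex.ofReal, Complex.ofReal_one, Complex.ofReal_zero,
      ite_mul, one_mul, zero_mul, Finset.sum_ite_mem, Finset.univ_inter]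
  have e2 : ∑ x, fInd A x ^ 2 = A.card := by simp [fInd]
  simp_rw [e1] at h
  rw [e2] at h
  simp_rw [muHat, norm_div, div_pow, Complex.norm_natCast]
  rw [← Finset.sum_div, h]
  field_simp

/-- The Fourier coefficients of `corrAvg s A₁ A₂`. -/
def corrCoeff (s : G → ℝ) (A₁ A₂ : Finset G) (γ : AddChar G ℂ) : ℂ :=
  (∑ x, (s x : ℂ) * γ x) * (starRingEnd ℂ) (muHat A₂ γ) * muHat A₁ γ / Fintype.card G

lemma corrAvg_eq_sum (s : G → ℝ) (A₁ A₂ : Finset G) (u : G) :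
    (corrAvg s A₁ A₂ u : ℂ) = ∑ γ, corrCoeff s A₁ A₂ γ * γ u := by
  have hN : (Fintype.card G : ℂ) ≠ 0 := by exact_mod_cast Fintype.card_ne_zero
  have h1 : ∀ γ : AddChar G ℂ, corrCoeff s A₁ A₂ γ * γ u =
      (∑ a ∈ A₁, ∑ a' ∈ A₂, ∑ x, (s x : ℂ) * γ (x - (a' - (a + u)))) /
        (A₁.card * A₂.card * Fintype.card G) := by
    intro γ
    have e : ∀ x a a' : G, γ (x - (a' - (a + u))) =
        γ x * ((starRingEnd ℂ) (γ a')) * γ a * γ u := by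
      intro x a a'
      rw [← AddChar.map_neg_eq_conj, ← AddChar.map_add_eq_mul, ← AddChar.map_add_eq_mul,
        ← AddChar.map_add_eq_mul]
      congr 1; abel
    simp_rw [e, corrCoeff, muHat, map_div₀, map_sum, Complex.conj_natCast]
    have e2 : ∑ a ∈ A₁, ∑ a' ∈ A₂, ∑ x, (s x : ℂ) * (γ x * (starRingEnd ℂ) (γ a') * γ a * γ u) =
        (∑ x, (s x : ℂ) * γ x) * (∑ a' ∈ A₂, (starRingEnd ℂ) (γ a')) * (∑ a ∈ A₁, γ a) * γ u := by
      rw [Finset.sum_mul_sum, Finset.mul_sum, Finset.sum_mul]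
      refine Finset.sum_congr rfl fun a _ => ?_
      rw [Finset.sum_comm, Finset.sum_mul, Finset.sum_mul]
      refine Finset.sum_congr rfl fun x _ => ?_
      rw [Finset.sum_mul, Finset.sum_mul]
      refine Finset.sum_congr rfl fun a' _ => by ring
    rw [e2]
    simp only [div_eq_mul_inv, mul_inv]
    ring
  simp_rw [h1, ← Finset.sum_div]
  rw [Finset.sum_comm, corrAvg]
  have h2 : ∀ a, ∑ γ : AddChar G ℂ, ∑ a' ∈ A₂, ∑ x, (s x : ℂ) * γ (x - (a' - (a + u))) =
      Fintype.card G * ∑ a' ∈ A₂, (s (a' - (a + u)) : ℂ) := by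
    intro a
    rw [Finset.sum_comm, Finset.mul_sum]
    refine Finset.sum_congr rfl fun a' _ => ?_
    rw [Finset.sum_comm]
    simp_rw [← Finset.mul_sum, AddChar.sum_apply_eq_ite, sub_eq_zero]
    simp
    ring
  simp_rw [h2, shiftAvg]
  push_cast
  rw [← Finset.mul_sum, ← Finset.sum_div, div_div, mul_comm (A₂.card : ℂ),
    mul_comm (Fintype.card G : ℂ), mul_div_mul_right _ _ hN]

lemma sum_norm_corrCoeff_le (s : G → ℝ) (A₁ A₂ : Finset G) (hA₁ : A₁.Nonempty) (Q : ℝ)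
    (hQ0 : 0 ≤ Q) (hQ : ∑ x, s x ^ 2 ≤ Q ^ 2 * A₁.card) :
    ∑ γ, ‖corrCoeff s A₁ A₂ γ‖ ≤ Q := by
  have hN : (0 : ℝ) < Fintype.card G := by exact_mod_cast Fintype.card_pos
  have hA0 : (0 : ℝ) < A₁.card := by exact_mod_cast hA₁.card_pos
  have h1 : ∀ γ, ‖corrCoeff s A₁ A₂ γ‖ ≤ ‖∑ x, (s x : ℂ) * γ x‖ * ‖muHat A₁ γ‖ /
      Fintype.card G := by
    intro γ
    rw [corrCoeff, norm_div, norm_mul, norm_mul, Complex.norm_conj, Complex.norm_natCast]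
    refine div_le_div_of_nonneg_right ?_ hN.le
    refine mul_le_mul_of_nonneg_right ?_ (norm_nonneg _)
    exact mul_le_of_le_one_right (norm_nonneg _) (norm_muHat_le_one _ _)
  refine (Finset.sum_le_sum fun γ _ => h1 γ).trans ?_
  rw [← Finset.sum_div, div_le_iff₀ hN]
  refine abs_le_of_sq_le_sq' ?_ (mul_nonneg hQ0 hN.le) |>.2
  refine (Finset.sum_mul_sq_le_sq_mul_sq _ _ _).trans ?_
  rw [parseval, sum_norm_muHat_sq hA₁]
  have h2 : (Fintype.card G : ℝ) * (∑ x, s x ^ 2) * (Fintype.card G / A₁.card) =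
      (∑ x, s x ^ 2) * (Fintype.card G ^ 2 / A₁.card) := by ring
  rw [h2]
  refine (mul_le_mul_of_nonneg_right hQ (by positivity)).trans (le_of_eq ?_)
  field_simp

/-- Averaging `φ` over the translates by `t - t'` with `t`, `t'` in `T`. -/
def smooth (T : Finset G) (φ : G → ℝ) (u : G) : ℝ :=
  (∑ t ∈ T, ∑ t' ∈ T, φ (u + (t - t'))) / (T.card : ℝ) ^ 2

lemma smooth_eq_sum (T : Finset G) (φ : G → ℝ) (c : AddChar G ℂ → ℂ)
    (h : ∀ u, (φ u : ℂ) = ∑ γ, c γ * γ u) (u : G) :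
    (smooth T φ u : ℂ) = ∑ γ, c γ * ((‖muHat T γ‖ ^ 2 : ℝ) : ℂ) * γ u := by
  rw [smooth]
  push_cast
  simp_rw [h]
  have e : ∀ γ : AddChar G ℂ, ((‖muHat T γ‖ : ℝ) : ℂ) ^ 2 =
      (∑ t ∈ T, ∑ t' ∈ T, γ (t - t')) / (T.card : ℂ) ^ 2 := by
    intro γ
    rw [← Complex.mul_conj', muHat, map_div₀, map_sum, Complex.conj_natCast, div_mul_div_comm,
      Finset.sum_mul_sum, ← pow_two]
    congr 1
    refine Finset.sum_congr rfl fun x _ => Finset.sum_congr rfl fun y _ => ?_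
    rw [← AddChar.map_neg_eq_conj, ← AddChar.map_add_eq_mul, sub_eq_add_neg]
  simp_rw [e]
  rw [Finset.sum_congr rfl fun t _ => Finset.sum_comm, Finset.sum_comm, Finset.sum_div]
  refine Finset.sum_congr rfl fun γ _ => ?_
  simp_rw [AddChar.map_add_eq_mul]
  rw [mul_div_assoc', div_mul_eq_mul_div]
  congr 1
  rw [Finset.mul_sum, Finset.sum_mul]
  refine Finset.sum_congr rfl fun t _ => ?_
  rw [Finset.mul_sum, Finset.sum_mul]
  exact Finset.sum_congr rfl fun t' _ => by ring

lemma smooth_iterate_eq_sum (T : Finset G) (φ : G → ℝ) (c : AddChar G ℂ → ℂ)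
    (h : ∀ u, (φ u : ℂ) = ∑ γ, c γ * γ u) (k : ℕ) (u : G) :
    ((smooth T)^[k] φ u : ℂ) = ∑ γ, c γ * (((‖muHat T γ‖ ^ 2) ^ k : ℝ) : ℂ) * γ u := by
  induction k generalizing u with
  | zero => simp [h]
  | succ k ih =>
    rw [Function.iterate_succ_apply', smooth_eq_sum T _ _ ih]
    refine Finset.sum_congr rfl fun γ _ => ?_
    push_cast; ring

/-- The iterated average varies slowly in directions nearly annihilated by the large spectrum. -/
lemma abs_smooth_iterate_sub_le (T : Finset G) (φ : G → ℝ) (c : AddChar G ℂ → ℂ)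
    (h : ∀ u, (φ u : ℂ) = ∑ γ, c γ * γ u) (Q : ℝ) (hc : ∑ γ, ‖c γ‖ ≤ Q) (k : ℕ) (κ : ℝ)
    (hκ : 2 * (1 / 4) ^ k ≤ κ) (v : G) (hv : ∀ γ, 1 / 2 ≤ ‖muHat T γ‖ → ‖γ v - 1‖ ≤ κ) :
    |(smooth T)^[k] φ v - (smooth T)^[k] φ 0| ≤ Q * κ := by
  have hκ0 : 0 ≤ κ := le_trans (by positivity) hκ
  have e : (((smooth T)^[k] φ v - (smooth T)^[k] φ 0 : ℝ) : ℂ) =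
      ∑ γ, c γ * ((((‖muHat T γ‖ ^ 2) ^ k : ℝ) : ℂ) * (γ v - 1)) := by
    rw [Complex.ofReal_sub, smooth_iterate_eq_sum T φ c h, smooth_iterate_eq_sum T φ c h,
      ← Finset.sum_sub_distrib]
    refine Finset.sum_congr rfl fun γ _ => ?_
    rw [AddChar.map_zero_eq_one]; ring
  rw [← Real.norm_eq_abs, ← Complex.norm_real, e]
  refine (norm_sum_le _ _).trans ?_
  refine le_trans ?_ (mul_le_mul_of_nonneg_right hc hκ0)
  rw [Finset.sum_mul]
  refine Finset.sum_le_sum fun γ _ => ?_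
  rw [norm_mul, norm_mul, Complex.norm_real, Real.norm_of_nonneg (by positivity)]
  refine mul_le_mul_of_nonneg_left ?_ (norm_nonneg _)
  have h1 := norm_muHat_le_one T γ
  have h0 := norm_nonneg (muHat T γ)
  rcases le_or_gt (1 / 2) ‖muHat T γ‖ with hγ | hγ
  · refine le_trans ?_ (hv γ hγ)
    exact mul_le_of_le_one_left (norm_nonneg _) (pow_le_one₀ (by positivity) (by nlinarith))
  · refine le_trans ?_ hκ
    rw [mul_comm]
    refine mul_le_mul ?_ ?_ (by positivity) (by norm_num)
    · refine (norm_sub_le _ _).trans ?_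
      rw [AddChar.norm_apply, norm_one]; norm_num
    · exact pow_le_pow_left₀ (by positivity) (by nlinarith) _

omit [Fintype G] in
/-- Almost periods move the iterated average by little. -/
lemma abs_smooth_sub_le (T : Finset G) (hT : T.Nonempty) (φ ψ : G → ℝ) (u : G) (ε : ℝ)
    (h : ∀ t ∈ T, ∀ t' ∈ T, |φ (u + (t - t')) - ψ u| ≤ ε) : |smooth T φ u - ψ u| ≤ ε := by
  have hT0 : (0 : ℝ) < T.card := by exact_mod_cast hT.card_pos
  have e : smooth T φ u - ψ u = (∑ t ∈ T, ∑ t' ∈ T, (φ (u + (t - t')) - ψ u)) / T.card ^ 2 := by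
    simp_rw [Finset.sum_sub_distrib, smooth]
    simp
    field_simp
  rw [e, abs_div, abs_of_pos (pow_pos hT0 2), div_le_iff₀ (pow_pos hT0 2)]
  refine (Finset.abs_sum_le_sum_abs _ _).trans ?_
  calc ∑ t ∈ T, |∑ t' ∈ T, (φ (u + (t - t')) - ψ u)| ≤ ∑ t ∈ T, T.card • ε :=
        Finset.sum_le_sum fun t ht => (Finset.abs_sum_le_sum_abs _ _).trans
          (Finset.sum_le_card_nsmul _ _ _ fun t' ht' => h t ht t' ht')
    _ = _ := by simp; ring

omit [Fintype G] in
lemma sum_smooth_iterate_lt {ι : Type*} (s : Finset ι) (v : ι → G) (T : Finset G)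
    (hT : T.Nonempty) (φ : G → ℝ) (C : ℝ) (h : ∀ u, ∑ i ∈ s, φ (u + v i) < C) (k : ℕ) (u : G) :
    ∑ i ∈ s, (smooth T)^[k] φ (u + v i) < C := by
  induction k generalizing u with
  | zero => exact h u
  | succ k ih =>
    have hT0 : (0 : ℝ) < T.card := by exact_mod_cast hT.card_pos
    simp_rw [Function.iterate_succ_apply', smooth]
    rw [← Finset.sum_div, div_lt_iff₀ (pow_pos hT0 2), Finset.sum_comm]
    calc ∑ t ∈ T, ∑ i ∈ s, ∑ t' ∈ T, (smooth T)^[k] φ (u + v i + (t - t'))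
        < ∑ t ∈ T, (T.card * C) := by
          refine Finset.sum_lt_sum_of_nonempty hT fun t _ => ?_
          rw [Finset.sum_comm]
          calc _ < ∑ t' ∈ T, C := by
                refine Finset.sum_lt_sum_of_nonempty hT fun t' _ => ?_
                have := ih (u + (t - t'))
                simp_rw [add_right_comm u] at this
                exact this
            _ = _ := by simp
      _ = _ := by simp; ring

omit [Fintype G] in
lemma sum_corrAvg_lt {ι : Type*} (I : Finset ι) (v : ι → G) (s : G → ℝ) (A₁ A₂ : Finset G)
    (h₁ : A₁.Nonempty) (h₂ : A₂.Nonempty) (C : ℝ)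
    (h : ∀ w, ∑ i ∈ I, s (w - v i) < C) (u : G) : ∑ i ∈ I, corrAvg s A₁ A₂ (u + v i) < C := by
  have h₁0 : (0 : ℝ) < A₁.card := by exact_mod_cast h₁.card_pos
  have h₂0 : (0 : ℝ) < A₂.card := by exact_mod_cast h₂.card_pos
  simp_rw [corrAvg]
  rw [← Finset.sum_div, div_lt_iff₀ h₁0, Finset.sum_comm]
  calc _ < ∑ a ∈ A₁, C := by
        refine Finset.sum_lt_sum_of_nonempty h₁ fun a _ => ?_
        simp_rw [shiftAvg]
        rw [← Finset.sum_div, div_lt_iff₀ h₂0, Finset.sum_comm]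
        calc _ < ∑ a' ∈ A₂, C := by
              refine Finset.sum_lt_sum_of_nonempty h₂ fun a' _ => ?_
              have := h (a' - (a + u))
              simp_rw [sub_sub, add_assoc] at this
              exact this
          _ = _ := by simp; ring
    _ = _ := by simp; ring

end Fourier

section Dissociation

variable [AddCommGroup G] [Fintype G]

/-- Exponent patterns in `{-1, 0, 1}` supported on `Λ`. -/
def signPatterns (Λ : Finset (AddChar G ℂ)) : Finset (AddChar G ℂ → ℤ) :=
  Fintype.piFinset fun γ => if γ ∈ Λ then {-1, 0, 1} else {0}

/-- The character `∏ γ ^ m γ`. -/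
def charProd (m : AddChar G ℂ → ℤ) : AddChar G ℂ := ∏ γ, γ ^ m γ

lemma mem_signPatterns {Λ : Finset (AddChar G ℂ)} {m : AddChar G ℂ → ℤ} :
    m ∈ signPatterns Λ ↔
      ∀ γ, (γ ∈ Λ → m γ = -1 ∨ m γ = 0 ∨ m γ = 1) ∧ (γ ∉ Λ → m γ = 0) := by
  rw [signPatterns, Fintype.mem_piFinset]
  refine forall_congr' fun γ => ?_
  by_cases h : γ ∈ Λ <;> simp [h]

lemma charProd_apply (m : AddChar G ℂ → ℤ) (x : G) : charProd m x = ∏ γ, γ x ^ m γ := by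
  rw [charProd, AddChar.prod_apply]
  simp

/-- `Λ` is dissociated relative to `B`: no nontrivial `{-1, 0, 1}`-combination of `Λ` correlates
with `B`. -/
def IsDissoc (B : Finset G) (Λ : Finset (AddChar G ℂ)) : Prop :=
  ∀ m ∈ signPatterns Λ, m ≠ 0 → ‖muHat B (charProd m)‖ ≤ 1 / 2

/-- The coefficients in the expansion of a Riesz product. -/
def rieszCoeff (Λ : Finset (AddChar G ℂ)) (ω : AddChar G ℂ → ℂ) (γ : AddChar G ℂ) (e : ℤ) : ℂ :=
  if γ ∈ Λ then
    if e = 0 then (Real.cosh (1 / 2) : ℂ) else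
      if e = 1 then ω γ * (Real.sinh (1 / 2) / 2 : ℝ)
      else (starRingEnd ℂ) (ω γ) * (Real.sinh (1 / 2) / 2 : ℝ)
  else 1

section

variable {Λ : Finset (AddChar G ℂ)} {ω : AddChar G ℂ → ℂ} {γ : AddChar G ℂ}

omit [Fintype G]

lemma rieszCoeff_zero (hγ : γ ∈ Λ) : rieszCoeff Λ ω γ 0 = (Real.cosh (1 / 2) : ℂ) := by
  rw [rieszCoeff, if_pos hγ, if_pos rfl]

lemma rieszCoeff_one (hγ : γ ∈ Λ) :
    rieszCoeff Λ ω γ 1 = ω γ * (Real.sinh (1 / 2) / 2 : ℝ) := by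
  rw [rieszCoeff, if_pos hγ, if_neg (by norm_num), if_pos rfl]

lemma rieszCoeff_neg_one (hγ : γ ∈ Λ) :
    rieszCoeff Λ ω γ (-1) = (starRingEnd ℂ) (ω γ) * (Real.sinh (1 / 2) / 2 : ℝ) := by
  rw [rieszCoeff, if_pos hγ, if_neg (by norm_num), if_neg (by norm_num)]

end

/-- The Riesz product attached to `Λ` with phases `ω`. -/
def riesz (Λ : Finset (AddChar G ℂ)) (ω : AddChar G ℂ → ℂ) (x : G) : ℝ :=
  ∏ γ ∈ Λ, (Real.cosh (1 / 2) + (ω γ * γ x).re * Real.sinh (1 / 2))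

lemma riesz_eq_sum (Λ : Finset (AddChar G ℂ)) (ω : AddChar G ℂ → ℂ) (x : G) :
    (riesz Λ ω x : ℂ) =
      ∑ m ∈ signPatterns Λ, (∏ γ, rieszCoeff Λ ω γ (m γ)) * charProd m x := by
  have h := Finset.prod_univ_sum (fun γ : AddChar G ℂ => if γ ∈ Λ then ({-1, 0, 1} : Finset ℤ)
    else {0}) fun γ e => rieszCoeff Λ ω γ e * γ x ^ e
  simp_rw [Finset.prod_mul_distrib, ← charProd_apply] at h
  rw [signPatterns, ← h, riesz, ← Finset.prod_subset (Finset.subset_univ Λ)]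
  · rw [Complex.ofReal_prod]
    refine Finset.prod_congr rfl fun γ hγ => ?_
    rw [if_pos hγ, Finset.sum_insert (by simp), Finset.sum_insert (by simp), Finset.sum_singleton]
    have e1 : γ x ^ (-1 : ℤ) = (starRingEnd ℂ) (γ x) := by
      rw [zpow_neg_one, ← AddChar.map_neg_eq_conj, AddChar.map_neg_eq_inv]
    have e2 : (((ω γ * γ x).re : ℝ) : ℂ) =
        (ω γ * γ x + (starRingEnd ℂ) (ω γ) * (starRingEnd ℂ) (γ x)) / 2 := by
      rw [Complex.re_eq_add_conj, map_mul]
    rw [Complex.ofReal_add, Complex.ofReal_mul, e2, rieszCoeff_neg_one hγ, rieszCoeff_zero hγ,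
      rieszCoeff_one hγ, e1, zpow_zero, zpow_one, Complex.ofReal_div, Complex.ofReal_ofNat]
    ring
  · intro γ _ hγ
    simp [rieszCoeff, hγ]

lemma sum_norm_rieszCoeff_le (Λ : Finset (AddChar G ℂ)) (ω : AddChar G ℂ → ℂ)
    (hω : ∀ γ, ‖ω γ‖ ≤ 1) :
    ∑ m ∈ signPatterns Λ, ‖∏ γ, rieszCoeff Λ ω γ (m γ)‖ ≤ Real.exp (Λ.card / 2) := by
  have h := Finset.prod_univ_sum (fun γ : AddChar G ℂ => if γ ∈ Λ then ({-1, 0, 1} : Finset ℤ)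
    else {0}) fun γ e => ‖rieszCoeff Λ ω γ e‖
  simp_rw [norm_prod]
  rw [signPatterns, ← h, ← Finset.prod_subset (Finset.subset_univ Λ)]
  · have e : Real.exp (Λ.card / 2) = ∏ γ ∈ Λ, Real.exp (1 / 2) := by
      rw [Finset.prod_const, ← Real.exp_nat_mul]; congr 1; ring
    rw [e]
    refine Finset.prod_le_prod (fun γ _ => Finset.sum_nonneg fun _ _ => norm_nonneg _)
      fun γ hγ => ?_
    rw [if_pos hγ, Finset.sum_insert (by simp), Finset.sum_insert (by simp), Finset.sum_singleton]
    rw [rieszCoeff_neg_one hγ, rieszCoeff_zero hγ, rieszCoeff_one hγ]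
    have hs : 0 ≤ Real.sinh (1 / 2) := Real.sinh_nonneg_iff.2 (by norm_num)
    have hc := (Real.cosh_pos (1 / 2)).le
    have hs2 : ‖((Real.sinh (1 / 2) / 2 : ℝ) : ℂ)‖ = Real.sinh (1 / 2) / 2 := by
      rw [Complex.norm_real, Real.norm_of_nonneg (by linarith)]
    have hc2 : ‖((Real.cosh (1 / 2) : ℝ) : ℂ)‖ = Real.cosh (1 / 2) := by
      rw [Complex.norm_real, Real.norm_of_nonneg hc]
    rw [← Real.cosh_add_sinh, norm_mul, norm_mul, hs2, hc2, RCLike.norm_conj]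
    nlinarith [mul_le_mul_of_nonneg_right (hω γ) hs]
  · intro γ _ hγ
    simp [rieszCoeff, hγ]

lemma exp_le_riesz (Λ : Finset (AddChar G ℂ)) (ω : AddChar G ℂ → ℂ)
    (hω : ∀ γ, ‖ω γ‖ ≤ 1) (x : G) :
    Real.exp ((∑ γ ∈ Λ, (ω γ * γ x).re) / 2) ≤ riesz Λ ω x := by
  have e : Real.exp ((∑ γ ∈ Λ, (ω γ * γ x).re) / 2) =
      ∏ γ ∈ Λ, Real.exp ((ω γ * γ x).re * (1 / 2)) := by
    rw [← Real.exp_sum, ← Finset.sum_mul]; congr 1; ring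
  rw [e, riesz]
  refine Finset.prod_le_prod (fun _ _ => (Real.exp_pos _).le) fun γ _ => ?_
  refine Real.exp_mul_le_cosh_add_mul_sinh ?_ _
  refine (Complex.abs_re_le_norm _).trans ?_
  rw [norm_mul, AddChar.norm_apply, mul_one]
  exact hω γ

lemma smooth_riesz_le (B : Finset G) (Λ : Finset (AddChar G ℂ)) (hΛ : IsDissoc B Λ)
    (ω : AddChar G ℂ → ℂ) (hω : ∀ γ, ‖ω γ‖ ≤ 1) (R : ℕ) (hR : Λ.card ≤ R) (u : G) :
    (smooth B)^[R] (riesz Λ ω) u ≤ 2 * Real.exp (Λ.card / 8) := by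
  obtain ⟨C, hC⟩ : ∃ C : (AddChar G ℂ → ℤ) → ℂ, C = fun m => ∏ γ, rieszCoeff Λ ω γ (m γ) :=
    ⟨_, rfl⟩
  have hexp : ∀ (w : AddChar G ℂ → ℂ) (x : G),
      ∑ γ, (∑ m ∈ signPatterns Λ, if charProd m = γ then C m else 0) * w γ * γ x =
        ∑ m ∈ signPatterns Λ, C m * w (charProd m) * charProd m x := by
    intro w x
    simp_rw [Finset.sum_mul]
    rw [Finset.sum_comm]
    refine Finset.sum_congr rfl fun m _ => ?_
    simp_rw [ite_mul, zero_mul]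
    rw [Finset.sum_ite_eq]
    simp
  have h0 : ∀ x, (riesz Λ ω x : ℂ) =
      ∑ γ : AddChar G ℂ, (∑ m ∈ signPatterns Λ, if charProd m = γ then C m else 0) * γ x := by
    intro x
    have := hexp (fun _ => 1) x
    simp only [mul_one] at this
    rw [this, riesz_eq_sum, hC]
  have h1 := smooth_iterate_eq_sum B (riesz Λ ω) _ h0 R u
  rw [hexp fun γ => (((‖muHat B γ‖ ^ 2) ^ R : ℝ) : ℂ)] at h1
  refine (le_abs_self _).trans ?_
  rw [← Real.norm_eq_abs, ← Complex.norm_real, h1]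
  refine (norm_sum_le _ _).trans ?_
  have hzero : (0 : AddChar G ℂ → ℤ) ∈ signPatterns Λ := by
    rw [mem_signPatterns]; intro γ; simp
  rw [← Finset.add_sum_erase _ _ hzero]
  have hterm : ∀ m, ‖C m * (((‖muHat B (charProd m)‖ ^ 2) ^ R : ℝ) : ℂ) * charProd m u‖ =
      ‖C m‖ * (‖muHat B (charProd m)‖ ^ 2) ^ R := by
    intro m
    rw [norm_mul, norm_mul, AddChar.norm_apply, mul_one, Complex.norm_real,
      Real.norm_of_nonneg (by positivity)]
  have hA : ‖C 0‖ ≤ Real.exp (Λ.card / 8) := by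
    have e : C 0 = ((Real.cosh (1 / 2) ^ Λ.card : ℝ) : ℂ) := by
      rw [hC]
      simp only [Pi.zero_apply]
      rw [← Finset.prod_subset (Finset.subset_univ Λ), Complex.ofReal_pow, ← Finset.prod_const]
      · exact Finset.prod_congr rfl fun γ hγ => by rw [rieszCoeff, if_pos hγ, if_pos rfl]
      · intro γ _ hγ
        rw [rieszCoeff, if_neg hγ]
    have hc := (Real.cosh_pos (1 / 2)).le
    rw [e, Complex.norm_real, Real.norm_of_nonneg (pow_nonneg hc _)]
    refine (pow_le_pow_left₀ hc (Real.cosh_le_exp_half_sq _) _).trans ?_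
    rw [← Real.exp_nat_mul]
    refine Real.exp_le_exp.2 (le_of_eq ?_)
    ring
  have hAA : ‖C 0‖ * (‖muHat B (charProd 0)‖ ^ 2) ^ R ≤ Real.exp (Λ.card / 8) := by
    refine le_trans (mul_le_of_le_one_right (norm_nonneg _) ?_) hA
    refine pow_le_one₀ (by positivity) ?_
    have := norm_muHat_le_one B (charProd (0 : AddChar G ℂ → ℤ))
    nlinarith [norm_nonneg (muHat B (charProd (0 : AddChar G ℂ → ℤ)))]
  have hBB : ∑ m ∈ (signPatterns Λ).erase 0,
      ‖C m‖ * (‖muHat B (charProd m)‖ ^ 2) ^ R ≤ 1 := by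
    calc ∑ m ∈ (signPatterns Λ).erase 0, ‖C m‖ * (‖muHat B (charProd m)‖ ^ 2) ^ R
        ≤ ∑ m ∈ (signPatterns Λ).erase 0, ‖C m‖ * (1 / 4) ^ R := by
          refine Finset.sum_le_sum fun m hm => mul_le_mul_of_nonneg_left ?_ (norm_nonneg _)
          rw [Finset.mem_erase] at hm
          have := hΛ m hm.2 hm.1
          refine pow_le_pow_left₀ (by positivity) ?_ _
          nlinarith [norm_nonneg (muHat B (charProd m))]
      _ ≤ Real.exp (Λ.card / 2) * (1 / 4) ^ R := by
          rw [← Finset.sum_mul]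
          refine mul_le_mul_of_nonneg_right ?_ (by positivity)
          refine le_trans (Finset.sum_le_sum_of_subset_of_nonneg (Finset.erase_subset _ _)
            fun _ _ _ => norm_nonneg _) ?_
          rw [hC]
          exact sum_norm_rieszCoeff_le Λ ω hω
      _ ≤ Real.exp (1 / 2) ^ R * (1 / 4) ^ R := by
          refine mul_le_mul_of_nonneg_right ?_ (by positivity)
          rw [← Real.exp_nat_mul]
          refine Real.exp_le_exp.2 ?_
          have : (Λ.card : ℝ) ≤ R := Nat.cast_le.2 hR
          linarith
      _ ≤ 1 := by
          rw [← mul_pow]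
          refine pow_le_one₀ (by positivity) ?_
          have h2 : Real.exp (1 / 2) ≤ Real.exp 1 := Real.exp_le_exp.2 (by norm_num)
          have := Real.exp_one_lt_d9
          linarith
  simp_rw [hterm]
  have : 1 ≤ Real.exp ((Λ.card : ℝ) / 8) := Real.one_le_exp (by positivity)
  linarith

omit [Fintype G] in
lemma smooth_nonneg (T : Finset G) (φ : G → ℝ) (h : ∀ x, 0 ≤ φ x) (k : ℕ) (u : G) :
    0 ≤ (smooth T)^[k] φ u := by
  induction k generalizing u with
  | zero => exact h u
  | succ k ih =>
    rw [Function.iterate_succ_apply', smooth]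
    exact div_nonneg (Finset.sum_nonneg fun _ _ => Finset.sum_nonneg fun _ _ => ih _)
      (by positivity)

lemma sum_bohr_le_sum_smooth (Γ : Finset (AddChar G ℂ)) (ρ σ : ℝ) (hσ : 0 ≤ σ) (φ : G → ℝ)
    (h : ∀ x, 0 ≤ φ x) (k : ℕ) :
    ∑ x ∈ bohr Γ ρ, φ x ≤ ∑ x ∈ bohr Γ (ρ + 2 * k * σ), (smooth (bohr Γ σ))^[k] φ x := by
  induction k with
  | zero => simp
  | succ k ih =>
    refine ih.trans ?_
    obtain ⟨f, hf⟩ : ∃ f, f = (smooth (bohr Γ σ))^[k] φ := ⟨_, rfl⟩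
    have hf0 : ∀ x, 0 ≤ f x := fun x => by rw [hf]; exact smooth_nonneg _ _ h k x
    simp only [Function.iterate_succ_apply']
    rw [← hf]
    simp only [smooth]
    have hc : (0 : ℝ) < (bohr Γ σ).card := card_bohr_pos hσ
    rw [← Finset.sum_div, le_div_iff₀ (by positivity), Finset.sum_comm]
    have key : ∀ t ∈ bohr Γ σ, ∀ t' ∈ bohr Γ σ, ∑ x ∈ bohr Γ (ρ + 2 * k * σ), f x ≤
        ∑ y ∈ bohr Γ (ρ + 2 * (k + 1 : ℕ) * σ), f (y + (t - t')) := by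
      intro t ht t' ht'
      have e : ∑ x ∈ bohr Γ (ρ + 2 * k * σ), f x =
          ∑ y ∈ (bohr Γ (ρ + 2 * k * σ)).image (fun x => x - (t - t')), f (y + (t - t')) := by
        rw [Finset.sum_image fun a _ b _ hab => sub_left_injective hab]
        exact Finset.sum_congr rfl fun x _ => by rw [sub_add_cancel]
      rw [e]
      refine Finset.sum_le_sum_of_subset_of_nonneg (fun y hy => ?_) fun _ _ _ => hf0 _
      obtain ⟨x, hx, rfl⟩ := Finset.mem_image.1 hy
      refine bohr_mono (le_of_eq ?_) (sub_mem_bohr hx (sub_mem_bohr ht ht'))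
      push_cast; ring
    calc (∑ x ∈ bohr Γ (ρ + 2 * k * σ), f x) * ((bohr Γ σ).card : ℝ) ^ 2
        = ∑ t ∈ bohr Γ σ, ∑ t' ∈ bohr Γ σ, ∑ x ∈ bohr Γ (ρ + 2 * k * σ), f x := by
          simp only [Finset.sum_const, nsmul_eq_mul]; ring
      _ ≤ ∑ t ∈ bohr Γ σ, ∑ t' ∈ bohr Γ σ,
            ∑ y ∈ bohr Γ (ρ + 2 * (k + 1 : ℕ) * σ), f (y + (t - t')) :=
          Finset.sum_le_sum fun t ht => Finset.sum_le_sum fun t' ht' => key t ht t' ht'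
      _ = _ := Finset.sum_congr rfl fun t _ => Finset.sum_comm

/-- Chang's bound for dissociated subsets of the large spectrum, relative to a Bohr set. -/
lemma card_le_of_isDissoc (Γ : Finset (AddChar G ℂ)) (ρ σ : ℝ) (hσ : 0 ≤ σ) (T : Finset G)
    (hT : T.Nonempty) (hTB : T ⊆ bohr Γ ρ) (τ : ℝ) (hτ : 0 < τ)
    (hTτ : τ * (bohr Γ ρ).card ≤ T.card) (R : ℕ)
    (hY : ((bohr Γ (ρ + 2 * R * σ)).card : ℝ) ≤ 2 * (bohr Γ ρ).card)
    (Λ : Finset (AddChar G ℂ)) (hΛ : IsDissoc (bohr Γ σ) Λ) (hR : Λ.card ≤ R)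
    (hspec : ∀ γ ∈ Λ, 1 / 2 ≤ ‖muHat T γ‖) : (Λ.card : ℝ) ≤ 8 * Real.log (4 / τ) := by
  obtain ⟨ω, hω⟩ : ∃ ω : AddChar G ℂ → ℂ, ω = fun γ =>
      (starRingEnd ℂ) (muHat T γ) / ‖muHat T γ‖ := ⟨_, rfl⟩
  have hω1 : ∀ γ, ‖ω γ‖ ≤ 1 := fun γ => by
    rw [hω]
    simp only [norm_div, RCLike.norm_conj, Complex.norm_real, norm_norm]
    exact div_self_le_one _
  have hT0 : (0 : ℝ) < T.card := Nat.cast_pos.2 hT.card_pos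
  have hωm : ∀ γ, ω γ * muHat T γ = (‖muHat T γ‖ : ℂ) := fun γ => by
    rw [hω]
    simp only
    rw [div_mul_eq_mul_div, Complex.conj_mul', pow_two]
    by_cases h : ((‖muHat T γ‖ : ℝ) : ℂ) = 0
    · rw [h]; simp
    · field_simp
  have hsum : ∑ x ∈ T, ∑ γ ∈ Λ, (ω γ * γ x).re = T.card * ∑ γ ∈ Λ, ‖muHat T γ‖ := by
    rw [Finset.sum_comm, Finset.mul_sum]
    refine Finset.sum_congr rfl fun γ _ => ?_
    rw [← Complex.re_sum, ← Finset.mul_sum]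
    have : ∑ x ∈ T, γ x = T.card * muHat T γ := by
      rw [muHat]
      have : (T.card : ℂ) ≠ 0 := by exact_mod_cast hT.card_pos.ne'
      field_simp
    rw [this, mul_left_comm, hωm, ← Complex.ofReal_natCast, ← Complex.ofReal_mul,
      Complex.ofReal_re]
  have hr : (Λ.card : ℝ) / 2 ≤ ∑ γ ∈ Λ, ‖muHat T γ‖ := by
    have := Finset.card_nsmul_le_sum Λ (fun γ => ‖muHat T γ‖) (1 / 2) hspec
    rw [nsmul_eq_mul] at this
    linarith
  obtain ⟨r, hrdef⟩ : ∃ r : ℝ, r = Λ.card := ⟨_, rfl⟩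
  rw [← hrdef] at hr ⊢
  have hlow : T.card * Real.exp (r / 4) ≤ ∑ x ∈ T, riesz Λ ω x := by
    have h1 : ∀ x ∈ T, Real.exp (r / 4) * (1 + ((∑ γ ∈ Λ, (ω γ * γ x).re) / 2 - r / 4)) ≤
        riesz Λ ω x := by
      intro x _
      refine le_trans ?_ (exp_le_riesz Λ ω hω1 x)
      have h2 := Real.add_one_le_exp ((∑ γ ∈ Λ, (ω γ * γ x).re) / 2 - r / 4)
      have h3 : Real.exp ((∑ γ ∈ Λ, (ω γ * γ x).re) / 2) = Real.exp (r / 4) *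
          Real.exp ((∑ γ ∈ Λ, (ω γ * γ x).re) / 2 - r / 4) := by
        rw [← Real.exp_add]; congr 1; ring
      rw [h3]
      refine mul_le_mul_of_nonneg_left ?_ (Real.exp_pos _).le
      linarith
    refine le_trans ?_ (Finset.sum_le_sum h1)
    rw [← Finset.mul_sum, Finset.sum_add_distrib, Finset.sum_sub_distrib, ← Finset.sum_div, hsum,
      mul_comm (T.card : ℝ)]
    refine mul_le_mul_of_nonneg_left ?_ (Real.exp_pos _).le
    simp only [Finset.sum_const, nsmul_eq_mul, mul_one]
    nlinarith
  have hpos : ∀ x, 0 ≤ riesz Λ ω x := fun x =>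
    (Real.exp_pos _).le.trans (exp_le_riesz Λ ω hω1 x)
  have hup : ∑ x ∈ T, riesz Λ ω x ≤ 2 * (bohr Γ ρ).card * (2 * Real.exp (r / 8)) := by
    refine (Finset.sum_le_sum_of_subset_of_nonneg hTB fun _ _ _ => hpos _).trans ?_
    refine (sum_bohr_le_sum_smooth Γ ρ σ hσ _ hpos R).trans ?_
    refine (Finset.sum_le_sum fun x _ => smooth_riesz_le _ Λ hΛ ω hω1 R hR x).trans ?_
    rw [Finset.sum_const, nsmul_eq_mul, ← hrdef]
    exact mul_le_mul_of_nonneg_right hY (by positivity)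
  have h4 : Real.exp (r / 4) = Real.exp (r / 8) * Real.exp (r / 8) := by
    rw [← Real.exp_add]; congr 1; ring
  have he := Real.exp_pos (r / 8)
  have hB0 : (0 : ℝ) < (bohr Γ ρ).card :=
    Nat.cast_pos.2 (Finset.card_pos.2 (hT.mono hTB))
  have h5 : Real.exp (r / 8) ≤ 4 / τ := by
    rw [le_div_iff₀ hτ]
    have h6 : τ * (bohr Γ ρ).card * (Real.exp (r / 8) * Real.exp (r / 8)) ≤
        2 * (bohr Γ ρ).card * (2 * Real.exp (r / 8)) := by
      rw [← h4]
      exact (mul_le_mul_of_nonneg_right hTτ (Real.exp_pos _).le).trans (hlow.trans hup)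
    have h7 : (Real.exp (r / 8) * τ) * ((bohr Γ ρ).card * Real.exp (r / 8)) ≤
        4 * ((bohr Γ ρ).card * Real.exp (r / 8)) := by nlinarith
    exact le_of_mul_le_mul_right h7 (mul_pos hB0 he)
  have := (Real.le_log_iff_exp_le (by positivity)).2 h5
  linarith

lemma norm_sub_one_le_of_pow {z : ℂ} {M : ℕ} (hM : 1 ≤ M)
    (h : ∀ j ≤ M, ‖z ^ j - 1‖ ≤ 1 / 2) : ‖z - 1‖ ≤ 1 / M := by
  have hM0 : (0 : ℝ) < M := Nat.cast_pos.2 hM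
  have e := mul_geom_sum z M
  have h1 : ‖(∑ i ∈ Finset.range M, z ^ i) - M‖ ≤ M / 2 := by
    have : (∑ i ∈ Finset.range M, z ^ i) - (M : ℂ) = ∑ i ∈ Finset.range M, (z ^ i - 1) := by
      simp
    rw [this]
    refine (norm_sum_le _ _).trans ?_
    refine (Finset.sum_le_sum fun i hi => h i (Finset.mem_range.1 hi).le).trans (le_of_eq ?_)
    simp; ring
  have h2 : (M : ℝ) / 2 ≤ ‖∑ i ∈ Finset.range M, z ^ i‖ := by
    have := norm_sub_norm_le (M : ℂ) (∑ i ∈ Finset.range M, z ^ i)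
    rw [norm_sub_rev, Complex.norm_natCast] at this
    linarith
  have h3 := h M le_rfl
  rw [← e, norm_mul] at h3
  rw [le_div_iff₀ hM0]
  nlinarith [norm_nonneg (z - 1)]

lemma nsmul_mem_bohr {Γ : Finset (AddChar G ℂ)} {σ : ℝ} {v : G}
    (hv : v ∈ bohr Γ σ) (j : ℕ) : j • v ∈ bohr Γ (j * σ) := by
  induction j with
  | zero => rw [zero_smul]; exact zero_mem_bohr (by simp)
  | succ j ih =>
    rw [succ_nsmul]
    refine bohr_mono (le_of_eq ?_) (add_mem_bohr ih hv)
    push_cast; ring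

lemma norm_muHat_mul_sub_one_le {Γ : Finset (AddChar G ℂ)} {σ : ℝ} (hσ : 0 ≤ σ)
    (hreg : IsRegBohr Γ σ) (χ : AddChar G ℂ) {v : G} (hv : v ∈ bohr Γ (σ * regScale Γ)) :
    ‖muHat (bohr Γ σ) χ‖ * ‖χ v - 1‖ ≤ 1 / 50 := by
  obtain ⟨B, hB⟩ : ∃ B, B = bohr Γ σ := ⟨_, rfl⟩
  have hB0 : (0 : ℝ) < B.card := by rw [hB]; exact card_bohr_pos hσ
  obtain ⟨P, hP⟩ : ∃ P, P = bohr Γ (σ * (1 + regScale Γ)) := ⟨_, rfl⟩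
  have hη := (regScale_pos Γ).le
  have hBP : B ⊆ P := by
    rw [hB, hP]; exact bohr_mono (by nlinarith)
  have hBvP : B.image (· + v) ⊆ P := by
    intro y hy
    obtain ⟨x, hx, rfl⟩ := Finset.mem_image.1 hy
    rw [hB] at hx
    rw [hP, mul_add, mul_one]
    exact add_mem_bohr hx hv
  have hcard : (P.card : ℝ) ≤ 101 / 100 * B.card := by rw [hP, hB]; exact hreg
  have hcomp : ∀ S ⊆ P, S.card = B.card → ‖∑ x ∈ P, χ x - ∑ x ∈ S, χ x‖ ≤ 1 / 100 * B.card := by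
    intro S hS hSB
    rw [← Finset.sum_sdiff hS, add_sub_cancel_right]
    refine (norm_sum_le _ _).trans ?_
    simp only [AddChar.norm_apply, Finset.sum_const, nsmul_eq_mul, mul_one]
    rw [Finset.card_sdiff_of_subset hS, Nat.cast_sub (Finset.card_le_card hS), hSB]
    linarith
  have hS2 : ∑ x ∈ B.image (· + v), χ x = χ v * ∑ x ∈ B, χ x := by
    rw [Finset.sum_image fun a _ b _ hab => add_left_injective v hab, Finset.mul_sum]
    exact Finset.sum_congr rfl fun x _ => by rw [AddChar.map_add_eq_mul, mul_comm]
  have h1 := hcomp B hBP rfl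
  have h2 := hcomp _ hBvP (Finset.card_image_of_injective _ (add_left_injective v))
  rw [hS2] at h2
  have h3 : (∑ x ∈ B, χ x) * (χ v - 1) = (∑ x ∈ P, χ x - ∑ x ∈ B, χ x) -
      (∑ x ∈ P, χ x - χ v * ∑ x ∈ B, χ x) := by ring
  rw [← hB, muHat, ← norm_mul, div_mul_eq_mul_div, h3, norm_div, Complex.norm_natCast,
    div_le_iff₀ hB0]
  refine (norm_sub_le _ _).trans ?_
  linarith

lemma norm_sub_one_le_of_correlates {Γ : Finset (AddChar G ℂ)} {σ : ℝ} (hσ : 0 ≤ σ)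
    (hreg : IsRegBohr Γ σ) {χ : AddChar G ℂ} (hχ : 1 / 2 < ‖muHat (bohr Γ σ) χ‖) {M : ℕ}
    (hM : 1 ≤ M) {v : G} (hv : v ∈ bohr Γ (σ * regScale Γ / M)) : ‖χ v - 1‖ ≤ 1 / M := by
  have hM0 : (0 : ℝ) < M := Nat.cast_pos.2 hM
  refine norm_sub_one_le_of_pow hM fun j hj => ?_
  rw [← AddChar.map_nsmul_eq_pow]
  have hjM : (j : ℝ) ≤ M := Nat.cast_le.2 hj
  have h0 : 0 ≤ σ * regScale Γ := mul_nonneg hσ (regScale_pos Γ).le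
  have h1 : j • v ∈ bohr Γ (σ * regScale Γ) := by
    refine bohr_mono ?_ (nsmul_mem_bohr hv j)
    rw [mul_div_assoc', div_le_iff₀ hM0, mul_comm]
    exact mul_le_mul_of_nonneg_left hjM h0
  have h2 := norm_muHat_mul_sub_one_le hσ hreg χ h1
  nlinarith [norm_nonneg (χ (j • v) - 1)]

lemma norm_zpow_sign_sub_one (γ : AddChar G ℂ) (e : ℤ) (he : e = -1 ∨ e = 0 ∨ e = 1) (v : G) :
    ‖γ v ^ e - 1‖ ≤ ‖γ v - 1‖ := by
  rcases he with rfl | rfl | rfl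
  · rw [zpow_neg_one, ← AddChar.map_neg_eq_inv, norm_map_neg_sub_one]
  · simp
  · simp

lemma norm_zpow_sign_sub_one' (γ : AddChar G ℂ) (e : ℤ) (he : e = -1 ∨ e = 1) (v : G) :
    ‖γ v ^ e - 1‖ = ‖γ v - 1‖ := by
  rcases he with rfl | rfl
  · rw [zpow_neg_one, ← AddChar.map_neg_eq_inv, norm_map_neg_sub_one]
  · simp

lemma norm_prod_sub_one_le {ι : Type*} (s : Finset ι) (z : ι → ℂ) (hz : ∀ i, ‖z i‖ ≤ 1) :
    ‖∏ i ∈ s, z i - 1‖ ≤ ∑ i ∈ s, ‖z i - 1‖ := by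
  induction s using Finset.induction_on with
  | empty => simp
  | insert a s ha ih =>
    rw [Finset.prod_insert ha, Finset.sum_insert ha]
    have e : z a * ∏ i ∈ s, z i - 1 = z a * (∏ i ∈ s, z i - 1) + (z a - 1) := by ring
    rw [e]
    refine (norm_add_le _ _).trans ?_
    rw [norm_mul, add_comm]
    exact add_le_add le_rfl ((mul_le_of_le_one_left (norm_nonneg _) (hz a)).trans ih)

/-- Chang's theorem relative to a Bohr set: the large spectrum of `T` is controlled by few
characters. -/
lemma exists_chang (Γ : Finset (AddChar G ℂ)) (ρ σ : ℝ) (hσ : 0 ≤ σ) (hreg : IsRegBohr Γ σ)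
    (T : Finset G) (hT : T.Nonempty) (hTB : T ⊆ bohr Γ ρ) (τ : ℝ) (hτ : 0 < τ)
    (hTτ : τ * (bohr Γ ρ).card ≤ T.card) (R : ℕ) (hR : 8 * Real.log (4 / τ) < R)
    (hY : ((bohr Γ (ρ + 2 * R * σ)).card : ℝ) ≤ 2 * (bohr Γ ρ).card) :
    ∃ Λ : Finset (AddChar G ℂ), Λ.card ≤ R ∧ ∀ (M : ℕ) (κ : ℝ) (v : G), 1 ≤ M → 0 ≤ κ →
      v ∈ bohr Γ (σ * regScale Γ / M) → v ∈ bohr Λ κ →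
      ∀ γ, 1 / 2 ≤ ‖muHat T γ‖ → ‖γ v - 1‖ ≤ 1 / M + R * κ := by
  obtain ⟨F, hF⟩ : ∃ F : Finset (Finset (AddChar G ℂ)), F = Finset.univ.filter fun Λ =>
      (∀ γ ∈ Λ, 1 / 2 ≤ ‖muHat T γ‖) ∧ Λ.card ≤ R ∧ IsDissoc (bohr Γ σ) Λ := ⟨_, rfl⟩
  have hFne : F.Nonempty := by
    refine ⟨∅, ?_⟩
    rw [hF, Finset.mem_filter]
    refine ⟨Finset.mem_univ _, by simp, by simp, fun m hm hm0 => absurd ?_ hm0⟩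
    funext γ
    exact ((mem_signPatterns.1 hm) γ).2 (by simp)
  obtain ⟨Λ, hΛF, hmax⟩ := Finset.exists_max_image F Finset.card hFne
  have hmem : ∀ Δ, Δ ∈ F ↔ (∀ γ ∈ Δ, 1 / 2 ≤ ‖muHat T γ‖) ∧ Δ.card ≤ R ∧
      IsDissoc (bohr Γ σ) Δ := fun Δ => by
    rw [hF, Finset.mem_filter]
    exact ⟨fun h => h.2, fun h => ⟨Finset.mem_univ _, h⟩⟩
  obtain ⟨hspec, hcard, hdis⟩ := (hmem Λ).1 hΛF
  have hlt : Λ.card < R := by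
    have := card_le_of_isDissoc Γ ρ σ hσ T hT hTB τ hτ hTτ R hY Λ hdis hcard hspec
    exact (Nat.cast_lt (α := ℝ)).1 (this.trans_lt hR)
  refine ⟨Λ, hcard, fun M κ v hM hκ hvΓ hvΛ γ hγ => ?_⟩
  have hM0 : (0 : ℝ) < M := Nat.cast_pos.2 hM
  have hR1 : (1 : ℝ) ≤ R := by exact_mod_cast (Nat.zero_le _).trans_lt hlt
  have hΛR : (Λ.card : ℝ) ≤ R := Nat.cast_le.2 hcard
  by_cases hγΛ : γ ∈ Λ
  · refine (mem_bohr.1 hvΛ γ hγΛ).trans ?_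
    have : 0 ≤ 1 / (M : ℝ) := by positivity
    nlinarith
  have hnot : insert γ Λ ∉ F := fun h => by
    have := hmax _ h
    rw [Finset.card_insert_of_notMem hγΛ] at this
    omega
  have hnd : ¬ IsDissoc (bohr Γ σ) (insert γ Λ) := by
    refine fun h => hnot ((hmem _).2 ⟨?_, ?_, h⟩)
    · intro χ hχ
      rcases Finset.mem_insert.1 hχ with rfl | hχ
      · exact hγ
      · exact hspec χ hχ
    · rw [Finset.card_insert_of_notMem hγΛ]; exact hlt
  rw [IsDissoc] at hnd
  push Not at hnd
  obtain ⟨m, hm, hm0, hmB⟩ := hnd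
  rw [mem_signPatterns] at hm
  have hmγ : m γ ≠ 0 := by
    intro h0
    refine absurd (hdis m (mem_signPatterns.2 fun χ => ⟨fun hχ => ?_, fun hχ => ?_⟩) hm0)
      (not_le.2 hmB)
    · exact (hm χ).1 (Finset.mem_insert_of_mem hχ)
    · by_cases hχγ : χ = γ
      · rw [hχγ]; exact h0
      · exact (hm χ).2 (by rw [Finset.mem_insert]; tauto)
  have hmγ' : m γ = -1 ∨ m γ = 1 := by
    have := (hm γ).1 (Finset.mem_insert_self _ _)
    tauto
  have hχv := norm_sub_one_le_of_correlates hσ hreg hmB hM hvΓ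
  have hprod : charProd m v = γ v ^ m γ * ∏ χ ∈ Λ, χ v ^ m χ := by
    rw [charProd_apply, ← Finset.prod_insert (f := fun χ : AddChar G ℂ => χ v ^ m χ) hγΛ]
    refine (Finset.prod_subset (Finset.subset_univ _) fun χ _ hχ => ?_).symm
    rw [(hm χ).2 hχ, zpow_zero]
  have hz : ∀ χ : AddChar G ℂ, ‖χ v ^ m χ‖ = 1 := fun χ => by
    rw [norm_zpow, AddChar.norm_apply, one_zpow]
  have hrest : ‖∏ χ ∈ Λ, χ v ^ m χ - 1‖ ≤ R * κ := by
    refine (norm_prod_sub_one_le Λ _ fun χ => (hz χ).le).trans ?_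
    refine (Finset.sum_le_sum (g := fun _ => κ) fun χ hχ => ?_).trans ?_
    · exact (norm_zpow_sign_sub_one χ _ ((hm χ).1 (Finset.mem_insert_of_mem hχ)) v).trans
        (mem_bohr.1 hvΛ χ hχ)
    · rw [Finset.sum_const, nsmul_eq_mul]
      exact mul_le_mul_of_nonneg_right hΛR hκ
  rw [← norm_zpow_sign_sub_one' γ _ hmγ' v]
  have e : γ v ^ m γ - 1 = (charProd m v - 1) - γ v ^ m γ * (∏ χ ∈ Λ, χ v ^ m χ - 1) := by
    rw [hprod]; ring
  rw [e]
  refine (norm_sub_le _ _).trans (add_le_add hχv ?_)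
  rw [norm_mul, hz γ, one_mul]
  exact hrest

end Dissociation

section Smoothing

variable [AddCommGroup G]

lemma sum_translates (A P B : Finset G) (hP : ∀ a ∈ A, ∀ b ∈ B, a - b ∈ P) (F : G → ℝ) :
    ∑ t ∈ P, ∑ a ∈ A.filter (fun a => a - t ∈ B), F a = B.card * ∑ a ∈ A, F a := by
  simp_rw [Finset.sum_filter]
  rw [Finset.sum_comm, Finset.mul_sum]
  refine Finset.sum_congr rfl fun a ha => ?_
  rw [← Finset.sum_filter, Finset.sum_const, nsmul_eq_mul]
  congr 2
  refine Finset.card_bij' (fun t _ => a - t) (fun b _ => a - b) ?_ ?_ ?_ ?_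
  · intro t ht; exact (Finset.mem_filter.1 ht).2
  · intro b hb
    refine Finset.mem_filter.2 ⟨hP a ha b hb, ?_⟩
    rw [sub_sub_cancel]; exact hb
  · intro t _; exact sub_sub_cancel _ _
  · intro b _; exact sub_sub_cancel _ _

lemma exists_translate (A P B : Finset G) (hP : ∀ a ∈ A, ∀ b ∈ B, a - b ∈ P) (F : G → ℝ) (C : ℝ)
    (hC : C * P.card < B.card * ∑ a ∈ A, F a) :
    ∃ t ∈ P, C < ∑ a ∈ A.filter (fun a => a - t ∈ B), F a := by
  by_contra hcon
  push Not at hcon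
  have := Finset.sum_le_sum hcon
  rw [sum_translates A P B hP F, Finset.sum_const, nsmul_eq_mul, mul_comm (P.card : ℝ)] at this
  linarith

/-- Most pairs of `A × A₂` stay good for a dense piece `A₂` of `A` inside a translate of `B`. -/
lemma exists_dense_piece (A P B : Finset G) (hP : ∀ a ∈ A, ∀ b ∈ B, a - b ∈ P)
    (hA : A.Nonempty) (hB : B.Nonempty) (θ : ℝ) (hθ : θ * P.card ≤ 2 * A.card) (s : G → ℝ)
    (hs : ∑ a ∈ A, ∑ a' ∈ A, (1 - s (a' - a)) ≤ (A.card : ℝ) ^ 2 / 100) :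
    ∃ t ∈ P, (θ / 4) * A.card * B.card + 20 * ∑ a ∈ A, ∑ a' ∈ A.filter (fun a => a - t ∈ B),
      (1 - s (a' - a)) < A.card * (A.filter (fun a => a - t ∈ B)).card := by
  have hA0 : (0 : ℝ) < A.card := Nat.cast_pos.2 hA.card_pos
  have hB0 : (0 : ℝ) < B.card := Nat.cast_pos.2 hB.card_pos
  obtain ⟨t, ht, h⟩ := exists_translate A P B hP
    (fun a' => A.card - 20 * ∑ a ∈ A, (1 - s (a' - a))) ((θ / 4) * A.card * B.card) (by
      rw [Finset.sum_sub_distrib, ← Finset.mul_sum, Finset.sum_comm, Finset.sum_const,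
        nsmul_eq_mul]
      have h1 : θ / 4 * A.card * B.card * P.card ≤ (A.card * A.card) * B.card / 2 := by
        have := mul_le_mul_of_nonneg_right hθ (mul_pos hA0 hB0).le
        linarith
      have h2 := mul_le_mul_of_nonneg_left hs hB0.le
      have h3 := mul_pos (mul_pos hA0 hA0) hB0
      nlinarith)
  refine ⟨t, ht, ?_⟩
  rw [Finset.sum_sub_distrib, ← Finset.mul_sum, Finset.sum_const, nsmul_eq_mul,
    Finset.sum_comm] at h
  linarith

lemma abs_smooth_iterate_sub_self_le [Fintype G] (Γ : Finset (AddChar G ℂ)) (ρ r ε : ℝ)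
    (Ψ : G → ℝ) (T : Finset G) (hT : T.Nonempty) (hTB : T ⊆ bohr Γ ρ) (hρ : 0 ≤ ρ)
    (h : ∀ t ∈ T, ∀ t' ∈ T, ∀ u, u ∈ bohr Γ r → u + (t - t') ∈ bohr Γ r →
      |Ψ u - Ψ (u + (t - t'))| ≤ ε) (k : ℕ) (σ : ℝ) (hσ : σ + 2 * k * ρ ≤ r) (u : G)
    (hu : u ∈ bohr Γ σ) : |(smooth T)^[k] Ψ u - Ψ u| ≤ k * ε := by
  induction k generalizing σ u with
  | zero => simp
  | succ k ih =>
    rw [Function.iterate_succ_apply']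
    refine abs_smooth_sub_le T hT _ _ _ _ fun t ht t' ht' => ?_
    push_cast at hσ
    have hu' : u + (t - t') ∈ bohr Γ (σ + (ρ + ρ)) :=
      add_mem_bohr hu (sub_mem_bohr (hTB ht) (hTB ht'))
    have h1 := ih (σ + (ρ + ρ)) (by linarith) _ hu'
    have hk : 0 ≤ 2 * (k : ℝ) * ρ := mul_nonneg (mul_nonneg zero_le_two (Nat.cast_nonneg k)) hρ
    have h2 := h t ht t' ht' u (bohr_mono (by linarith) hu) (bohr_mono (by linarith) hu')
    rw [abs_sub_comm] at h2
    refine (abs_sub_le _ (Ψ (u + (t - t'))) _).trans ?_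
    push_cast
    linarith

lemma almostPeriods_numeric (n : ℕ) (ε : ℝ) (hε : ε = 1 / (200 * ((n : ℝ) + 4))) :
    808 / 200 * (2 : ℝ) ^ n ≤ ε * Real.exp (((480000 * (n + 4) ^ 3 : ℕ) : ℝ) * ε ^ 2 / 4) := by
  have hx : (0 : ℝ) < (n : ℝ) + 4 := by positivity
  have e : ((480000 * (n + 4) ^ 3 : ℕ) : ℝ) * ε ^ 2 / 4 =
      ((n : ℝ) + 4) + ((n : ℝ) + 4) + ((n : ℝ) + 4) := by
    rw [hε]; push_cast; field_simp; ring
  rw [e, Real.exp_add, Real.exp_add, hε, div_mul_eq_mul_div (1 : ℝ), one_mul,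
    le_div_iff₀ (by positivity)]
  obtain ⟨E, hE⟩ : ∃ E, E = Real.exp ((n : ℝ) + 4) := ⟨_, rfl⟩
  have h1 : (n : ℝ) + 4 ≤ E := by rw [hE]; linarith [Real.add_one_le_exp ((n : ℝ) + 4)]
  have h2 : (2 : ℝ) ^ n * 2.7 ^ 4 ≤ E := by
    rw [hE, Real.exp_add]
    have h3 : (2.7 : ℝ) ≤ Real.exp 1 := by linarith [Real.exp_one_gt_d9]
    have h4 : Real.exp n = Real.exp 1 ^ n := by rw [← Real.exp_nat_mul, mul_one]
    have h5 : Real.exp 4 = Real.exp 1 ^ 4 := by rw [← Real.exp_nat_mul]; norm_num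
    rw [h4, h5]
    exact mul_le_mul (pow_le_pow_left₀ (by norm_num) (by linarith) _)
      (pow_le_pow_left₀ (by norm_num) h3 _) (by positivity) (by positivity)
  have h6 : (2.7 : ℝ) ^ 4 ≤ E := by
    refine le_trans ?_ h2
    have : (1 : ℝ) ≤ 2 ^ n := one_le_pow₀ (by norm_num)
    nlinarith
  have hE0 : 0 < E := by rw [hE]; exact Real.exp_pos _
  rw [← hE]
  have h7 : (2 : ℝ) ^ n * 2.7 ^ 4 * ((n : ℝ) + 4) ≤ E * E := mul_le_mul h2 h1 hx.le hE0.le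
  have h8 : (2 : ℝ) ^ n * 2.7 ^ 4 * ((n : ℝ) + 4) * 2.7 ^ 4 ≤ E * E * E :=
    mul_le_mul h7 h6 (by positivity) (by positivity)
  refine le_trans ?_ h8
  have : 0 < (2 : ℝ) ^ n * ((n : ℝ) + 4) := by positivity
  nlinarith

lemma chang_rank_numeric (n : ℕ) (τ : ℝ)
    (hτ : τ = (2 ^ ((n + 3) * (480000 * (n + 4) ^ 3) + 1))⁻¹) :
    8 * Real.log (4 / τ) < ((4000000 * (n + 4) ^ 4 : ℕ) : ℝ) := by
  obtain ⟨P, hP⟩ : ∃ P, P = (n + 4) ^ 3 := ⟨_, rfl⟩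
  rw [pow_succ (n + 4) 3, ← hP]
  rw [← hP] at hτ
  obtain ⟨K, hK⟩ : ∃ K, K = (n + 3) * (480000 * P) := ⟨_, rfl⟩
  rw [← hK] at hτ
  have e : 4 / τ = 2 ^ (K + 3) := by
    rw [hτ, div_inv_eq_mul, pow_succ, pow_add _ K 3]; ring
  rw [e, Real.log_pow]
  have h2 : Real.log 2 ≤ 1 := by linarith [Real.log_two_lt_d9]
  have h3 : (0 : ℝ) ≤ ((K + 3 : ℕ) : ℝ) := Nat.cast_nonneg _
  have h4 : 8 * (K + 3) < 4000000 * (P * (n + 4)) := by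
    have : 1 ≤ P := hP ▸ Nat.one_le_pow _ _ (by omega)
    rw [hK]
    nlinarith
  have h5 : ((8 * (K + 3) : ℕ) : ℝ) < ((4000000 * (P * (n + 4)) : ℕ) : ℝ) := Nat.cast_lt.2 h4
  refine lt_of_le_of_lt ?_ h5
  rw [Nat.cast_mul 8, Nat.cast_ofNat]
  nlinarith

end Smoothing

section Smoothing

variable [AddCommGroup G] [Fintype G]

omit [Fintype G] in
lemma regScale_le (Γ : Finset (AddChar G ℂ)) : regScale Γ ≤ 1 / 1000 := by
  rw [regScale]
  refine one_div_le_one_div_of_le (by norm_num) ?_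
  have : (0 : ℝ) ≤ Γ.card := Nat.cast_nonneg _
  linarith

lemma card_bohr_le_of_isRegBohr {Γ : Finset (AddChar G ℂ)} {ρ σ : ℝ} (h : IsRegBohr Γ ρ)
    (hσ : σ ≤ ρ * (1 + regScale Γ)) : ((bohr Γ σ).card : ℝ) ≤ 101 / 100 * (bohr Γ ρ).card :=
  le_trans (Nat.cast_le.2 (Finset.card_le_card (bohr_mono hσ))) h

lemma exists_almostPeriod_set (Γ : Finset (AddChar G ℂ)) (ρ : ℝ) (hρ : 0 < ρ)
    (hreg : IsRegBohr Γ ρ) (n : ℕ) (A : Finset G) (hAB : A ⊆ bohr Γ ρ) (hA : A.Nonempty)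
    (hAn : ((bohr Γ ρ).card : ℝ) ≤ 2 ^ n * A.card) (S : Finset G)
    (hS : ∑ a ∈ A, ∑ a' ∈ A, (1 - fInd S (a' - a)) ≤ (A.card : ℝ) ^ 2 / 100) :
    ∃ (S' A₂ T : Finset G) (ρ₃ : ℝ), S' ⊆ S ∧ (S'.card : ℝ) ≤ (2 ^ (n + 1)) ^ 2 * A.card ∧
      A₂.Nonempty ∧ 19 / 20 ≤ corrAvg (fInd S') A A₂ 0 ∧ IsRegBohr Γ ρ₃ ∧
      ρ * regScale Γ ^ 2 / (16 * (n + 4)) ≤ ρ₃ ∧ ρ₃ ≤ ρ ∧ T ⊆ bohr Γ ρ₃ ∧ T.Nonempty ∧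
      (2 ^ ((n + 3) * (480000 * (n + 4) ^ 3) + 1) : ℝ)⁻¹ * (bohr Γ ρ₃).card ≤ T.card ∧
      |(smooth T)^[n + 4] (corrAvg (fInd S') A A₂) 0 - corrAvg (fInd S') A A₂ 0| ≤ 1 / 50 := by
  obtain ⟨η, hη⟩ : ∃ η, η = regScale Γ := ⟨_, rfl⟩
  have hη0 : 0 < η := hη ▸ regScale_pos Γ
  have hη1 : η ≤ 1 / 1000 := hη ▸ regScale_le Γ
  obtain ⟨κ, hκ⟩ : ∃ κ : ℝ, κ = (n : ℝ) + 4 := ⟨_, rfl⟩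
  have hκ1 : 4 ≤ κ := by rw [hκ]; linarith [(Nat.cast_nonneg n : (0 : ℝ) ≤ n)]
  obtain ⟨ρ₂, hρ₂l, hρ₂u, hreg₂⟩ := exists_isRegBohr Γ (ρ := ρ * η / 2) (by positivity)
  have hρ₂0 : 0 < ρ₂ := lt_of_lt_of_le (by positivity) hρ₂l
  obtain ⟨ρ₃, hρ₃l, hρ₃u, hreg₃⟩ := exists_isRegBohr Γ (ρ := ρ₂ * η / (2 * κ)) (by positivity)
  have hρ₃0 : 0 < ρ₃ := lt_of_lt_of_le (by positivity) hρ₃l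
  have hρη : ρ * η ≤ ρ := by nlinarith
  have hρ₂η : ρ₂ * η ≤ ρ₂ := by nlinarith
  have hρ₃κ : 2 * κ * ρ₃ ≤ ρ₂ * η := by
    rw [le_div_iff₀ (by positivity)] at hρ₃u; linarith
  have hρ₃ρ₂ : ρ₃ ≤ ρ₂ * η := by nlinarith
  have hρ₃low : ρ * η ^ 2 / (16 * κ) ≤ ρ₃ := by
    refine le_trans ?_ hρ₃l
    rw [div_div, div_le_div_iff₀ (by positivity) (by positivity)]
    have := mul_le_mul_of_nonneg_right hρ₂l (mul_pos hη0 (lt_of_lt_of_le four_pos hκ1)).le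
    nlinarith
  obtain ⟨P, hP⟩ : ∃ P, P = bohr Γ (ρ * (1 + η)) := ⟨_, rfl⟩
  obtain ⟨B₂, hB₂⟩ : ∃ B, B = bohr Γ ρ₂ := ⟨_, rfl⟩
  obtain ⟨X, hX⟩ : ∃ B, B = bohr Γ (ρ₂ * (1 + η)) := ⟨_, rfl⟩
  have hPc : (P.card : ℝ) ≤ 101 / 100 * (2 ^ n * A.card) := by
    have : (P.card : ℝ) ≤ 101 / 100 * (bohr Γ ρ).card := by rw [hP, hη]; exact hreg
    linarith
  have hXc : (X.card : ℝ) ≤ 101 / 100 * B₂.card := by rw [hX, hη, hB₂]; exact hreg₂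
  have hA0 : (0 : ℝ) < A.card := Nat.cast_pos.2 hA.card_pos
  have hB₂0 : (0 : ℝ) < B₂.card := by rw [hB₂]; exact card_bohr_pos hρ₂0.le
  have h2n : (0 : ℝ) < 2 ^ n := pow_pos two_pos n
  have hAP : ∀ a ∈ A, ∀ b ∈ B₂, a - b ∈ P := fun a ha b hb => by
    rw [hB₂] at hb
    rw [hP]
    exact bohr_mono (by linarith) (sub_mem_bohr (hAB ha) hb)
  obtain ⟨t₀, -, ht₀⟩ := exists_dense_piece A P B₂ hAP hA (Finset.card_pos.1 (Nat.cast_pos.1 hB₂0))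
    ((2 ^ n)⁻¹) (by rw [inv_mul_le_iff₀ h2n]; linarith) (fInd S) hS
  obtain ⟨A₂, hA₂⟩ : ∃ A₂, A₂ = A.filter (fun a => a - t₀ ∈ B₂) := ⟨_, rfl⟩
  rw [← hA₂] at ht₀
  obtain ⟨S', hS'⟩ : ∃ S', S' = S.filter (fun x => x - t₀ ∈ P) := ⟨_, rfl⟩
  have hbad0 : 0 ≤ ∑ a ∈ A, ∑ a' ∈ A₂, (1 - fInd S (a' - a)) :=
    Finset.sum_nonneg fun _ _ => Finset.sum_nonneg fun _ _ => sub_nonneg.2 (fInd_le_one _ _)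
  have hA₂c : ((2 : ℝ) ^ n)⁻¹ / 4 * B₂.card ≤ A₂.card := by
    have : A.card * (((2 : ℝ) ^ n)⁻¹ / 4 * B₂.card) ≤ A.card * A₂.card := by linarith
    exact le_of_mul_le_mul_left this hA0
  have hA₂0 : (0 : ℝ) < A₂.card :=
    lt_of_lt_of_le (mul_pos (div_pos (inv_pos.2 h2n) four_pos) hB₂0) hA₂c
  have hA₂ne : A₂.Nonempty := Finset.card_pos.1 (Nat.cast_pos.1 hA₂0)
  have hA₂mem : ∀ a ∈ A₂, a - t₀ ∈ B₂ := fun a ha => by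
    rw [hA₂] at ha; exact (Finset.mem_filter.1 ha).2
  have hcorr : 19 / 20 ≤ corrAvg (fInd S') A A₂ 0 := by
    have e : corrAvg (fInd S') A A₂ 0 =
        (∑ a ∈ A, ∑ a' ∈ A₂, fInd S (a' - a)) / (A.card * A₂.card) := by
      simp only [corrAvg, shiftAvg, add_zero]
      rw [← Finset.sum_div, div_div, mul_comm (A₂.card : ℝ)]
      congr 1
      refine Finset.sum_congr rfl fun a ha => Finset.sum_congr rfl fun a' ha' => ?_
      have hmem : a' - a - t₀ ∈ P := by
        have h1 : a' - a - t₀ = (a' - t₀) - a := by abel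
        have h2 := hA₂mem a' ha'
        rw [hB₂] at h2
        rw [h1, hP]
        exact bohr_mono (by linarith) (sub_mem_bohr h2 (hAB ha))
      by_cases hSm : a' - a ∈ S
      · rw [fInd_of_mem hSm, fInd_of_mem (by rw [hS']; exact Finset.mem_filter.2 ⟨hSm, hmem⟩)]
      · rw [fInd_of_notMem hSm,
          fInd_of_notMem (by rw [hS']; exact fun h => hSm (Finset.mem_filter.1 h).1)]
    rw [e, le_div_iff₀ (mul_pos hA0 hA₂0)]
    simp only [Finset.sum_sub_distrib, Finset.sum_const, nsmul_eq_mul, mul_one] at ht₀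
    have h3 : 0 ≤ ((2 : ℝ) ^ n)⁻¹ / 4 * A.card * B₂.card :=
      mul_nonneg (mul_nonneg (div_pos (inv_pos.2 h2n) four_pos).le hA0.le) hB₂0.le
    linarith
  have hS'c : (S'.card : ℝ) ≤ (2 ^ (n + 1)) ^ 2 * A.card := by
    have h1 : S'.card ≤ P.card := by
      rw [← Finset.card_image_of_injective S' (sub_left_injective (b := t₀))]
      refine Finset.card_le_card fun x hx => ?_
      obtain ⟨y, hy, rfl⟩ := Finset.mem_image.1 hx
      rw [hS'] at hy
      exact (Finset.mem_filter.1 hy).2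
    refine le_trans (Nat.cast_le.2 h1) (hPc.trans ?_)
    have h2 : 101 / 100 * (2 : ℝ) ^ n ≤ (2 ^ (n + 1)) ^ 2 := by
      have : (1 : ℝ) ≤ 2 ^ n := one_le_pow₀ one_le_two
      rw [pow_succ (2 : ℝ) n]; nlinarith
    rw [← mul_assoc]
    exact mul_le_mul_of_nonneg_right h2 hA0.le
  obtain ⟨m, hm⟩ : ∃ m, m = 480000 * (n + 4) ^ 3 := ⟨_, rfl⟩
  have hm0 : 0 < m := by rw [hm]; exact Nat.mul_pos (by omega) (Nat.pow_pos (by omega))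
  obtain ⟨ε, hε⟩ : ∃ ε, ε = 1 / (200 * ((n : ℝ) + 4)) := ⟨_, rfl⟩
  have hnum := almostPeriods_numeric n ε hε
  rw [← hm] at hnum
  have hε0 : 0 < ε := by rw [hε, ← hκ]; exact div_pos one_pos (by linarith)
  have hε1 : ε ≤ 1 := by
    rw [hε, ← hκ]; exact div_le_one_of_le₀ (by linarith) (by linarith)
  obtain ⟨T, hTW, hTc, hT⟩ := exists_almostPeriods (fInd S') (fInd_nonneg S') (fInd_le_one S') A A₂
    P (bohr Γ ρ₃) (X.image (· + t₀)) hA hA₂ne (by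
      intro a ha w hw
      refine Finset.mem_image.2 ⟨a - t₀ + w, ?_, by abel⟩
      have h1 := hA₂mem a ha
      rw [hB₂] at h1
      rw [hX]
      exact bohr_mono (by linarith) (add_mem_bohr h1 hw)) m hm0 ε hε0 hε1 (by
      have := mul_le_mul_of_nonneg_right hnum hA0.le
      linarith)
  rw [Finset.card_image_of_injective _ (add_left_injective t₀)] at hTc
  have hW0 : (0 : ℝ) < (bohr Γ ρ₃).card := card_bohr_pos hρ₃0.le
  have hXA : (X.card : ℝ) ≤ 2 ^ (n + 3) * A₂.card := by
    have h1 : (B₂.card : ℝ) ≤ 4 * 2 ^ n * A₂.card := by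
      have := mul_le_mul_of_nonneg_left hA₂c h2n.le
      have e : (2 : ℝ) ^ n * ((2 ^ n)⁻¹ / 4 * B₂.card) = B₂.card / 4 := by
        field_simp
      rw [e] at this
      linarith
    rw [pow_add]
    have := mul_pos h2n hA₂0
    linarith
  have hTcard : (2 ^ ((n + 3) * m + 1) : ℝ)⁻¹ * (bohr Γ ρ₃).card ≤ T.card := by
    rw [inv_mul_le_iff₀ (pow_pos two_pos _)]
    have h1 : ((bohr Γ ρ₃).card : ℝ) * A₂.card ^ m ≤
        2 ^ ((n + 3) * m + 1) * T.card * A₂.card ^ m := by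
      refine hTc.trans ?_
      have h2 := pow_le_pow_left₀ (Nat.cast_nonneg _) hXA m
      rw [mul_pow, ← pow_mul] at h2
      have h3 := mul_le_mul_of_nonneg_left h2 (show (0 : ℝ) ≤ 2 * T.card from
        mul_nonneg zero_le_two (Nat.cast_nonneg _))
      refine h3.trans (le_of_eq ?_)
      rw [pow_succ]; ring
    exact le_of_mul_le_mul_right h1 (pow_pos hA₂0 m)
  have hTne : T.Nonempty := by
    refine Finset.card_pos.1 (Nat.cast_pos.1 (lt_of_lt_of_le ?_ hTcard))
    exact mul_pos (inv_pos.2 (pow_pos two_pos _)) hW0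
  rw [← hη, ← hm, ← hκ]
  refine ⟨S', A₂, T, ρ₃, ?_, hS'c, hA₂ne, hcorr, hreg₃, hρ₃low, by linarith, hTW, hTne, hTcard, ?_⟩
  · rw [hS']; exact Finset.filter_subset _ _
  · have key := abs_smooth_iterate_sub_self_le Γ ρ₃ (ρ * η) (4 * ε) (corrAvg (fInd S') A A₂) T hTne
      hTW hρ₃0.le (fun t ht t' ht' u hu hu' => by
        have hin : ∀ w ∈ bohr Γ (ρ * η), ∀ a ∈ A, a + w ∈ P := fun w hw a ha => by
          rw [hP]
          exact bohr_mono (by linarith) (add_mem_bohr (hAB ha) hw)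
        exact hT t ht t' ht' u (hin u hu) (hin _ hu')) (n + 4) 0 (by
        rw [Nat.cast_add, Nat.cast_ofNat, ← hκ]
        linarith) 0 (zero_mem_bohr le_rfl)
    refine key.trans (le_of_eq ?_)
    rw [Nat.cast_add, Nat.cast_ofNat, ← hκ, hε, ← hκ]
    have : κ ≠ 0 := by linarith
    field_simp
    norm_num

/-- If most differences of a dense subset `A` of a Bohr set lie in `S`, then most differences of a
somewhat smaller Bohr set lie in a translate of `S`. -/
theorem exists_smoothing (Γ : Finset (AddChar G ℂ)) (ρ : ℝ) (hρ : 0 < ρ) (hρ2 : ρ ≤ 2)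
    (hreg : IsRegBohr Γ ρ) (n : ℕ) (A : Finset G) (hAB : A ⊆ bohr Γ ρ) (hA : A.Nonempty)
    (hAn : ((bohr Γ ρ).card : ℝ) ≤ 2 ^ n * A.card) (S : Finset G)
    (hS : ∑ a ∈ A, ∑ a' ∈ A, (1 - fInd S (a' - a)) ≤ (A.card : ℝ) ^ 2 / 100)
    (R : ℕ) (hR : R = 4000000 * (n + 4) ^ 4) :
    ∃ Λ : Finset (AddChar G ℂ), Λ.card ≤ R ∧ ∀ σ, 0 < σ →
      σ ≤ ρ * regScale Γ ^ 4 / (51200 * (n + 4) * R * 2 ^ n) →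
      ∃ h₀, 9 / 10 * ((bohr (Γ ∪ Λ) σ).card : ℝ) ^ 2 ≤
        ∑ b ∈ bohr (Γ ∪ Λ) σ, ∑ b' ∈ bohr (Γ ∪ Λ) σ, fInd S (h₀ + (b' - b)) := by
  obtain ⟨S', A₂, T, ρ₃, hS'S, hS'c, hA₂ne, hcorr, hreg₃, hρ₃l, hρ₃u, hTW, hTne, hTcard, hTs⟩ :=
    exists_almostPeriod_set Γ ρ hρ hreg n A hAB hA hAn S hS
  obtain ⟨τ, hτ⟩ : ∃ τ : ℝ, τ = (2 ^ ((n + 3) * (480000 * (n + 4) ^ 3) + 1))⁻¹ := ⟨_, rfl⟩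
  have hτ0 : 0 < τ := by rw [hτ]; exact inv_pos.2 (pow_pos two_pos _)
  have hlog := chang_rank_numeric n τ hτ
  rw [← hR] at hlog
  rw [← hτ] at hTcard
  obtain ⟨η, hη⟩ : ∃ η, η = regScale Γ := ⟨_, rfl⟩
  have hη0 : 0 < η := hη ▸ regScale_pos Γ
  have hη1 : η ≤ 1 / 1000 := hη ▸ regScale_le Γ
  obtain ⟨κ, hκ⟩ : ∃ κ : ℝ, κ = (n : ℝ) + 4 := ⟨_, rfl⟩
  have hκ1 : 4 ≤ κ := by rw [hκ]; linarith [(Nat.cast_nonneg n : (0 : ℝ) ≤ n)]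
  rw [← hη, ← hκ] at hρ₃l
  rw [← hη, ← hκ]
  have hR1 : 1 ≤ R := by
    rw [hR]; exact Nat.mul_pos (by omega) (Nat.pow_pos (by omega))
  have hR1' : (1 : ℝ) ≤ R := by exact_mod_cast hR1
  have hκ0 : 0 < κ := by linarith
  have hR0 : (0 : ℝ) < R := by linarith
  have h2n : (1 : ℝ) ≤ 2 ^ n := one_le_pow₀ one_le_two
  have h2n0 : (0 : ℝ) < 2 ^ n := by linarith
  have hρ₃0 : 0 < ρ₃ := lt_of_lt_of_le
    (div_pos (mul_pos hρ (pow_pos hη0 2)) (mul_pos (by norm_num) hκ0)) hρ₃l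
  obtain ⟨ρ₄, hρ₄l, hρ₄u, hreg₄⟩ := exists_isRegBohr Γ (ρ := ρ₃ * η / (2 * R))
    (div_pos (mul_pos hρ₃0 hη0) (mul_pos two_pos hR0))
  have hρ₄0 : 0 < ρ₄ := lt_of_lt_of_le
    (div_pos (div_pos (mul_pos hρ₃0 hη0) (mul_pos two_pos hR0)) two_pos) hρ₄l
  obtain ⟨Λ, hΛR, hΛ⟩ := exists_chang Γ ρ₃ ρ₄ hρ₄0.le hreg₄ T hTne hTW τ hτ0 hTcard R hlog (by
    have h1 := card_bohr_le_of_isRegBohr (σ := ρ₃ + 2 * R * ρ₄) hreg₃ (by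
      rw [le_div_iff₀ (mul_pos two_pos hR0)] at hρ₄u
      rw [← hη]; linarith)
    have h2 : (0 : ℝ) ≤ (bohr Γ ρ₃).card := Nat.cast_nonneg _
    linarith)
  refine ⟨Λ, hΛR, fun σ hσ0 hσ => ?_⟩
  obtain ⟨B, hB⟩ : ∃ B, B = bohr (Γ ∪ Λ) σ := ⟨_, rfl⟩
  rw [← hB]
  have hB0 : (0 : ℝ) < B.card := by rw [hB]; exact card_bohr_pos hσ0.le
  have hσ2 : σ * (51200 * κ * R * 2 ^ n) ≤ ρ * η ^ 4 := by
    rwa [le_div_iff₀ (mul_pos (mul_pos (mul_pos (by norm_num) hκ0) hR0) h2n0)] at hσ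
  have hρ₄' : ρ * η ^ 3 ≤ 64 * κ * R * ρ₄ := by
    rw [div_le_iff₀ (mul_pos (by norm_num) hκ0)] at hρ₃l
    rw [div_div, div_le_iff₀ (mul_pos (mul_pos two_pos hR0) two_pos)] at hρ₄l
    have h1 := mul_le_mul_of_nonneg_right hρ₃l hη0.le
    have h2 := mul_le_mul_of_nonneg_right hρ₄l (mul_pos (show (0 : ℝ) < 16 by norm_num) hκ0).le
    calc ρ * η ^ 3 = ρ * η ^ 2 * η := by ring
      _ ≤ ρ₃ * (16 * κ) * η := h1
      _ = ρ₃ * η * (16 * κ) := by ring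
      _ ≤ _ := h2
      _ = _ := by ring
  have hσM : 2 * σ * (400 * 2 ^ n) ≤ ρ₄ * η := by
    have h1 := mul_le_mul_of_nonneg_right hρ₄' hη0.le
    have h3 : (2 * σ * (400 * 2 ^ n)) * (64 * κ * R) ≤ (ρ₄ * η) * (64 * κ * R) := by
      calc (2 * σ * (400 * 2 ^ n)) * (64 * κ * R) = σ * (51200 * κ * R * 2 ^ n) := by ring
        _ ≤ ρ * η ^ 4 := hσ2
        _ = ρ * η ^ 3 * η := by ring
        _ ≤ 64 * κ * R * ρ₄ * η := h1
        _ = _ := by ring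
    exact le_of_mul_le_mul_right h3 (mul_pos (mul_pos (by norm_num) hκ0) hR0)
  have hσκ : 2 * σ ≤ 1 / (200 * 2 ^ n * R) := by
    rw [le_div_iff₀ (mul_pos (mul_pos (by norm_num) h2n0) hR0)]
    have h1 : ρ * η ^ 4 ≤ 2 * 1 := by
      refine mul_le_mul hρ2 ?_ (pow_pos hη0 4).le two_pos.le
      exact pow_le_one₀ hη0.le (by linarith)
    have h2 : 0 < σ * (R * 2 ^ n) := mul_pos hσ0 (mul_pos hR0 h2n0)
    have h3 : σ * (R * 2 ^ n) * 4 ≤ σ * (R * 2 ^ n) * κ := mul_le_mul_of_nonneg_left hκ1 h2.le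
    linarith
  have hv : ∀ b ∈ B, ∀ b' ∈ B, ∀ γ, 1 / 2 ≤ ‖muHat T γ‖ →
      ‖γ (b - b') - 1‖ ≤ 1 / (100 * 2 ^ n) := by
    intro b hb b' hb' γ hγ
    rw [hB] at hb hb'
    have hbb := sub_mem_bohr hb hb'
    refine (hΛ (400 * 2 ^ n) (1 / (200 * 2 ^ n * R)) (b - b') ?_ ?_ ?_ ?_ γ hγ).trans ?_
    · exact Nat.mul_pos (by omega) (Nat.pow_pos (by omega))
    · exact (div_pos one_pos (mul_pos (mul_pos (by norm_num) h2n0) hR0)).le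
    · refine bohr_mono ?_ (bohr_anti Finset.subset_union_left hbb)
      rw [Nat.cast_mul, Nat.cast_pow, Nat.cast_ofNat, Nat.cast_ofNat, ← hη,
        le_div_iff₀ (mul_pos (by norm_num) h2n0)]
      linarith
    · refine bohr_mono ?_ (bohr_anti Finset.subset_union_right hbb)
      linarith
    · rw [Nat.cast_mul, Nat.cast_pow, Nat.cast_ofNat, Nat.cast_ofNat]
      have e1 : (R : ℝ) * (1 / (200 * 2 ^ n * R)) = 1 / (200 * 2 ^ n) := by
        field_simp
      have e2 : 1 / (100 * (2 : ℝ) ^ n) = 4 / (400 * 2 ^ n) := by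
        rw [div_eq_div_iff (by positivity) (by positivity)]; ring
      have e3 : 1 / (200 * (2 : ℝ) ^ n) = 2 / (400 * 2 ^ n) := by
        rw [div_eq_div_iff (by positivity) (by positivity)]; ring
      rw [e1, e2, e3, ← add_div]
      exact div_le_div_of_nonneg_right (by norm_num) (mul_pos (by norm_num) h2n0).le
  obtain ⟨Ψ, hΨ⟩ : ∃ Ψ, Ψ = corrAvg (fInd S') A A₂ := ⟨_, rfl⟩
  have hlow : ∀ b ∈ B, ∀ b' ∈ B, 91 / 100 ≤ (smooth T)^[n + 4] Ψ (0 + (b - b')) := by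
    intro b hb b' hb'
    have h1 := abs_smooth_iterate_sub_le T (corrAvg (fInd S') A A₂) _
      (corrAvg_eq_sum (fInd S') A A₂) (2 ^ (n + 1))
      (sum_norm_corrCoeff_le (fInd S') A A₂ hA (2 ^ (n + 1)) (pow_pos two_pos _).le (by
        have : ∀ x, fInd S' x ^ 2 = fInd S' x := fun x => by
          by_cases hx : x ∈ S'
          · rw [fInd_of_mem hx, one_pow]
          · rw [fInd_of_notMem hx, zero_pow two_ne_zero]
        rw [Finset.sum_congr rfl fun x _ => this x, sum_fInd]
        exact hS'c)) (n + 4) (1 / (100 * 2 ^ n)) (by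
        rw [one_div_pow, ← mul_one_div, mul_one_div, mul_one_div,
          div_le_div_iff₀ (pow_pos four_pos _) (mul_pos (by norm_num) h2n0)]
        have e : (4 : ℝ) ^ (n + 4) = 2 ^ n * 2 ^ n * 256 := by
          rw [pow_add, ← mul_pow]; norm_num
        rw [e]
        nlinarith) (b - b') (hv b hb b' hb')
    have e : (2 : ℝ) ^ (n + 1) * (1 / (100 * 2 ^ n)) = 1 / 50 := by
      rw [pow_succ]; field_simp; norm_num
    rw [e, abs_le] at h1
    rw [abs_le] at hTs
    rw [hΨ, zero_add]
    linarith [h1.1, hTs.1]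
  by_contra hcon
  push Not at hcon
  have hlt : ∀ w, ∑ i ∈ B ×ˢ B, fInd S' (w - (i.1 - i.2)) < 9 / 10 * (B.card : ℝ) ^ 2 := by
    intro w
    refine lt_of_le_of_lt ?_ (hcon w)
    rw [Finset.sum_product]
    refine Finset.sum_le_sum fun b _ => Finset.sum_le_sum fun b' _ => ?_
    have e : w - (b - b') = w + (b' - b) := by abel
    show fInd S' (w - (b - b')) ≤ _
    rw [e]
    by_cases hx : w + (b' - b) ∈ S'
    · rw [fInd_of_mem hx, fInd_of_mem (hS'S hx)]
    · rw [fInd_of_notMem hx]; exact fInd_nonneg _ _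
  have h1 := sum_smooth_iterate_lt (B ×ˢ B) (fun i => i.1 - i.2) T hTne Ψ
    (9 / 10 * (B.card : ℝ) ^ 2) (by
      rw [hΨ]
      exact sum_corrAvg_lt (B ×ˢ B) (fun i => i.1 - i.2) (fInd S') A A₂ hA hA₂ne _ hlt) (n + 4) 0
  have h2 := Finset.card_nsmul_le_sum (B ×ˢ B)
    (fun i => (smooth T)^[n + 4] Ψ (0 + (i.1 - i.2))) (91 / 100) fun i hi => by
      rw [Finset.mem_product] at hi
      exact hlow i.1 hi.1 i.2 hi.2
  rw [nsmul_eq_mul, Finset.card_product, Nat.cast_mul] at h2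
  have h3 := mul_pos hB0 hB0
  have h4 := lt_of_le_of_lt h2 h1
  nlinarith

end Smoothing

section Increment

variable [AddCommGroup G]

lemma sum_le_sum_shift (B P : Finset G) (x : G) (f : G → ℝ) (hf : ∀ x, 0 ≤ f x)
    (h : ∀ z ∈ B, z - x ∈ P) : ∑ z ∈ B, f z ≤ ∑ t ∈ P, f (x + t) := by
  have e : ∑ z ∈ B, f z = ∑ t ∈ B.image (· - x), f (x + t) := by
    rw [Finset.sum_image fun a _ b _ hab => sub_left_injective hab]
    exact Finset.sum_congr rfl fun z _ => by rw [add_sub_cancel]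
  rw [e]
  refine Finset.sum_le_sum_of_subset_of_nonneg (fun y hy => ?_) fun _ _ _ => hf _
  obtain ⟨z, hz, rfl⟩ := Finset.mem_image.1 hy
  exact h z hz

/-- Some translate of `f` has large average against `diffMeasure S`. -/
lemma exists_shift_le_sum_diffMeasure [Fintype G] (B P S : Finset G) (hS : S.Nonempty)
    (hB : B.Nonempty) (hP : ∀ z ∈ B, ∀ s ∈ S, ∀ s' ∈ S, z - (s' - s) ∈ P)
    (hPB : (P.card : ℝ) ≤ 101 / 100 * B.card) (f : G → ℝ) (hf : ∀ x, 0 ≤ f x) :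
    ∃ t, ∑ z ∈ B, f z ≤ 101 / 100 * B.card * ∑ x, diffMeasure S x * f (x + t) := by
  by_contra hcon
  push Not at hcon
  have hB0 : (0 : ℝ) < B.card := Nat.cast_pos.2 hB.card_pos
  obtain ⟨s, hs⟩ := hS
  obtain ⟨z, hz⟩ := hB
  have hPne : P.Nonempty := ⟨_, hP z hz s hs s hs⟩
  have h1 : ∑ z ∈ B, f z ≤ ∑ t ∈ P, ∑ x, diffMeasure S x * f (x + t) := by
    rw [Finset.sum_comm]
    simp_rw [← Finset.mul_sum]
    rw [← one_mul (∑ z ∈ B, f z), ← sum_diffMeasure ⟨s, hs⟩, Finset.sum_mul]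
    refine Finset.sum_le_sum fun x _ => ?_
    by_cases hx : diffMeasure S x = 0
    · rw [hx, zero_mul, zero_mul]
    · obtain ⟨t, ht, t', ht', rfl⟩ := exists_of_diffMeasure_ne_zero hx
      exact mul_le_mul_of_nonneg_left (sum_le_sum_shift B P _ f hf fun z hz => hP z hz t ht t' ht')
        (diffMeasure_nonneg _ _)
  have h2 : ∑ t ∈ P, 101 / 100 * B.card * ∑ x, diffMeasure S x * f (x + t) <
      ∑ t ∈ P, ∑ z ∈ B, f z := Finset.sum_lt_sum_of_nonempty hPne fun t _ => hcon t
  rw [← Finset.mul_sum, Finset.sum_const, nsmul_eq_mul] at h2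
  have h3 : 0 ≤ ∑ z ∈ B, f z := Finset.sum_nonneg fun _ _ => hf _
  have h4 := mul_le_mul_of_nonneg_left h1 (show (0 : ℝ) ≤ 101 / 100 * B.card by linarith)
  have h5 := mul_le_mul_of_nonneg_right hPB h3
  linarith

/-- The average of `f` against `diffMeasure S` is controlled by its averages on translates of a
narrow set `B`. -/
lemma exists_shift_sum_diffMeasure_le [Fintype G] (B P S : Finset G) (hS : S.Nonempty)
    (hP : ∀ s ∈ S, ∀ b ∈ B, s - b ∈ P) (hB : B.Nonempty)
    (hPS : (P.card : ℝ) ≤ 101 / 100 * S.card) (f : G → ℝ) (hf : ∀ x, 0 ≤ f x) :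
    ∃ t, B.card * ∑ x, diffMeasure S x * f x ≤ 101 / 100 * ∑ b ∈ B, f (b + t) := by
  by_contra hcon
  push Not at hcon
  obtain ⟨E, hE⟩ : ∃ E, E = B.card * ∑ x, diffMeasure S x * f x := ⟨_, rfl⟩
  rw [← hE] at hcon
  have hS0 : (0 : ℝ) < S.card := Nat.cast_pos.2 hS.card_pos
  have hE0 : 0 ≤ E := hE ▸ mul_nonneg (Nat.cast_nonneg _)
    (Finset.sum_nonneg fun x _ => mul_nonneg (diffMeasure_nonneg _ _) (hf x))
  have hPne : P.Nonempty := by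
    obtain ⟨s, hs⟩ := hS
    obtain ⟨b, hb⟩ := hB
    exact ⟨_, hP s hs b hb⟩
  have h1 : ∀ s ∈ S, B.card * ∑ s' ∈ S, f (s' - s) < S.card * E := by
    intro s _
    have h2 : B.card * ∑ s' ∈ S, f (s' - s) ≤ ∑ b ∈ B, ∑ t ∈ P, f (b + (t - s)) := by
      rw [← nsmul_eq_mul, ← Finset.sum_const]
      refine Finset.sum_le_sum fun b hb => ?_
      refine (sum_le_sum_shift S P b (fun x => f (x - s)) (fun _ => hf _)
        fun z hz => hP z hz b hb).trans (le_of_eq ?_)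
      exact Finset.sum_congr rfl fun t _ => by
        show f (b + t - s) = _
        rw [add_sub_assoc]
    rw [Finset.sum_comm] at h2
    have h3 : ∑ t ∈ P, 101 / 100 * ∑ b ∈ B, f (b + (t - s)) < ∑ t ∈ P, E :=
      Finset.sum_lt_sum_of_nonempty hPne fun t _ => hcon _
    rw [← Finset.mul_sum, Finset.sum_const, nsmul_eq_mul] at h3
    have h4 := mul_le_mul_of_nonneg_right hPS hE0
    linarith
  have h5 := Finset.sum_lt_sum_of_nonempty hS h1
  rw [← Finset.mul_sum, Finset.sum_const, nsmul_eq_mul] at h5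
  have h6 : E * S.card ^ 2 = B.card * ∑ s ∈ S, ∑ s' ∈ S, f (s' - s) := by
    rw [hE, sum_diffMeasure_mul]
    field_simp
  linarith

lemma sum_autoCorr_le [Fintype G] (A B : Finset G) (w : ℝ)
    (hw : ∀ y, ∑ b ∈ B, fInd A (y + b) ≤ w) (h₀ : G) :
    ∑ b ∈ B, ∑ b' ∈ B, autoCorr A (h₀ + (b' - b)) ≤ A.card * B.card * w := by
  have h1 : ∀ b ∈ B, ∑ b' ∈ B, autoCorr A (h₀ + (b' - b)) ≤ A.card * w := by
    intro b _
    simp only [autoCorr]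
    rw [Finset.sum_comm, ← sum_fInd, Finset.sum_mul]
    refine Finset.sum_le_sum fun y _ => ?_
    rw [← Finset.mul_sum]
    refine mul_le_mul_of_nonneg_left ?_ (fInd_nonneg _ _)
    refine le_trans (le_of_eq ?_) (hw (y + h₀ - b))
    refine Finset.sum_congr rfl fun b' _ => ?_
    congr 1; abel
  refine (Finset.sum_le_sum h1).trans (le_of_eq ?_)
  rw [Finset.sum_const, nsmul_eq_mul]; ring

/-- If no fibre has large density on a translate of `B`, then the averaged fibre correlation is
small on differences of `B`. -/
lemma sum_skewCorr_le [Fintype G] (A : G → Finset G) (ν : G → ℝ) (hν : ∀ x, 0 ≤ ν x) (δ : ℝ)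
    (hδ : 0 < δ) (B : Finset G) (w : G → ℝ) (hw0 : ∀ x, 0 ≤ w x)
    (hw : ∀ x y, ∑ b ∈ B, fInd (A x) (y + b) ≤ w x) (h₀ : G) :
    δ * ∑ b ∈ B, ∑ b' ∈ B, skewCorr (fun x => ν x / (δ * (A x).card)) A (h₀ + (b' - b)) ≤
      B.card * ∑ x, ν x * w x := by
  simp only [skewCorr]
  have e : ∑ b ∈ B, ∑ b' ∈ B, ∑ x, ν x / (δ * (A x).card) * autoCorr (A x) (h₀ + (b' - b)) =
      ∑ x, ν x / (δ * (A x).card) * ∑ b ∈ B, ∑ b' ∈ B, autoCorr (A x) (h₀ + (b' - b)) := by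
    rw [Finset.sum_congr rfl fun b _ => Finset.sum_comm, Finset.sum_comm]
    simp_rw [Finset.mul_sum]
  rw [e, Finset.mul_sum, Finset.mul_sum]
  refine Finset.sum_le_sum fun x _ => ?_
  have h1 := sum_autoCorr_le (A x) B (w x) (hw x) h₀
  rcases (A x).card.eq_zero_or_pos with h0 | h0
  · rw [h0, Nat.cast_zero, mul_zero, div_zero, zero_mul, mul_zero]
    exact mul_nonneg (Nat.cast_nonneg _) (mul_nonneg (hν x) (hw0 x))
  · have h0' : (0 : ℝ) < (A x).card := Nat.cast_pos.2 h0
    have h2 := mul_le_mul_of_nonneg_left h1 (div_nonneg (hν x) (mul_pos hδ h0').le)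
    have h3 := mul_le_mul_of_nonneg_left h2 hδ.le
    refine h3.trans (le_of_eq ?_)
    field_simp

end Increment

section DensityIncrement

variable [AddCommGroup G]

/-- The fibres `A x` of a skew-corner-free set. -/
def IsSkewFreeSystem (A : G → Finset G) : Prop :=
  ∀ x z, x ≠ z → (A z).Nonempty → ∀ y ∈ A x, y + (z - x) ∉ A x

lemma IsSkewFreeSystem.translate {A A' : G → Finset G} (h : IsSkewFreeSystem A) (t : G) (y : G → G)
    (hA' : ∀ x, ∀ b ∈ A' x, y x + b ∈ A (x + t)) : IsSkewFreeSystem A' := by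
  rintro x z hxz ⟨b', hb'⟩ b hb hb2
  refine h (x + t) (z + t) (fun e => hxz (add_right_cancel e)) ⟨_, hA' z b' hb'⟩ _ (hA' x b hb) ?_
  have := hA' x _ hb2
  rwa [add_sub_add_right_eq_sub, add_assoc]

variable [Fintype G]

lemma skewCorr_nonneg {c : G → ℝ} (hc : ∀ x, 0 ≤ c x) (A : G → Finset G) (h : G) :
    0 ≤ skewCorr c A h :=
  Finset.sum_nonneg fun x _ => mul_nonneg (hc x) (autoCorr_nonneg _ _)

/-- Large fibre correlation on the differences of `B` gives a translated restriction of the system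
to `B` of larger density. -/
lemma exists_restriction (A : G → Finset G) (hA : IsSkewFreeSystem A) (S P B : Finset G)
    (hS : S.Nonempty) (hP : ∀ s ∈ S, ∀ b ∈ B, s - b ∈ P) (hB : B.Nonempty)
    (hPS : (P.card : ℝ) ≤ 101 / 100 * S.card) (δ : ℝ) (hδ : 0 < δ) (H : Finset G)
    (hH : ∀ h ∈ H, 6 / 5 ≤ skewCorr (fun x => diffMeasure S x / (δ * (A x).card)) A h) (h₀ : G)
    (hBH : 9 / 10 * (B.card : ℝ) ^ 2 ≤ ∑ b ∈ B, ∑ b' ∈ B, fInd H (h₀ + (b' - b))) :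
    ∃ A' : G → Finset G, (∀ x, A' x ⊆ B) ∧ IsSkewFreeSystem A' ∧
      108 / 101 * δ * (B.card : ℝ) ^ 2 ≤ ∑ x ∈ B, ((A' x).card : ℝ) := by
  have hB0 : (0 : ℝ) < B.card := Nat.cast_pos.2 hB.card_pos
  have hc : ∀ x, 0 ≤ diffMeasure S x / (δ * (A x).card) := fun x =>
    div_nonneg (diffMeasure_nonneg S x) (mul_nonneg hδ.le (Nat.cast_nonneg _))
  have hmax : ∀ x, ∃ y, ∀ y', ∑ b ∈ B, fInd (A x) (y' + b) ≤ ∑ b ∈ B, fInd (A x) (y + b) := by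
    intro x
    obtain ⟨y, -, hy⟩ := Finset.exists_max_image Finset.univ
      (fun y => ∑ b ∈ B, fInd (A x) (y + b)) ⟨(0 : G), Finset.mem_univ _⟩
    exact ⟨y, fun y' => hy y' (Finset.mem_univ _)⟩
  choose y hy using hmax
  obtain ⟨w, hw⟩ : ∃ w : G → ℝ, w = fun x => ∑ b ∈ B, fInd (A x) (y x + b) := ⟨_, rfl⟩
  have hw0 : ∀ x, 0 ≤ w x := fun x => by
    rw [hw]; exact Finset.sum_nonneg fun _ _ => fInd_nonneg _ _
  have h1 := sum_skewCorr_le A (diffMeasure S) (diffMeasure_nonneg S) δ hδ B w hw0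
    (fun x y' => by rw [hw]; exact hy x y') h₀
  have h2 : 6 / 5 * (∑ b ∈ B, ∑ b' ∈ B, fInd H (h₀ + (b' - b))) ≤
      ∑ b ∈ B, ∑ b' ∈ B,
        skewCorr (fun x => diffMeasure S x / (δ * (A x).card)) A (h₀ + (b' - b)) := by
    simp_rw [Finset.mul_sum]
    refine Finset.sum_le_sum fun b _ => Finset.sum_le_sum fun b' _ => ?_
    by_cases hm : h₀ + (b' - b) ∈ H
    · rw [fInd_of_mem hm, mul_one]
      exact hH _ hm
    · rw [fInd_of_notMem hm, mul_zero]
      exact skewCorr_nonneg hc _ _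
  obtain ⟨t, ht⟩ := exists_shift_sum_diffMeasure_le B P S hS hP hB hPS w hw0
  refine ⟨fun x => B.filter fun b => y (x + t) + b ∈ A (x + t), fun x => Finset.filter_subset _ _,
    hA.translate t (fun x => y (x + t)) fun x b hb => (Finset.mem_filter.1 hb).2, ?_⟩
  have e : ∑ x ∈ B, ((B.filter fun b => y (x + t) + b ∈ A (x + t)).card : ℝ) =
      ∑ x ∈ B, w (x + t) := by
    refine Finset.sum_congr rfl fun x _ => ?_
    rw [hw, Finset.card_filter, Nat.cast_sum]
    refine Finset.sum_congr rfl fun b _ => ?_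
    rw [fInd_eq_ite]
    split_ifs
    · exact Nat.cast_one
    · exact Nat.cast_zero
  rw [e]
  have h3 := mul_le_mul_of_nonneg_left (mul_le_mul_of_nonneg_left hBH (by norm_num : (0:ℝ) ≤ 6 / 5))
    hδ.le
  have h4 := mul_le_mul_of_nonneg_left h2 hδ.le
  linarith

/-- Sifting, smoothing and restriction, for a system that is dense with respect to
`diffMeasure (bohr Γ ρ₁)`. -/
lemma exists_increment_of_dense (L : ℕ) (hL : 1 ≤ L) (Γ : Finset (AddChar G ℂ)) (ρ₁ : ℝ)
    (hρ₁ : 0 < ρ₁) (hρ₁2 : ρ₁ ≤ 2) (hreg : IsRegBohr Γ ρ₁) (A : G → Finset G)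
    (hA : IsSkewFreeSystem A) (B Bp : Finset G) (hAB : ∀ x, A x ⊆ B)
    (hBp : ∀ b ∈ B, ∀ t₁ ∈ bohr Γ ρ₁, ∀ t₂ ∈ bohr Γ ρ₁, ∀ t₃ ∈ bohr Γ ρ₁, ∀ t₄ ∈ bohr Γ ρ₁,
      b + (t₁ - t₂ - (t₃ - t₄)) ∈ Bp)
    (hcard : (Bp.card : ℝ) ≤ 101 / 100 * B.card)
    (hS : 100 * 2 ^ L ≤ ((bohr Γ ρ₁).card : ℝ)) (δ : ℝ)
    (hδ : δ = ∑ x, diffMeasure (bohr Γ ρ₁) x * ((A x).card / B.card)) (hδL : (2 ^ L)⁻¹ ≤ δ)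
    (n : ℕ) (hn : n = 90 * L ^ 2 + 1) (R : ℕ) (hR : R = 4000000 * (n + 4) ^ 4) :
    ∃ (Λ : Finset (AddChar G ℂ)) (ρ' : ℝ) (A' : G → Finset G), Λ.card ≤ R ∧
      ρ₁ * regScale Γ ^ 4 / (51200 * (n + 4) * R * 2 ^ n) / 2 ≤ ρ' ∧
      ρ' ≤ ρ₁ ∧ IsRegBohr (Γ ∪ Λ) ρ' ∧ (∀ x, A' x ⊆ bohr (Γ ∪ Λ) ρ') ∧ IsSkewFreeSystem A' ∧
      108 / 101 * δ * ((bohr (Γ ∪ Λ) ρ').card : ℝ) ^ 2 ≤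
        ∑ x ∈ bohr (Γ ∪ Λ) ρ', ((A' x).card : ℝ) := by
  have hδ0 : 0 < δ := lt_of_lt_of_le (inv_pos.2 (pow_pos two_pos _)) hδL
  have hη := regScale_pos Γ
  have hη1 := regScale_le Γ
  obtain ⟨A₁, hA₁S, hA₁c, hA₁⟩ := exists_sifted_of_skewFree L hL A B Bp (bohr Γ ρ₁) hAB hBp hcard hA
    hS δ hδ hδL
  obtain ⟨g, hg⟩ : ∃ g : G → ℝ,
    g = skewCorr (fun x => diffMeasure (bohr Γ ρ₁) x / (δ * (A x).card)) A := ⟨_, rfl⟩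
  rw [← hg] at hA₁
  have hpow : (2 : ℝ) * (2 ^ L) ^ (90 * L) = 2 ^ n := by
    rw [hn, pow_succ, ← pow_mul, mul_comm (2 : ℝ)]
    congr 2; ring
  rw [hpow] at hA₁c
  have hA₁ne : A₁.Nonempty := by
    rw [Finset.nonempty_iff_ne_empty]
    rintro rfl
    rw [Finset.card_empty, Nat.cast_zero, mul_zero] at hA₁c
    exact absurd hA₁c (not_lt.2 (Nat.cast_nonneg _))
  obtain ⟨H, hH⟩ : ∃ H : Finset G, H = Finset.univ.filter fun h => ¬ g h < 6 / 5 := ⟨_, rfl⟩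
  have hHg : ∀ h, h ∈ H ↔ ¬ g h < 6 / 5 := fun h => by
    rw [hH, Finset.mem_filter]
    exact ⟨fun h => h.2, fun h => ⟨Finset.mem_univ _, h⟩⟩
  have hHs : ∑ a ∈ A₁, ∑ a' ∈ A₁, (1 - fInd H (a' - a)) ≤ (A₁.card : ℝ) ^ 2 / 100 := by
    have e : ∑ a ∈ A₁, ∑ a' ∈ A₁, (1 - fInd H (a' - a)) =
        ∑ t ∈ A₁, ∑ t' ∈ A₁, (if g (t' - t) < 6 / 5 then (1 : ℝ) else 0) := by
      refine Finset.sum_congr rfl fun a _ => Finset.sum_congr rfl fun a' _ => ?_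
      by_cases h : g (a' - a) < 6 / 5
      · rw [if_pos h, fInd_of_notMem (fun hm => (hHg _).1 hm h), sub_zero]
      · rw [if_neg h, fInd_of_mem ((hHg _).2 h), sub_self]
    rw [e]
    linarith
  obtain ⟨Λ, hΛR, hΛ⟩ := exists_smoothing Γ ρ₁ hρ₁ hρ₁2 hreg n A₁ hA₁S hA₁ne hA₁c.le H hHs R hR
  obtain ⟨κ, hκ⟩ : ∃ κ : ℝ, κ = 51200 * (n + 4) * R * 2 ^ n := ⟨_, rfl⟩
  rw [← hκ] at hΛ ⊢
  have hR1 : (1 : ℝ) ≤ R := by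
    rw [hR]
    exact_mod_cast Nat.one_le_iff_ne_zero.2
      (Nat.mul_ne_zero (by norm_num) (pow_ne_zero _ (Nat.succ_ne_zero _)))
  have hκ1 : 1 ≤ κ := by
    have h1 : (1 : ℝ) ≤ 51200 * (n + 4) := by
      have : (0 : ℝ) ≤ n := Nat.cast_nonneg _
      linarith
    rw [hκ]
    exact one_le_mul_of_one_le_of_one_le (one_le_mul_of_one_le_of_one_le h1 hR1)
      (one_le_pow₀ one_le_two)
  have hκ0 : 0 < κ := by linarith
  have hη4 : regScale Γ ^ 4 ≤ regScale Γ := pow_le_of_le_one hη.le (by linarith) (by norm_num)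
  have hσ0 : 0 < ρ₁ * regScale Γ ^ 4 / κ := div_pos (mul_pos hρ₁ (pow_pos hη 4)) hκ0
  have hσ1 : ρ₁ * regScale Γ ^ 4 / κ ≤ ρ₁ * regScale Γ :=
    (div_le_self (mul_pos hρ₁ (pow_pos hη 4)).le hκ1).trans (mul_le_mul_of_nonneg_left hη4 hρ₁.le)
  obtain ⟨ρ', hρ'l, hρ'u, hρ'reg⟩ := exists_isRegBohr (Γ ∪ Λ) hσ0
  have hρ'0 : 0 < ρ' := lt_of_lt_of_le (half_pos hσ0) hρ'l
  obtain ⟨h₀, hh₀⟩ := hΛ ρ' hρ'0 hρ'u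
  have hP : ∀ s ∈ bohr Γ ρ₁, ∀ b ∈ bohr (Γ ∪ Λ) ρ', s - b ∈ bohr Γ (ρ₁ * (1 + regScale Γ)) := by
    intro s hs b hb
    refine bohr_mono ?_ (sub_mem_bohr hs (bohr_anti Finset.subset_union_left hb))
    linarith
  obtain ⟨A', hA'B, hA'f, hA'd⟩ := exists_restriction A hA (bohr Γ ρ₁) _ (bohr (Γ ∪ Λ) ρ')
    (bohr_nonempty hρ₁.le) hP (bohr_nonempty hρ'0.le) hreg δ hδ0 H
    (fun h hh => by rw [← hg]; exact not_lt.1 ((hHg h).1 hh)) h₀ hh₀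
  refine ⟨Λ, ρ', A', hΛR, hρ'l, ?_, hρ'reg, hA'B, hA'f, hA'd⟩
  have : ρ₁ * regScale Γ ≤ ρ₁ * 1 := mul_le_mul_of_nonneg_left (by linarith) hρ₁.le
  linarith

/-- A skew-corner-free system of density `α` on a large regular Bohr set has density at least
`21 / 20 * α` on a translate of a smaller Bohr set. -/
theorem exists_increment (L : ℕ) (hL : 1 ≤ L) (Γ : Finset (AddChar G ℂ)) (ρ : ℝ)
    (hρ : 0 < ρ) (hρ2 : ρ ≤ 2) (hreg : IsRegBohr Γ ρ) (A : G → Finset G)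
    (hA : IsSkewFreeSystem A) (hAB : ∀ x, A x ⊆ bohr Γ ρ)
    (hS : 100 * 2 ^ L ≤ ((bohr Γ (ρ * regScale Γ / 8)).card : ℝ)) (α : ℝ)
    (hα : 101 / 100 * (2 ^ L)⁻¹ ≤ α)
    (hαA : α * ((bohr Γ ρ).card : ℝ) ^ 2 ≤ ∑ x ∈ bohr Γ ρ, ((A x).card : ℝ))
    (n : ℕ) (hn : n = 90 * L ^ 2 + 1) (R : ℕ) (hR : R = 4000000 * (n + 4) ^ 4) :
    ∃ (Λ : Finset (AddChar G ℂ)) (ρ' : ℝ) (A' : G → Finset G), Λ.card ≤ R ∧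
      ρ * regScale Γ ^ 5 / (819200 * (n + 4) * R * 2 ^ n) ≤ ρ' ∧
      ρ' ≤ ρ ∧ IsRegBohr (Γ ∪ Λ) ρ' ∧ (∀ x, A' x ⊆ bohr (Γ ∪ Λ) ρ') ∧ IsSkewFreeSystem A' ∧
      21 / 20 * α * ((bohr (Γ ∪ Λ) ρ').card : ℝ) ^ 2 ≤
        ∑ x ∈ bohr (Γ ∪ Λ) ρ', ((A' x).card : ℝ) := by
  have hη := regScale_pos Γ
  have hη1 := regScale_le Γ
  have hρη : 0 < ρ * regScale Γ := mul_pos hρ hη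
  have hρη' : ρ * regScale Γ ≤ ρ := mul_le_of_le_one_right hρ.le (by linarith)
  obtain ⟨ρ₁, hρ₁l, hρ₁u, hreg₁⟩ := exists_isRegBohr Γ (show 0 < ρ * regScale Γ / 4 by linarith)
  have hρ₁ : 0 < ρ₁ := by linarith
  have hS₁ne : (bohr Γ ρ₁).Nonempty := bohr_nonempty hρ₁.le
  have hBne : (bohr Γ ρ).Nonempty := bohr_nonempty hρ.le
  have hB0 : (0 : ℝ) < (bohr Γ ρ).card := card_bohr_pos hρ.le
  obtain ⟨t, ht⟩ := exists_shift_le_sum_diffMeasure (bohr Γ ρ) (bohr Γ (ρ * (1 + regScale Γ)))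
    (bohr Γ ρ₁) hS₁ne hBne (fun z hz s hs s' hs' => by
      refine bohr_mono ?_ (sub_mem_bohr hz (sub_mem_bohr hs' hs))
      linarith) hreg (fun x => ((A x).card : ℝ)) fun _ => Nat.cast_nonneg _
  obtain ⟨δ, hδ⟩ : ∃ δ : ℝ, δ = ∑ x, diffMeasure (bohr Γ ρ₁) x *
    ((A (x + t)).card / (bohr Γ ρ).card) := ⟨_, rfl⟩
  have hδ' : δ * (bohr Γ ρ).card = ∑ x, diffMeasure (bohr Γ ρ₁) x * (A (x + t)).card := by
    rw [hδ, Finset.sum_mul]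
    refine Finset.sum_congr rfl fun x _ => ?_
    rw [mul_assoc, div_mul_cancel₀ _ hB0.ne']
  rw [← hδ'] at ht
  have hαδ : α ≤ 101 / 100 * δ := by
    have h1 := hαA.trans ht
    have h2 : α * ((bohr Γ ρ).card : ℝ) ^ 2 ≤ 101 / 100 * δ * ((bohr Γ ρ).card : ℝ) ^ 2 := by
      linarith
    exact le_of_mul_le_mul_right h2 (pow_pos hB0 2)
  have hA' : IsSkewFreeSystem fun x => A (x + t) :=
    hA.translate t (fun _ => 0) fun x b hb => by rw [zero_add]; exact hb
  obtain ⟨Λ, ρ', A', h1, h2, h3, h4, h5, h6, h7⟩ := exists_increment_of_dense L hL Γ ρ₁ hρ₁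
    (by linarith) hreg₁ (fun x => A (x + t)) hA' (bohr Γ ρ) (bohr Γ (ρ * (1 + regScale Γ)))
    (fun x => hAB _) (fun b hb t₁ h₁ t₂ h₂ t₃ h₃ t₄ h₄ => by
      refine bohr_mono ?_ (add_mem_bohr hb (sub_mem_bohr (sub_mem_bohr h₁ h₂) (sub_mem_bohr h₃ h₄)))
      linarith) hreg (hS.trans (card_bohr_mono (by linarith))) δ hδ (by linarith) n hn R hR
  refine ⟨Λ, ρ', A', h1, ?_, by linarith, h4, h5, h6, ?_⟩
  · refine le_trans (le_of_eq_of_le ?_ (div_le_div_of_nonneg_right (div_le_div_of_nonneg_right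
      (mul_le_mul_of_nonneg_right (show ρ * regScale Γ / 8 ≤ ρ₁ by linarith)
        (pow_pos hη 4).le) ?_) zero_le_two)) h2
    · rw [div_div, div_mul_eq_mul_div, div_div]
      congr 1
      · ring
      · ring
    · exact mul_nonneg (mul_nonneg (mul_nonneg (by norm_num) (by
        have : (0 : ℝ) ≤ n := Nat.cast_nonneg _
        linarith)) (Nat.cast_nonneg _)) (pow_pos two_pos _).le
  · have h8 : 21 / 20 * α ≤ 108 / 101 * δ := by
      have : 0 < α := lt_of_lt_of_le (mul_pos (by norm_num) (inv_pos.2 (pow_pos two_pos _))) hα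
      linarith
    exact (mul_le_mul_of_nonneg_right h8 (sq_nonneg _)).trans h7

end DensityIncrement

section Iteration

variable [AddCommGroup G] [Fintype G]

omit [AddCommGroup G] [Fintype G] in
lemma sum_card_le_sq {A : G → Finset G} {B : Finset G} (hAB : ∀ x, A x ⊆ B) :
    ∑ x ∈ B, ((A x).card : ℝ) ≤ (B.card : ℝ) ^ 2 := by
  refine (Finset.sum_le_sum fun x _ => Nat.cast_le.2 (Finset.card_le_card (hAB x))).trans
    (le_of_eq ?_)
  rw [Finset.sum_const, nsmul_eq_mul, sq]

/-- The result of iterating `exists_increment`. -/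
lemma exists_iterated_increment (L : ℕ) (hL : 1 ≤ L) (n : ℕ) (hn : n = 90 * L ^ 2 + 1) (R : ℕ)
    (hR : R = 4000000 * (n + 4) ^ 4) (J : ℕ) (q : ℝ) (hq0 : 0 < q) (hq1 : q ≤ 1)
    (hq : ∀ Γ : Finset (AddChar G ℂ), Γ.card ≤ J * R →
      q ≤ regScale Γ ^ 5 / (819200 * (n + 4) * R * 2 ^ n))
    (hsize : ∀ (Γ : Finset (AddChar G ℂ)) (ρ : ℝ), Γ.card ≤ J * R → 2 * q ^ J ≤ ρ →
      100 * 2 ^ L ≤ ((bohr Γ (ρ * regScale Γ / 8)).card : ℝ))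
    (A : G → Finset G) (hA : IsSkewFreeSystem A)
    (hd : 101 / 100 * (2 ^ L)⁻¹ * (Fintype.card G : ℝ) ^ 2 ≤ ∑ x, ((A x).card : ℝ))
    (j : ℕ) (hj : j ≤ J) :
    ∃ (Γ : Finset (AddChar G ℂ)) (ρ : ℝ) (A' : G → Finset G), Γ.card ≤ j * R ∧ 2 * q ^ j ≤ ρ ∧
      ρ ≤ 2 ∧ IsRegBohr Γ ρ ∧ (∀ x, A' x ⊆ bohr Γ ρ) ∧ IsSkewFreeSystem A' ∧
      (21 / 20) ^ j * (101 / 100 * (2 ^ L)⁻¹) * ((bohr Γ ρ).card : ℝ) ^ 2 ≤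
        ∑ x ∈ bohr Γ ρ, ((A' x).card : ℝ) := by
  have hα0 : (0 : ℝ) < 101 / 100 * (2 ^ L)⁻¹ :=
    mul_pos (by norm_num) (inv_pos.2 (pow_pos two_pos _))
  induction j with
  | zero =>
    refine ⟨∅, 2, A, ?_, ?_, le_rfl, ?_, ?_, hA, ?_⟩
    · rw [Finset.card_empty]; exact Nat.zero_le _
    · rw [pow_zero, mul_one]
    · rw [IsRegBohr, bohr_of_two_le le_rfl, bohr_of_two_le]
      · have : (0 : ℝ) ≤ (Finset.univ : Finset G).card := Nat.cast_nonneg _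
        linarith
      · have := regScale_pos (∅ : Finset (AddChar G ℂ))
        linarith
    · rw [bohr_of_two_le le_rfl]
      exact fun x => Finset.subset_univ _
    · rw [bohr_of_two_le le_rfl, pow_zero, one_mul, Finset.card_univ]
      exact hd
  | succ j ih =>
    obtain ⟨Γ, ρ, A', h1, h2, h3, h4, h5, h6, h7⟩ := ih (Nat.le_of_succ_le hj)
    have hΓ : Γ.card ≤ J * R := h1.trans (Nat.mul_le_mul_right R (Nat.le_of_succ_le hj))
    have hρ : 0 < ρ := lt_of_lt_of_le (mul_pos two_pos (pow_pos hq0 j)) h2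
    have hρJ : 2 * q ^ J ≤ ρ := by
      have := pow_le_pow_of_le_one hq0.le hq1 (Nat.le_of_succ_le hj)
      linarith
    have hα : 101 / 100 * (2 ^ L)⁻¹ ≤ (21 / 20 : ℝ) ^ j * (101 / 100 * (2 ^ L)⁻¹) :=
      le_mul_of_one_le_left hα0.le (one_le_pow₀ (by norm_num))
    obtain ⟨Λ, ρ', A'', g1, g2, g3, g4, g5, g6, g7⟩ := exists_increment L hL Γ ρ hρ h3 h4 A' h6 h5
      (hsize Γ ρ hΓ hρJ) _ hα h7 n hn R hR
    refine ⟨Γ ∪ Λ, ρ', A'', ?_, ?_, g3.trans h3, g4, g5, g6, ?_⟩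
    · refine (Finset.card_union_le _ _).trans ?_
      rw [Nat.succ_mul]
      exact Nat.add_le_add h1 g1
    · rw [mul_div_assoc] at g2
      refine le_trans ?_ g2
      rw [pow_succ, ← mul_assoc]
      exact mul_le_mul h2 (hq Γ hΓ) hq0.le hρ.le
    · rw [pow_succ', mul_assoc (21 / 20)]
      exact g7

lemma not_dense_of_increment (L : ℕ) (hL : 1 ≤ L) (n : ℕ) (hn : n = 90 * L ^ 2 + 1) (R : ℕ)
    (hR : R = 4000000 * (n + 4) ^ 4) (q : ℝ) (hq0 : 0 < q) (hq1 : q ≤ 1)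
    (hq : ∀ Γ : Finset (AddChar G ℂ), Γ.card ≤ 15 * L * R →
      q ≤ regScale Γ ^ 5 / (819200 * (n + 4) * R * 2 ^ n))
    (hsize : ∀ (Γ : Finset (AddChar G ℂ)) (ρ : ℝ), Γ.card ≤ 15 * L * R → 2 * q ^ (15 * L) ≤ ρ →
      100 * 2 ^ L ≤ ((bohr Γ (ρ * regScale Γ / 8)).card : ℝ))
    (A : G → Finset G) (hA : IsSkewFreeSystem A) :
    ∑ x, ((A x).card : ℝ) < 101 / 100 * (2 ^ L)⁻¹ * (Fintype.card G : ℝ) ^ 2 := by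
  by_contra hd
  obtain ⟨Γ, ρ, A', -, h2, -, -, h5, -, h7⟩ := exists_iterated_increment L hL n hn R hR (15 * L) q
    hq0 hq1 hq hsize A hA (not_lt.1 hd) (15 * L) le_rfl
  have hρ : 0 < ρ := lt_of_lt_of_le (mul_pos two_pos (pow_pos hq0 _)) h2
  have hB0 : (0 : ℝ) < (bohr Γ ρ).card := card_bohr_pos hρ.le
  have h8 := h7.trans (sum_card_le_sq h5)
  have h9 : (2 : ℝ) ^ L ≤ (21 / 20) ^ (15 * L) := by
    rw [pow_mul]
    exact pow_le_pow_left₀ zero_le_two (by norm_num) L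
  have h10 : (101 / 100 : ℝ) ≤ (21 / 20) ^ (15 * L) * (101 / 100 * (2 ^ L)⁻¹) := by
    have h2L : (0 : ℝ) < 2 ^ L := pow_pos two_pos L
    have h11 := mul_le_mul_of_nonneg_right h9 (mul_pos (by norm_num : (0 : ℝ) < 101 / 100)
      (inv_pos.2 h2L)).le
    refine le_trans (le_of_eq ?_) h11
    rw [mul_left_comm, mul_inv_cancel₀ h2L.ne', mul_one]
  have h12 := (mul_le_mul_of_nonneg_right h10 (sq_nonneg _)).trans h8
  have : (0 : ℝ) < ((bohr Γ ρ).card : ℝ) ^ 2 := pow_pos hB0 2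
  linarith

omit [Fintype G] in
lemma inv_two_pow_le_regScale (L R n : ℕ) (hn : n + 4 ≤ 2 ^ (7 + 2 * L))
    (hR : R = 4000000 * (n + 4) ^ 4) (Γ : Finset (AddChar G ℂ)) (hΓ : Γ.card ≤ 15 * L * R) :
    ((2 : ℝ) ^ (65 + 9 * L))⁻¹ ≤ regScale Γ ∧ R ≤ 2 ^ (50 + 8 * L) := by
  have hR2 : R ≤ 2 ^ (50 + 8 * L) := by
    rw [hR, show 50 + 8 * L = 22 + (7 + 2 * L) * 4 by ring, pow_add, pow_mul]
    exact Nat.mul_le_mul (by norm_num) (Nat.pow_le_pow_left hn 4)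
  refine ⟨?_, hR2⟩
  have h1 : 15 * L * R ≤ 2 ^ (54 + 9 * L) := by
    rw [show 54 + 9 * L = 4 + L + (50 + 8 * L) by ring, pow_add, pow_add]
    exact Nat.mul_le_mul (Nat.mul_le_mul (by norm_num) Nat.lt_two_pow_self.le) hR2
  have h2 : 1000 * (Γ.card + 1) ≤ 2 ^ (65 + 9 * L) := by
    rw [show 65 + 9 * L = 10 + ((54 + 9 * L) + 1) by ring, pow_add 2 10, pow_succ]
    refine Nat.mul_le_mul (by norm_num) ?_
    have : 1 ≤ 2 ^ (54 + 9 * L) := Nat.one_le_two_pow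
    omega
  rw [regScale, ← one_div]
  refine one_div_le_one_div_of_le ?_ (by exact_mod_cast h2)
  have : (0 : ℝ) ≤ Γ.card := Nat.cast_nonneg _
  linarith

lemma le_card_bohr_of_le_card {Γ : Finset (AddChar G ℂ)} {d k : ℕ} {M ρ : ℝ} (hΓ : Γ.card ≤ d)
    (hG : M * 2 ^ (7 * (k * d)) ≤ (Fintype.card G : ℝ)) (hρ : 2 / 2 ^ k ≤ ρ) :
    M ≤ ((bohr Γ ρ).card : ℝ) := by
  have h1 := card_le_card_bohr Γ k
  have h2 : (81 : ℝ) ^ (k * Γ.card) ≤ 2 ^ (7 * (k * d)) := by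
    rw [pow_mul 2 7]
    exact (pow_le_pow_right₀ (by norm_num) (Nat.mul_le_mul_left k hΓ)).trans
      (pow_le_pow_left₀ (by norm_num) (by norm_num) _)
  have h3 := hG.trans (h1.trans (mul_le_mul_of_nonneg_right h2 (Nat.cast_nonneg _)))
  rw [mul_comm] at h3
  exact (le_of_mul_le_mul_left h3 (pow_pos two_pos _)).trans (card_bohr_mono hρ)

lemma iteration_exponent_le (L n R : ℕ) (hL : 1 ≤ L) (hn : n = 90 * L ^ 2 + 1)
    (hR : R = 4000000 * (n + 4) ^ 4) :
    7 + L + 7 * (8297 * L ^ 3 * (15 * L * R)) ≤ 3 * 10 ^ 20 * L ^ 12 := by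
  have h1 : n + 4 ≤ 95 * L ^ 2 := by nlinarith
  have h2 : R ≤ 4000000 * (95 * L ^ 2) ^ 4 := by
    rw [hR]; exact Nat.mul_le_mul_left _ (Nat.pow_le_pow_left h1 4)
  have h3 : 7 * (8297 * L ^ 3 * (15 * L * R)) ≤
      7 * (8297 * L ^ 3 * (15 * L * (4000000 * (95 * L ^ 2) ^ 4))) := by gcongr
  have h4 : 7 * (8297 * L ^ 3 * (15 * L * (4000000 * (95 * L ^ 2) ^ 4))) =
      283834250962500000000 * L ^ 12 := by ring
  have h5 : L ≤ L ^ 12 := Nat.le_self_pow (by norm_num) L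
  omega

/-- A skew-corner-free system in a finite abelian group of order at least
`2 ^ (3 * 10 ^ 20 * L ^ 12)` has density less than `1.01 * 2 ^ (-L)`. -/
theorem sum_card_lt_of_isSkewFreeSystem (L : ℕ) (hL : 1 ≤ L)
    (hG : (2 : ℝ) ^ (3 * 10 ^ 20 * L ^ 12) ≤ (Fintype.card G : ℝ)) (A : G → Finset G)
    (hA : IsSkewFreeSystem A) :
    ∑ x, ((A x).card : ℝ) < 101 / 100 * (2 ^ L)⁻¹ * (Fintype.card G : ℝ) ^ 2 := by
  obtain ⟨n, hn⟩ : ∃ n, n = 90 * L ^ 2 + 1 := ⟨_, rfl⟩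
  obtain ⟨R, hR⟩ : ∃ R, R = 4000000 * (n + 4) ^ 4 := ⟨_, rfl⟩
  have hexp := iteration_exponent_le L n R hL hn hR
  have hn4 : n + 4 ≤ 2 ^ (7 + 2 * L) := by
    have h1 : n + 4 ≤ 95 * L ^ 2 := by nlinarith
    have h2 : L ^ 2 ≤ 2 ^ (2 * L) := by
      rw [mul_comm, pow_mul]
      exact Nat.pow_le_pow_left Nat.lt_two_pow_self.le 2
    rw [pow_add]
    exact h1.trans (Nat.mul_le_mul (by norm_num) h2)
  have hbig : (100 : ℝ) * 2 ^ L * 2 ^ (7 * (8297 * L ^ 3 * (15 * L * R))) ≤ Fintype.card G := by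
    refine le_trans ?_ ((pow_le_pow_right₀ one_le_two hexp).trans hG)
    rw [pow_add, pow_add]
    exact mul_le_mul_of_nonneg_right (mul_le_mul_of_nonneg_right (by norm_num)
      (pow_pos two_pos _).le) (pow_pos two_pos _).le
  have hk : 548 * L ^ 2 * (15 * L) + (65 + 9 * L) + 3 ≤ 8297 * L ^ 3 := by
    have h1 : L ≤ L ^ 3 := Nat.le_self_pow (by norm_num) L
    have h2 : 548 * L ^ 2 * (15 * L) = 8220 * L ^ 3 := by ring
    omega
  have hq0 : (0 : ℝ) < (2 ^ (548 * L ^ 2))⁻¹ := inv_pos.2 (pow_pos two_pos _)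
  refine not_dense_of_increment L hL n hn R hR (2 ^ (548 * L ^ 2))⁻¹ hq0
    (inv_le_one_of_one_le₀ (one_le_pow₀ one_le_two)) ?_ ?_ A hA
  · intro Γ hΓ
    obtain ⟨h1, h2⟩ := inv_two_pow_le_regScale L R n hn4 hR Γ hΓ
    have hn0 : (0 : ℝ) < n + 4 := by
      have : (0 : ℝ) ≤ n := Nat.cast_nonneg _
      linarith
    have hR0 : (0 : ℝ) < R := by
      rw [hR]
      exact Nat.cast_pos.2 (Nat.mul_pos (by norm_num) (pow_pos (Nat.succ_pos _) _))
    have h3 : (819200 : ℝ) * (n + 4) * R * 2 ^ n ≤ 2 ^ (20 + (7 + 2 * L) + (50 + 8 * L) + n) := by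
      rw [pow_add, pow_add, pow_add]
      refine mul_le_mul_of_nonneg_right (mul_le_mul (mul_le_mul (by norm_num)
        (by exact_mod_cast hn4)
        hn0.le (pow_pos two_pos _).le) (by exact_mod_cast h2) hR0.le
        (mul_pos (pow_pos two_pos _) (pow_pos two_pos _)).le) (pow_pos two_pos _).le
    have h4 := pow_le_pow_left₀ (inv_pos.2 (pow_pos two_pos _)).le h1 5
    have h5 : 20 + (7 + 2 * L) + (50 + 8 * L) + n + (65 + 9 * L) * 5 ≤ 548 * L ^ 2 := by
      have h6 : L ≤ L ^ 2 := Nat.le_self_pow (by norm_num) L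
      omega
    rw [le_div_iff₀ (mul_pos (mul_pos (mul_pos (by norm_num) hn0) hR0) (pow_pos two_pos _))]
    refine le_trans ?_ h4
    refine (mul_le_mul_of_nonneg_left h3 hq0.le).trans ?_
    rw [inv_pow, ← pow_mul, ← one_div, ← one_div, div_mul_eq_mul_div, one_mul,
      div_le_div_iff₀ (pow_pos two_pos _) (pow_pos two_pos _), one_mul, ← pow_add]
    exact pow_le_pow_right₀ one_le_two h5
  · intro Γ ρ hΓ hρ
    obtain ⟨h1, -⟩ := inv_two_pow_le_regScale L R n hn4 hR Γ hΓ
    refine le_card_bohr_of_le_card hΓ hbig ?_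
    have h2 := mul_le_mul hρ h1 (inv_pos.2 (pow_pos two_pos _)).le
      ((mul_pos two_pos (pow_pos hq0 _)).le.trans hρ)
    have h3 : (2 : ℝ) * ((2 ^ (548 * L ^ 2))⁻¹) ^ (15 * L) * (2 ^ (65 + 9 * L))⁻¹ / 8 =
        2 / 2 ^ (548 * L ^ 2 * (15 * L) + (65 + 9 * L) + 3) := by
      rw [pow_add _ _ 3, pow_add _ (548 * L ^ 2 * (15 * L)), inv_pow, ← pow_mul,
        show (2 : ℝ) ^ 3 = 8 by norm_num, ← div_eq_mul_inv,
        ← div_eq_mul_inv, div_div, div_div, ← mul_assoc]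
    refine le_trans ?_ (div_le_div_of_nonneg_right h2 (by norm_num))
    rw [h3]
    exact div_le_div_of_nonneg_left zero_le_two (pow_pos two_pos _)
      (pow_le_pow_right₀ one_le_two hk)

end Iteration

section Integers

/-- The fibres of the reduction modulo `N` of a planar set of integer points. -/
def residueFibre (N : ℕ) [NeZero N] (A : Set (ℤ × ℤ)) (x : ZMod N) : Finset (ZMod N) :=
  Finset.univ.filter fun y => ∃ a b : ℤ, (a, b) ∈ A ∧ (a : ZMod N) = x ∧ (b : ZMod N) = y

lemma mem_residueFibre {N : ℕ} [NeZero N] {A : Set (ℤ × ℤ)} {x y : ZMod N} :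
    y ∈ residueFibre N A x ↔ ∃ a b : ℤ, (a, b) ∈ A ∧ (a : ZMod N) = x ∧ (b : ZMod N) = y := by
  rw [residueFibre, Finset.mem_filter]
  exact ⟨fun h => h.2, fun h => ⟨Finset.mem_univ _, h⟩⟩

lemma eq_of_intCast_eq {n : ℕ} {a b : ℤ} (h : (a : ZMod (3 * n)) = b) (h1 : a - b < 3 * n)
    (h2 : b - a < 3 * n) : a = b := by
  rw [ZMod.intCast_eq_intCast_iff_dvd_sub] at h
  have h3 : b - a = 0 := Int.eq_zero_of_abs_lt_dvd h (by
    push_cast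
    exact abs_lt.2 ⟨by linarith, h2⟩)
  linarith

variable {n : ℕ} {A : Set (ℤ × ℤ)}

lemma isSkewFreeSystem_residueFibre [NeZero (3 * n)]
    (hA : A ⊆ (Set.Icc (1 : ℤ) n) ×ˢ (Set.Icc (1 : ℤ) n)) (hfree : IsSkewCornerFree A) :
    IsSkewFreeSystem (residueFibre (3 * n) A) := by
  rintro x z hxz ⟨w, hw⟩ y hy hy'
  obtain ⟨a, b, hab, rfl, rfl⟩ := mem_residueFibre.1 hy
  obtain ⟨a', b', hab', ha', hb'⟩ := mem_residueFibre.1 hy'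
  obtain ⟨c, d, hcd, rfl, rfl⟩ := mem_residueFibre.1 hw
  obtain ⟨⟨p1, p2⟩, p3, p4⟩ := hA hab
  obtain ⟨⟨q1, q2⟩, q3, q4⟩ := hA hab'
  obtain ⟨⟨r1, r2⟩, r3, r4⟩ := hA hcd
  dsimp only at *
  obtain rfl : a' = a := eq_of_intCast_eq ha' (by linarith) (by linarith)
  obtain rfl : b' = b + (c - a') := by
    refine eq_of_intCast_eq (n := n) ?_ (by linarith) (by linarith)
    rw [hb']
    push_cast
    rfl
  have h0 := hfree a' b d (c - a') hab hab' (by rw [add_sub_cancel]; exact hcd)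
  exact hxz (by rw [sub_eq_zero.1 h0])

lemma finite_of_subset_box (hA : A ⊆ (Set.Icc (1 : ℤ) n) ×ˢ (Set.Icc (1 : ℤ) n)) : A.Finite :=
  ((Set.finite_Icc _ _).prod (Set.finite_Icc _ _)).subset hA

lemma card_le_sum_residueFibre [NeZero (3 * n)]
    (hA : A ⊆ (Set.Icc (1 : ℤ) n) ×ˢ (Set.Icc (1 : ℤ) n)) :
    (Nat.card A : ℝ) ≤ ∑ x, ((residueFibre (3 * n) A x).card : ℝ) := by
  have hfin := finite_of_subset_box hA
  have h1 : Nat.card A = hfin.toFinset.card := by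
    rw [Nat.card_coe_set_eq, Set.ncard_eq_toFinset_card A hfin]
  rw [h1, ← Nat.cast_sum, ← Finset.card_sigma]
  refine Nat.cast_le.2 (Finset.card_le_card_of_injOn
    (fun p => ⟨(p.1 : ZMod (3 * n)), (p.2 : ZMod (3 * n))⟩) ?_ ?_)
  · rintro ⟨a, b⟩ hp
    exact Finset.mem_sigma.2 ⟨Finset.mem_univ _,
      mem_residueFibre.2 ⟨a, b, hfin.mem_toFinset.1 hp, rfl, rfl⟩⟩
  · rintro ⟨a, b⟩ hp ⟨c, d⟩ hq h
    obtain ⟨⟨p1, p2⟩, p3, p4⟩ := hA (hfin.mem_toFinset.1 hp)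
    obtain ⟨⟨q1, q2⟩, q3, q4⟩ := hA (hfin.mem_toFinset.1 hq)
    dsimp only at *
    rw [Sigma.mk.injEq, heq_eq_eq] at h
    rw [Prod.mk.injEq]
    exact ⟨eq_of_intCast_eq h.1 (by linarith) (by linarith),
      eq_of_intCast_eq h.2 (by linarith) (by linarith)⟩

lemma card_lt_of_isSkewCornerFree (hn : 1 ≤ n) (L : ℕ) (hL : 1 ≤ L)
    (hnL : (2 : ℝ) ^ (3 * 10 ^ 20 * L ^ 12) ≤ n)
    (hA : A ⊆ (Set.Icc (1 : ℤ) n) ×ˢ (Set.Icc (1 : ℤ) n)) (hfree : IsSkewCornerFree A) :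
    (Nat.card A : ℝ) < 10 * (2 ^ L)⁻¹ * (n : ℝ) ^ 2 := by
  have : NeZero (3 * n) := ⟨by omega⟩
  have hn0 : (1 : ℝ) ≤ n := Nat.one_le_cast.2 hn
  have hc : (Fintype.card (ZMod (3 * n)) : ℝ) = 3 * n := by
    rw [ZMod.card]; push_cast; rfl
  have h1 := sum_card_lt_of_isSkewFreeSystem (G := ZMod (3 * n)) L hL
    (hnL.trans (by rw [hc]; linarith)) _ (isSkewFreeSystem_residueFibre hA hfree)
  rw [hc] at h1
  have h2 := (card_le_sum_residueFibre hA).trans_lt h1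
  have h3 : 0 < ((2 : ℝ) ^ L)⁻¹ * (n : ℝ) ^ 2 :=
    mul_pos (inv_pos.2 (pow_pos two_pos _)) (pow_pos (by linarith) _)
  linarith

lemma card_le_sq_sub_one (hn : 2 ≤ n) (hA : A ⊆ (Set.Icc (1 : ℤ) n) ×ˢ (Set.Icc (1 : ℤ) n))
    (hfree : IsSkewCornerFree A) : (Nat.card A : ℝ) ≤ (n : ℝ) ^ 2 - 1 := by
  have hn' : (2 : ℤ) ≤ n := by exact_mod_cast hn
  have hne : A ≠ (Set.Icc (1 : ℤ) n) ×ˢ (Set.Icc (1 : ℤ) n) := by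
    rintro rfl
    refine one_ne_zero (hfree 1 1 1 1 ?_ ?_ ?_) <;>
      exact ⟨⟨by norm_num, by norm_num; linarith⟩, by norm_num, by norm_num; linarith⟩
  have h1 := Set.ncard_lt_ncard (hA.ssubset_of_ne hne)
    ((Set.finite_Icc _ _).prod (Set.finite_Icc _ _))
  rw [Set.ncard_prod, ← Finset.coe_Icc, Set.ncard_coe_finset, Int.card_Icc,
    show ((n : ℤ) + 1 - 1).toNat = n by omega] at h1
  rw [Nat.card_coe_set_eq]
  have h2 : A.ncard + 1 ≤ n ^ 2 := by rw [sq]; exact h1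
  have h3 : (A.ncard : ℝ) + 1 ≤ (n : ℝ) ^ 2 := by exact_mod_cast h2
  linarith

lemma ten_mul_inv_two_pow_le {L : ℕ} (hL : 8 ≤ L) {v : ℝ} (hv : v ≤ (L + 1) / 10) :
    10 * ((2 : ℝ) ^ L)⁻¹ ≤ Real.exp (-v) := by
  have h1 : Real.exp (1 / 10) ≤ 6 / 5 := by
    have h2 : Real.exp (1 / 10) ^ 10 ≤ (6 / 5) ^ 10 := by
      rw [← Real.exp_nat_mul]
      have := Real.exp_one_lt_d9
      norm_num at this ⊢
      linarith
    exact le_of_pow_le_pow_left₀ (by norm_num) (by norm_num) h2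
  have h3 : Real.exp v ≤ (6 / 5) ^ (L + 1) := by
    refine (Real.exp_le_exp.2 hv).trans ?_
    rw [show ((L : ℝ) + 1) / 10 = ((L + 1 : ℕ) : ℝ) * (1 / 10) by push_cast; ring,
      Real.exp_nat_mul]
    exact pow_le_pow_left₀ (Real.exp_pos _).le h1 _
  have h4 : (12 : ℝ) ≤ (5 / 3) ^ L :=
    le_trans (by norm_num) (pow_le_pow_right₀ (by norm_num : (1 : ℝ) ≤ 5 / 3) hL)
  have h5 : (2 : ℝ) ^ L = (5 / 3) ^ L * (6 / 5) ^ L := by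
    rw [← mul_pow]; norm_num
  have h6 : 10 * Real.exp v ≤ 2 ^ L := by
    have h7 : (0 : ℝ) < (6 / 5) ^ L := pow_pos (by norm_num) _
    rw [pow_succ] at h3
    have := mul_le_mul_of_nonneg_right h4 h7.le
    linarith
  rw [Real.exp_neg, ← div_eq_mul_inv, ← one_div, div_le_div_iff₀ (pow_pos two_pos _)
    (Real.exp_pos _), one_mul]
  exact h6

lemma two_pow_le_of_le {n L : ℕ} {u : ℝ} (hn : 1 ≤ n) (hu : u ^ 12 = Real.log n)
    (hL : (L : ℝ) ≤ u / 100) : (2 : ℝ) ^ (3 * 10 ^ 20 * L ^ 12) ≤ n := by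
  have hn0 : (0 : ℝ) < n := Nat.cast_pos.2 hn
  obtain ⟨m, hm⟩ : ∃ m, m = 3 * 10 ^ 20 * L ^ 12 := ⟨_, rfl⟩
  rw [← hm]
  have h1 : (2 : ℝ) ^ m ≤ Real.exp m := by
    rw [← mul_one (m : ℝ), Real.exp_nat_mul]
    refine pow_le_pow_left₀ zero_le_two ?_ m
    have := Real.add_one_le_exp 1
    linarith
  refine h1.trans ((Real.exp_le_exp.2 ?_).trans_eq (Real.exp_log hn0))
  have h2 : (100 * (L : ℝ)) ^ 12 ≤ u ^ 12 :=
    pow_le_pow_left₀ (mul_nonneg (by norm_num) (Nat.cast_nonneg _)) (by linarith) 12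
  have h3 : (0 : ℝ) ≤ (L : ℝ) ^ 12 := pow_nonneg (Nat.cast_nonneg _) 12
  rw [mul_pow] at h2
  rw [← hu, hm, Nat.cast_mul, Nat.cast_pow]
  refine le_trans (mul_le_mul_of_nonneg_right ?_ h3) h2
  norm_num

lemma card_le_of_large (hn : 1 ≤ n) {u : ℝ} (hu800 : 800 ≤ u) (hu : u ^ 12 = Real.log n) {c : ℝ}
    (hc : c ≤ 1 / 1000) (hA : A ⊆ (Set.Icc (1 : ℤ) n) ×ˢ (Set.Icc (1 : ℤ) n))
    (hfree : IsSkewCornerFree A) : (Nat.card A : ℝ) ≤ Real.exp (-(c * u)) * (n : ℝ) ^ 2 := by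
  have hu0 : 0 ≤ u := by linarith
  have hL : (⌊u / 100⌋₊ : ℝ) ≤ u / 100 := Nat.floor_le (by linarith)
  have hL' : u / 100 < ⌊u / 100⌋₊ + 1 := Nat.lt_floor_add_one _
  have hL8 : 8 ≤ ⌊u / 100⌋₊ := Nat.le_floor (by push_cast; linarith)
  obtain ⟨L, hLdef⟩ : ∃ L, L = ⌊u / 100⌋₊ := ⟨_, rfl⟩
  rw [← hLdef] at hL hL' hL8
  have h1 := card_lt_of_isSkewCornerFree hn L (by linarith) (two_pow_le_of_le hn hu hL) hA hfree
  have h2 : c * u ≤ (L + 1) / 10 := by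
    have := mul_le_mul_of_nonneg_right hc hu0
    linarith
  exact h1.le.trans (mul_le_mul_of_nonneg_right (ten_mul_inv_two_pow_le hL8 h2) (sq_nonneg _))

lemma card_le_of_small (hn : 2 ≤ n) {u M : ℝ} (hu0 : 0 ≤ u) (hu800 : u ≤ 800) (hM : n ≤ M) {c : ℝ}
    (hc : c ≤ 1 / (800 * M ^ 2)) (hA : A ⊆ (Set.Icc (1 : ℤ) n) ×ˢ (Set.Icc (1 : ℤ) n))
    (hfree : IsSkewCornerFree A) : (Nat.card A : ℝ) ≤ Real.exp (-(c * u)) * (n : ℝ) ^ 2 := by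
  have hn0 : (0 : ℝ) < n := Nat.cast_pos.2 (by omega)
  have hn2 : (0 : ℝ) < (n : ℝ) ^ 2 := pow_pos hn0 2
  have hM2 : (n : ℝ) ^ 2 ≤ M ^ 2 := pow_le_pow_left₀ hn0.le hM 2
  have h1 : c * u ≤ 1 / (n : ℝ) ^ 2 := by
    have h2 : c * u ≤ 1 / (800 * M ^ 2) * 800 :=
      (mul_le_mul_of_nonneg_right hc hu0).trans (mul_le_mul_of_nonneg_left hu800
        (div_nonneg zero_le_one (mul_nonneg (by norm_num) (sq_nonneg M))))
    refine h2.trans ?_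
    have h3 : 0 < M ^ 2 := lt_of_lt_of_le hn2 hM2
    rw [div_mul_eq_mul_div, one_mul, div_mul_eq_div_div, div_self (by norm_num)]
    exact one_div_le_one_div_of_le hn2 hM2
  have h4 : 1 - 1 / (n : ℝ) ^ 2 ≤ Real.exp (-(c * u)) := by
    have := Real.add_one_le_exp (-(c * u))
    linarith
  refine (card_le_sq_sub_one hn hA hfree).trans
    (le_of_eq_of_le ?_ (mul_le_mul_of_nonneg_right h4 hn2.le))
  rw [sub_mul, one_mul, one_div, inv_mul_cancel₀ hn2.ne']

end Integers

theorem statement0 :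
    ∃ c : ℝ, 0 < c ∧ ∀ n : ℕ, 2 ≤ n → ∀ A : Set (ℤ × ℤ),
      A ⊆ (Set.Icc (1 : ℤ) n) ×ˢ (Set.Icc (1 : ℤ) n) →
      IsSkewCornerFree A →
      (Nat.card A : ℝ) ≤ Real.exp (-c * Real.log n ^ ((1 : ℝ) / 12)) * n ^ 2 := by
  obtain ⟨M, hM⟩ : ∃ M, M = Real.exp (800 ^ 12) := ⟨_, rfl⟩
  have hM0 : 0 < M := hM ▸ Real.exp_pos _
  refine ⟨min (1 / 1000) (1 / (800 * M ^ 2)), lt_min (by norm_num)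
    (div_pos one_pos (mul_pos (by norm_num) (pow_pos hM0 2))), fun n hn A hA hfree => ?_⟩
  have hlog : 0 ≤ Real.log n := Real.log_natCast_nonneg n
  obtain ⟨u, hu⟩ : ∃ u, u = Real.log n ^ ((1 : ℝ) / 12) := ⟨_, rfl⟩
  have hu0 : 0 ≤ u := hu ▸ Real.rpow_nonneg hlog _
  have hu12 : u ^ 12 = Real.log n := by
    rw [hu, ← Real.rpow_natCast, ← Real.rpow_mul hlog]
    norm_num
  rw [← hu, neg_mul]
  rcases le_total 800 u with h | h
  · exact card_le_of_large (by omega) h hu12 (min_le_left _ _) hA hfree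
  · refine card_le_of_small hn hu0 h ?_ (min_le_right _ _) hA hfree
    rw [hM, ← Real.exp_log (Nat.cast_pos.2 (by omega) : (0 : ℝ) < n), ← hu12]
    exact Real.exp_le_exp.2 (pow_le_pow_left₀ hu0 h 12)

end SkewPaper
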